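/- arXiv:0810.5205 — 2 statements merged into one kernel-verified Lean document; each statement's English description precedes it below -/
import Mathlib

section
/- Let n ≥ 3 and let α ∈ L_n not be the greatest element of L_n. Suppose there is an even index of α at which applying the applicable elementary operation (E_s or E_c) yields a lexical sequence; let i be the largest such even index and let α′ ∈ L_n be the result of applying that operation at cell i (α′ is obtained by applying one elementary operation on the tail of the longest left sequence of even length which gives a lexical successor in L_n). Set f = α ∧ α′ and suppose f is lexical; let m = 1 + D(f) and write n = md + r with 0 ≤ r < m. If r > 0, then α is adjacent to α′ in L_n. -/
/-!
Common definitions: α-sequences, the lexical order, elementary operations,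
lexical sequences, harmonics, star products, etc.
-/

/-- The sign-alternating sequence `Al(τ)` associated to an α-sequence `τ`
(0-indexed: entry `i` of `Al τ` is `(-1)^i * τ_{i+1}`, and `0` beyond the length). -/
def Al (τ : List ℕ) (i : ℕ) : ℤ := (-1 : ℤ) ^ i * (τ.getD i 0 : ℤ)

/-- The (strict) lexical order: `τ < τ'` iff the first nonzero entry of
`Al τ - Al τ'` is negative. -/
def lexLt (τ τ' : List ℕ) : Prop :=
  ∃ i, (∀ j < i, Al τ j = Al τ' j) ∧ Al τ i < Al τ' i

/-- An α-sequence: a nonempty finite sequence of positive integers. -/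
def IsAlphaSeq (α : List ℕ) : Prop := α ≠ [] ∧ ∀ x ∈ α, 0 < x

/-- `Aset n` is the set `A_n` of α-sequences of degree `n`. -/
def Aset (n : ℕ) : Set (List ℕ) := {α | IsAlphaSeq α ∧ α.sum = n}

/-- Splitting operation `E_s` at the (1-indexed) cell `i`:
`(α₁,…,α_{i-1}, α_i - 1, 1, α_{i+1},…,α_k)`. -/
def applyEs (α : List ℕ) (i : ℕ) : List ℕ :=
  α.take (i - 1) ++ [α.getD (i - 1) 0 - 1, 1] ++ α.drop i

/-- `E_s` is applicable at cell `i` iff `1 ≤ i ≤ l(α)` and `α_i > 1`. -/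
def EsApplicable (α : List ℕ) (i : ℕ) : Prop :=
  1 ≤ i ∧ i ≤ α.length ∧ 1 < α.getD (i - 1) 0

/-- Conjugation operation `E_c` at the (1-indexed) cell `i`:
`(α₁,…,α_{i-2}, α_{i-1} + 1, α_{i+1},…,α_k)`. -/
def applyEc (α : List ℕ) (i : ℕ) : List ℕ :=
  α.take (i - 2) ++ [α.getD (i - 2) 0 + 1] ++ α.drop i

/-- `E_c` is applicable at cell `i` iff `2 ≤ i ≤ l(α)` and `α_i = 1`. -/
def EcApplicable (α : List ℕ) (i : ℕ) : Prop :=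
  2 ≤ i ∧ i ≤ α.length ∧ α.getD (i - 1) 0 = 1

/-- `α'` is obtained from `α` by applying one elementary operation (`E_s` or `E_c`)
at the (1-indexed) cell `i`. -/
def ElemOpAt (α : List ℕ) (i : ℕ) (α' : List ℕ) : Prop :=
  (EsApplicable α i ∧ α' = applyEs α i) ∨ (EcApplicable α i ∧ α' = applyEc α i)

/-- `a < b` and `a`, `b` are adjacent in `S`: no element of `S` lies strictly between. -/
def AdjLtIn (S : Set (List ℕ)) (a b : List ℕ) : Prop :=
  lexLt a b ∧ ∀ γ ∈ S, ¬ (lexLt a γ ∧ lexLt γ b)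

/-- An α-sequence is lexical iff it strictly exceeds all of its proper right sequences. -/
def IsLexical (α : List ℕ) : Prop :=
  IsAlphaSeq α ∧ ∀ i, 2 ≤ i → i ≤ α.length → lexLt (α.drop (i - 1)) α

/-- `Lset n` is the set `L_n` of lexical sequences `α` with `1 + D(α) = n`. -/
def Lset (n : ℕ) : Set (List ℕ) := {α | IsLexical α ∧ 1 + α.sum = n}

/-- Add `1` to the last entry of a list. -/
def bumpLast (α : List ℕ) : List ℕ := α.dropLast ++ [α.getD (α.length - 1) 0 + 1]

/-- `α_e`: the even-length modification of `α`. -/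
def seqE (α : List ℕ) : List ℕ := if Even α.length then bumpLast α else α ++ [1]

/-- `α_o`: the odd-length modification of `α`. -/
def seqO (α : List ℕ) : List ℕ := if Even α.length then α ++ [1] else bumpLast α

/-- The `j`-th harmonicSeq: `h_0(α) = α` and `h_j(α) = (h_{j-1}(α))_o h_{j-1}(α)`. -/
def harmonicSeq : ℕ → List ℕ → List ℕ
  | 0, α => α
  | j + 1, α => seqO (harmonicSeq j α) ++ harmonicSeq j α

/-- A sequence is fundamental iff it is not a harmonicSeq `h_j(β)`, `j ≥ 1`,
of any α-sequence `β`. -/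
def IsFundamental (α : List ℕ) : Prop :=
  ∀ β : List ℕ, IsAlphaSeq β → ∀ j, 1 ≤ j → α ≠ harmonicSeq j β

/-- `α^q`: the `q`-fold concatenation of `α` with itself. -/
def nrep (α : List ℕ) (q : ℕ) : List ℕ := (List.replicate q α).flatten

/-- The star product
`α ⋆ β = α_o (α_e)^{β₁-1} α_o (α_e)^{β₂-1} ⋯ α_o (α_e)^{β_k-1} α`. -/
def starProd (α β : List ℕ) : List ℕ :=
  (β.map (fun b => seqO α ++ nrep (seqE α) (b - 1))).flatten ++ α

/-- `α ∧ β`: the longest common left factor, ended by the minimum of the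
first differing entries. -/
def wedge : List ℕ → List ℕ → List ℕ
  | [], _ => []
  | _, [] => []
  | a :: as, b :: bs => if a = b then a :: wedge as bs else [min a b]

/-- `a` is the least element of `S` in the lexical order. -/
def LeastIn (S : Set (List ℕ)) (a : List ℕ) : Prop :=
  a ∈ S ∧ ∀ b ∈ S, b ≠ a → lexLt a b

/-- `a` is the greatest element of `S` in the lexical order. -/
def GreatestIn (S : Set (List ℕ)) (a : List ℕ) : Prop :=
  a ∈ S ∧ ∀ b ∈ S, b ≠ a → lexLt b a

/-- `i` is an even (1-indexed) cell of `α` at which the applicable elementary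
operation yields a lexical sequence. -/
def GoodEvenIndex (α : List ℕ) (i : ℕ) : Prop :=
  Even i ∧ ∃ α', ElemOpAt α i α' ∧ IsLexical α'

/-- `i` is an odd (1-indexed) cell of `α` at which the applicable elementary
operation yields a lexical sequence. -/
def GoodOddIndex (α : List ℕ) (i : ℕ) : Prop :=
  Odd i ∧ ∃ α', ElemOpAt α i α' ∧ IsLexical α'

/-- The successor operation: apply whichever of `E_s`, `E_c` is applicable at
the largest even (1-indexed) index `≤ l(α)`, i.e. on the tail of the longest
left sequence of even length. -/
def succOp (α : List ℕ) : List ℕ :=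
  let i := if Even α.length then α.length else α.length - 1
  if 1 < α.getD (i - 1) 0 then applyEs α i else applyEc α i

/-- Numerical rank of a binary word: comparing ranks is the alternating lexicographic order, in
which an occurrence of `true` reverses the order of what follows it. -/
def rk : List Bool → ℚ
  | [] => 0
  | false :: w => -1 / 2 + rk w / 4
  | true :: w => 1 / 2 - rk w / 4

/-- A word with an even number of `true`s. -/
def Ev (w : List Bool) : Prop := Even (w.count true)

theorem rk_bounds (w : List Bool) : -1 < rk w ∧ rk w < 1 := by
  induction w with
  | nil => simp [rk]
  | cons a w ih => cases a <;> simp only [rk] <;> constructor <;> linarith [ih.1, ih.2]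

theorem rk_false_neg (w : List Bool) : rk (false :: w) < 0 := by
  simp only [rk]; linarith [(rk_bounds w).2]

theorem rk_true_pos (w : List Bool) : 0 < rk (true :: w) := by
  simp only [rk]; linarith [(rk_bounds w).2]

theorem rk_false_lt {x y : List Bool} : rk (false :: x) < rk (false :: y) ↔ rk x < rk y := by
  simp only [rk]; constructor <;> intro h <;> linarith

theorem rk_true_lt {x y : List Bool} : rk (true :: x) < rk (true :: y) ↔ rk y < rk x := by
  simp only [rk]; constructor <;> intro h <;> linarith

theorem rk_false_lt_true (x y : List Bool) : rk (false :: x) < rk (true :: y) :=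
  (rk_false_neg x).trans (rk_true_pos y)

theorem rk_inj : ∀ {x y : List Bool}, rk x = rk y → x = y
  | [], [], _ => rfl
  | [], false :: y, h => by have := rk_false_neg y; rw [← h] at this; simp [rk] at this
  | [], true :: y, h => by have := rk_true_pos y; rw [← h] at this; simp [rk] at this
  | false :: x, [], h => by have := rk_false_neg x; rw [h] at this; simp [rk] at this
  | true :: x, [], h => by have := rk_true_pos x; rw [h] at this; simp [rk] at this
  | false :: x, true :: y, h => absurd h (rk_false_lt_true x y).ne
  | true :: x, false :: y, h => absurd h (rk_false_lt_true y x).ne'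
  | false :: x, false :: y, h => by
    rw [rk_inj (x := x) (y := y)]; simp only [rk] at h; linarith
  | true :: x, true :: y, h => by
    rw [rk_inj (x := x) (y := y)]; simp only [rk] at h; linarith

theorem rk_lt_of_le_of_length {x y : List Bool} (h : rk x ≤ rk y) (hl : x.length ≠ y.length) :
    rk x < rk y :=
  lt_of_le_of_ne h fun e => hl (by rw [rk_inj e])

theorem ev_nil : Ev [] := by simp [Ev]

theorem ev_append {u v : List Bool} : Ev (u ++ v) ↔ (Ev u ↔ Ev v) := by
  simp only [Ev, List.count_append, Nat.even_add]

theorem ev_cons {c : Bool} {v : List Bool} : Ev (c :: v) ↔ (c = true ↔ ¬ Ev v) := by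
  cases c <;> simp [Ev, Nat.even_add_one]

theorem ev_singleton {c : Bool} : Ev [c] ↔ c = false := by
  cases c <;> simp [Ev]

theorem rk_append (u x : List Bool) :
    (Ev u → rk (u ++ x) = rk u + (1 / 4) ^ u.length * rk x) ∧
      (¬ Ev u → rk (u ++ x) = rk u - (1 / 4) ^ u.length * rk x) := by
  induction u with
  | nil => simp [rk, ev_nil]
  | cons a u ih =>
    cases a <;> by_cases h : Ev u <;>
      simp only [h, ev_cons, not_true_eq_false, not_false_eq_true, true_imp_iff, false_imp_iff,
        true_and, and_true, iff_true, iff_false, List.cons_append, rk, List.length_cons,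
        reduceCtorEq] at ih ⊢ <;> rw [ih] <;> ring

theorem rk_append_ev {u : List Bool} (hu : Ev u) (x : List Bool) :
    rk (u ++ x) = rk u + (1 / 4) ^ u.length * rk x := (rk_append u x).1 hu

theorem rk_append_odd {u : List Bool} (hu : ¬ Ev u) (x : List Bool) :
    rk (u ++ x) = rk u - (1 / 4) ^ u.length * rk x := (rk_append u x).2 hu

theorem rk_append_lt_ev {u : List Bool} (hu : Ev u) {x y : List Bool} :
    rk (u ++ x) < rk (u ++ y) ↔ rk x < rk y := by
  have : (0 : ℚ) < (1 / 4) ^ u.length := by positivity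
  rw [rk_append_ev hu, rk_append_ev hu, add_lt_add_iff_left, mul_lt_mul_iff_right₀ this]

theorem rk_append_lt_odd {u : List Bool} (hu : ¬ Ev u) {x y : List Bool} :
    rk (u ++ x) < rk (u ++ y) ↔ rk y < rk x := by
  have : (0 : ℚ) < (1 / 4) ^ u.length := by positivity
  rw [rk_append_odd hu, rk_append_odd hu, sub_lt_sub_iff_left, mul_lt_mul_iff_right₀ this]

/-- An even prefix `y c` is below any word with prefix `y (!c)`. -/
theorem rk_lt_flip {y : List Bool} {c : Bool} (h : Ev (y ++ [c])) (T T' : List Bool) :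
    rk (y ++ c :: T) < rk (y ++ (!c) :: T') := by
  by_cases hy : Ev y
  · rw [rk_append_lt_ev hy]
    cases c
    · exact rk_false_lt_true _ _
    · simp [ev_append, hy, ev_singleton] at h
  · rw [rk_append_lt_odd hy]
    cases c
    · simp [ev_append, hy, ev_singleton] at h
    · exact rk_false_lt_true _ _

theorem ev_flip {y : List Bool} {c : Bool} : Ev (y ++ [!c]) ↔ ¬ Ev (y ++ [c]) := by
  cases c <;> simp [ev_append, ev_singleton]

theorem rk_append_lt_self_ev {y : List Bool} {c : Bool} (h : Ev (y ++ [c])) (T : List Bool) :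
    rk (y ++ c :: T) < rk y := by
  by_cases hy : Ev y
  · conv_rhs => rw [← List.append_nil y]
    rw [rk_append_lt_ev hy]
    cases c
    · exact rk_false_neg _
    · simp [ev_append, hy, ev_singleton] at h
  · conv_rhs => rw [← List.append_nil y]
    rw [rk_append_lt_odd hy]
    cases c
    · simp [ev_append, hy, ev_singleton] at h
    · exact rk_true_pos _

theorem rk_self_lt_append_odd {y : List Bool} {c : Bool} (h : ¬ Ev (y ++ [c])) (T : List Bool) :
    rk y < rk (y ++ c :: T) := by
  by_cases hy : Ev y
  · conv_lhs => rw [← List.append_nil y]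
    rw [rk_append_lt_ev hy]
    cases c
    · simp [ev_append, hy, ev_singleton] at h
    · exact rk_true_pos _
  · conv_lhs => rw [← List.append_nil y]
    rw [rk_append_lt_odd hy]
    cases c
    · exact rk_false_neg _
    · simp [ev_append, hy, ev_singleton] at h

/-- `y` lies strictly between `x` and `z`, in either order. -/
def Mid (x y z : List Bool) : Prop := (rk x < rk y ∧ rk y < rk z) ∨ (rk z < rk y ∧ rk y < rk x)

theorem mid_cons {c : Bool} {x y z : List Bool} :
    Mid (c :: x) (c :: y) (c :: z) ↔ Mid x y z := by
  cases c <;> simp only [Mid, rk_false_lt, rk_true_lt]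
  tauto

theorem mid_cons_exists {c : Bool} {x y z : List Bool} (h : Mid (c :: x) z (c :: y)) :
    ∃ t, z = c :: t := by
  have h1 := rk_bounds x
  have h2 := rk_bounds y
  have hx := rk_true_pos x
  have hy := rk_true_pos y
  have gx := rk_false_neg x
  have gy := rk_false_neg y
  rcases z with _ | ⟨d, z⟩
  · cases c
    · simp only [Mid, rk] at h gx gy; rcases h with h | h <;> linarith [h.1, h.2]
    · simp only [Mid, rk] at h hx hy; rcases h with h | h <;> linarith [h.1, h.2]
  · have hz := rk_true_pos z
    have gz := rk_false_neg z
    cases c <;> cases d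
    · exact ⟨_, rfl⟩
    · rcases h with h | h <;> linarith [h.1, h.2]
    · rcases h with h | h <;> linarith [h.1, h.2]
    · exact ⟨_, rfl⟩

/-- Any word strictly between two words with a common prefix has this prefix. -/
theorem sandwich {u x y z : List Bool} (h : Mid (u ++ x) z (u ++ y)) :
    ∃ t, z = u ++ t ∧ Mid x t y := by
  induction u generalizing z with
  | nil => exact ⟨z, rfl, h⟩
  | cons c u ih =>
    obtain ⟨t, rfl⟩ := mid_cons_exists h
    obtain ⟨t', rfl, h'⟩ := ih (mid_cons.1 h)
    exact ⟨t', rfl, h'⟩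

/-- A word strictly between `u` and `u c ρ` is of the form `u c x'` with `x'` above `ρ`
as soon as `u c` is even, and below it otherwise. -/
theorem mid_self {u t ρ : List Bool} {c : Bool} (h : Mid u t (u ++ c :: ρ)) :
    ∃ x', t = u ++ c :: x' ∧ rk ρ < rk x' := by
  have h' : Mid (u ++ []) t (u ++ c :: ρ) := by simpa using h
  obtain ⟨t', rfl, h2⟩ := sandwich h'
  have h3 := rk_true_pos ρ
  have h4 := rk_false_neg ρ
  have h0 : rk [] = 0 := rfl
  cases c
  · have h5 : rk (false :: ρ) < rk t' ∧ rk t' < 0 := by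
      rcases h2 with h2 | h2
      · rw [h0] at h2; linarith [h2.1, h2.2]
      · rw [h0] at h2; exact h2
    rcases t' with _ | ⟨d, t'⟩
    · simp [h0] at h5
    · cases d
      · exact ⟨t', rfl, rk_false_lt.1 h5.1⟩
      · linarith [h5.2, rk_true_pos t']
  · have h5 : 0 < rk t' ∧ rk t' < rk (true :: ρ) := by
      rcases h2 with h2 | h2
      · rw [h0] at h2; exact h2
      · rw [h0] at h2; linarith [h2.1, h2.2]
    rcases t' with _ | ⟨d, t'⟩
    · simp [h0] at h5
    · cases d
      · linarith [h5.1, rk_false_neg t']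
      · exact ⟨t', rfl, rk_true_lt.1 h5.2⟩

/-- Intermediate value property for words with a prescribed tail. -/
theorem exists_mid_of_drop (t : ℕ) : ∀ (a b ρ : List Bool), t ≤ a.length → t ≤ b.length →
    Mid (a.drop t) ρ (b.drop t) →
    ∃ u : List Bool, u.length = t ∧ ∀ j ≤ t, Mid (a.drop j) ((u ++ ρ).drop j) (b.drop j) := by
  induction t with
  | zero => intro a b ρ _ _ h; exact ⟨[], rfl, fun j hj => by simpa [Nat.le_zero.1 hj] using h⟩
  | succ t ih =>
    intro a b ρ ha hb h
    rcases a with _ | ⟨p, a⟩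
    · simp at ha
    rcases b with _ | ⟨q, b⟩
    · simp at hb
    obtain ⟨u, hu, hj⟩ := ih a b ρ (by simpa using ha) (by simpa using hb) (by simpa using h)
    have h0 := hj 0 (Nat.zero_le _)
    simp only [List.drop_zero] at h0
    obtain ⟨c, hc⟩ : ∃ c, Mid (p :: a) (c :: (u ++ ρ)) (q :: b) := by
      by_cases hpq : p = q
      · subst hpq; exact ⟨p, mid_cons.2 h0⟩
      · cases p <;> cases q <;> simp at hpq
        · rcases h0 with h0 | h0
          · exact ⟨false, Or.inl ⟨rk_false_lt.2 h0.1, rk_false_lt_true _ _⟩⟩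
          · exact ⟨true, Or.inl ⟨rk_false_lt_true _ _, rk_true_lt.2 h0.1⟩⟩
        · rcases h0 with h0 | h0
          · exact ⟨true, Or.inr ⟨rk_false_lt_true _ _, rk_true_lt.2 h0.1⟩⟩
          · exact ⟨false, Or.inr ⟨rk_false_lt.2 h0.1, rk_false_lt_true _ _⟩⟩
    refine ⟨c :: u, by simp [hu], fun j hjt => ?_⟩
    rcases j with _ | j
    · simpa using hc
    · simpa using hj j (by omega)

/-- `x` lies below the infinite power of `E`. -/
def Blw (E x : List Bool) : Prop := rk x < rk (E ++ x)

/-- `x` lies above the infinite power of `E`. -/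
def Abv (E x : List Bool) : Prop := rk (E ++ x) < rk x

theorem pow_length_lt_one {E : List Bool} (hE0 : E ≠ []) : (1 / 4 : ℚ) ^ E.length < 1 :=
  pow_lt_one₀ (by norm_num) (by norm_num) (by simpa using hE0)

/-- The value of the infinite power of `E`. -/
def rkLim (E : List Bool) : ℚ := rk E / (1 - (1 / 4) ^ E.length)

theorem rk_append_eq_rkLim {E : List Bool} (hE : Ev E) (hE0 : E ≠ []) (x : List Bool) :
    rk (E ++ x) = rkLim E + (1 / 4) ^ E.length * (rk x - rkLim E) := by
  have h := pow_length_lt_one hE0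
  have h' : rk E = rkLim E * (1 - (1 / 4) ^ E.length) := by
    rw [rkLim, div_mul_cancel₀]; linarith
  rw [rk_append_ev hE, h']; ring

theorem blw_iff {E : List Bool} (hE : Ev E) (hE0 : E ≠ [])
    {x : List Bool} : Blw E x ↔ rk x < rkLim E := by
  have h := pow_length_lt_one hE0
  rw [Blw, rk_append_eq_rkLim hE hE0]
  constructor <;> intro h' <;> nlinarith

theorem abv_iff {E : List Bool} (hE : Ev E) (hE0 : E ≠ [])
    {x : List Bool} : Abv E x ↔ rkLim E < rk x := by
  have h := pow_length_lt_one hE0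
  rw [Abv, rk_append_eq_rkLim hE hE0]
  constructor <;> intro h' <;> nlinarith

theorem Blw.mono {E : List Bool} (hE : Ev E) (hE0 : E ≠ [])
    {x y : List Bool} (h : Blw E y) (hxy : rk x ≤ rk y) : Blw E x := by
  rw [blw_iff hE hE0] at *; exact hxy.trans_lt h

theorem Abv.mono {E : List Bool} (hE : Ev E) (hE0 : E ≠ [])
    {x y : List Bool} (h : Abv E x) (hxy : rk x ≤ rk y) : Abv E y := by
  rw [abv_iff hE hE0] at *; exact h.trans_le hxy

theorem Blw.lt_abv {E : List Bool} (hE : Ev E) (hE0 : E ≠ [])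
    {x y : List Bool} (h : Blw E x) (h' : Abv E y) : rk x < rk y := by
  rw [blw_iff hE hE0] at h; rw [abv_iff hE hE0] at h'; exact h.trans h'

theorem blw_or_abv {E : List Bool} (hE0 : E ≠ []) (x : List Bool) : Blw E x ∨ Abv E x := by
  rcases lt_trichotomy (rk x) (rk (E ++ x)) with h | h | h
  · exact Or.inl h
  · have := congrArg List.length (rk_inj h)
    simp [hE0] at this
  · exact Or.inr h

theorem blw_append {E : List Bool} (hE : Ev E)
    {x : List Bool} : Blw E (E ++ x) ↔ Blw E x := rk_append_lt_ev hE

theorem abv_append {E : List Bool} (hE : Ev E)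
    {x : List Bool} : Abv E (E ++ x) ↔ Abv E x := rk_append_lt_ev hE

/-- `E ^ k` followed by `T`. -/
def pw (E : List Bool) : ℕ → List Bool → List Bool
  | 0, T => T
  | k + 1, T => E ++ pw E k T

theorem length_pw (E : List Bool) (k : ℕ) (T : List Bool) :
    (pw E k T).length = k * E.length + T.length := by
  induction k with
  | zero => simp [pw]
  | succ k ih => simp [pw, ih]; ring

theorem drop_pw (E : List Bool) (k : ℕ) (T : List Bool) :
    (pw E k T).drop (k * E.length) = T := by
  induction k with
  | zero => simp [pw]
  | succ k ih =>
    rw [pw, Nat.succ_mul, add_comm, ← List.drop_drop, List.drop_left, ih]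

theorem pw_append (E : List Bool) (k : ℕ) (T T' : List Bool) :
    pw E k (T ++ T') = pw E k T ++ T' := by
  induction k with
  | zero => rfl
  | succ k ih => simp [pw, ih]

theorem pw_succ' (E : List Bool) (k : ℕ) (T : List Bool) : pw E (k + 1) T = pw E k (E ++ T) := by
  induction k with
  | zero => rfl
  | succ k ih => rw [pw, ih, pw]

theorem suffix_pw (E : List Bool) (k : ℕ) (T : List Bool) : T <:+ pw E k T := by
  induction k with
  | zero => exact List.suffix_rfl
  | succ k ih => exact ih.trans (List.suffix_append _ _)

theorem blw_pw {E : List Bool} (hE : Ev E)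
    {k : ℕ} {T : List Bool} : Blw E (pw E k T) ↔ Blw E T := by
  induction k with
  | zero => rfl
  | succ k ih => rw [pw, blw_append hE, ih]

theorem le_pw {E : List Bool} (hE : Ev E)
    {T : List Bool} (h : Blw E T) (k : ℕ) : rk T ≤ rk (pw E k T) := by
  induction k with
  | zero => rfl
  | succ k ih => exact ih.trans (((blw_pw hE).2 h : Blw E (pw E k T))).le

theorem lt_pw {E : List Bool} (hE : Ev E)
    {T : List Bool} (h : Blw E T) {k : ℕ} (hk : 1 ≤ k) : rk T < rk (pw E k T) := by
  obtain ⟨k, rfl⟩ := Nat.exists_eq_succ_of_ne_zero (by omega : k ≠ 0)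
  exact (le_pw hE h k).trans_lt ((blw_pw hE).2 h : Blw E (pw E k T))

theorem exists_pw_between {E : List Bool} (hE : Ev E) (hE0 : E ≠ [])
    {a b : List Bool} (ha : Blw E a) (hb : Abv E b) (T : List Bool) :
    ∃ k, rk a < rk (pw E k T) ∧ rk (pw E k T) < rk b := by
  rw [blw_iff hE hE0] at ha
  rw [abv_iff hE hE0] at hb
  have key : ∀ k, rk (pw E k T) = rkLim E + ((1 / 4) ^ E.length) ^ k * (rk T - rkLim E) := by
    intro k
    induction k with
    | zero => simp [pw]
    | succ k ih => rw [pw, rk_append_eq_rkLim hE hE0, ih]; ring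
  set q : ℚ := (1 / 4) ^ E.length with hq
  have hq0 : 0 < q := by positivity
  obtain ⟨ε, hε, hεa, hεb⟩ : ∃ ε : ℚ, 0 < ε ∧ ε ≤ rkLim E - rk a ∧ ε ≤ rk b - rkLim E :=
    ⟨min (rkLim E - rk a) (rk b - rkLim E), lt_min (by linarith) (by linarith),
      min_le_left _ _, min_le_right _ _⟩
  have hc : (0 : ℚ) < |rk T - rkLim E| + 1 := by positivity
  obtain ⟨k, hk⟩ := exists_pow_lt_of_lt_one (div_pos hε hc) (pow_length_lt_one hE0)
  rw [← hq, lt_div_iff₀ hc] at hk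
  have hqk : 0 < q ^ k := by positivity
  have h1 := mul_le_mul_of_nonneg_left (le_abs_self (rk T - rkLim E)) hqk.le
  have h2 := mul_le_mul_of_nonneg_left (neg_abs_le (rk T - rkLim E)) hqk.le
  refine ⟨k, ?_, ?_⟩ <;> rw [key] <;> linarith

/-- Every suffix of `E x` lies below the infinite power of `E`. -/
def Good (E x : List Bool) : Prop := ∀ v, v <:+ E ++ x → Blw E v

/-- Above a good word, prepending suffixes of `E` preserves being below the infinite power. -/
def Lifts (E : List Bool) : Prop :=
  ∀ x T v, Good E x → rk x ≤ rk T → Blw E T → v <:+ E → Blw E (v ++ T)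

theorem suffix_append_cases {v a b : List Bool} (h : v <:+ a ++ b) :
    v <:+ b ∨ ∃ v', v = v' ++ b ∧ v' <:+ a := by
  obtain ⟨u, hu⟩ := h
  rcases List.append_eq_append_iff.1 hu with ⟨c, h1, h2⟩ | ⟨c, h1, h2⟩
  · exact Or.inr ⟨c, h2, u, h1.symm⟩
  · exact Or.inl ⟨c, h2.symm⟩

theorem Good.blw_suffix {E x v : List Bool} (h : Good E x) (hv : v <:+ x) : Blw E v :=
  h v (hv.trans (List.suffix_append _ _))

theorem Lifts.good {E x z : List Bool} (hL : Lifts E) (hx : Good E x) (hxz : rk x ≤ rk z)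
    (hz : ∀ v, v <:+ z → Blw E v) : Good E z := by
  intro v hv
  rcases suffix_append_cases hv with h | ⟨v', rfl, h⟩
  · exact hz v h
  · exact hL x z v' hx hxz (hz z List.suffix_rfl) h

theorem Lifts.blw_suffix_pw {E : List Bool} (hE : Ev E) (hL : Lifts E)
    {x T v : List Bool} (hx : Good E x) (hxT : rk x ≤ rk T)
    (hT : Blw E T) {k : ℕ} (hv : v <:+ pw E k T) (hl : T.length ≤ v.length) : Blw E v := by
  induction k with
  | zero =>
    rw [pw] at hv
    rwa [hv.eq_of_length (le_antisymm hv.length_le hl)]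
  | succ k ih =>
    rcases suffix_append_cases hv with h | ⟨v', rfl, h⟩
    · exact ih h
    · exact hL x _ v' hx (hxT.trans (le_pw hE hT k)) ((blw_pw hE).2 hT) h

theorem Lifts.good_pw {E : List Bool} (hE : Ev E) (hL : Lifts E)
    {x : List Bool} (hx : Good E x) (k : ℕ) : Good E (pw E k x) := by
  have hB : Blw E x := hx.blw_suffix List.suffix_rfl
  refine hL.good hx (le_pw hE hB k) fun v hv => ?_
  rcases le_total x.length v.length with h | h
  · exact hL.blw_suffix_pw hE hx le_rfl hB hv h
  · exact hx.blw_suffix (List.suffix_of_suffix_length_le hv (suffix_pw E k x) h)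

/-- Replacing a suffix `ρ` of a word `w` by a smaller word `ρ'` at the same place while staying
above `x` and below the infinite power. -/
theorem Lifts.replace_suffix {E : List Bool} (hE : Ev E) (hE0 : E ≠ []) (hL : Lifts E)
    {x ρ' w u ρ : List Bool} (hx : Good E x) (h1 : rk x < rk ρ')
    (h2 : Blw E ρ') (hxw : rk x ≤ rk w) (hwB : Blw E w) (hw : w = u ++ ρ) (hu : u ≠ [])
    (h3 : rk ρ' < rk ρ) :
    ∃ u' : List Bool, u'.length = u.length ∧ rk x < rk (u' ++ ρ') ∧ Blw E (u' ++ ρ') ∧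
      ∀ j ≤ u.length, rk ((u' ++ ρ').drop j) < rk (w.drop j) ∨ Blw E ((u' ++ ρ').drop j) := by
  set t := u.length with ht
  have ht1 : 1 ≤ t := List.length_pos_iff.2 hu
  set y := pw E t ρ' with hy
  have hM : 1 ≤ E.length := List.length_pos_iff.2 hE0
  have hyl : y.length = t * E.length + ρ'.length := length_pw E t ρ'
  have hyd : ∀ j ≤ t * E.length, Blw E (y.drop j) := fun j hj =>
    hL.blw_suffix_pw hE hx h1.le h2 (List.drop_suffix j y) (by simp [hyl]; omega)
  have hex : ∃ i, rk (y.drop (t * i)) ≤ rk ρ' := ⟨E.length, by rw [drop_pw]⟩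
  classical
  obtain ⟨i, hi, hmin⟩ : ∃ i, rk (y.drop (t * i)) ≤ rk ρ' ∧
      ∀ j < i, rk ρ' < rk (y.drop (t * j)) :=
    ⟨Nat.find hex, Nat.find_spec hex, fun j hj => not_le.1 (Nat.find_min hex hj)⟩
  have hi0 : i ≠ 0 := by
    rintro rfl
    have := lt_pw hE h2 ht1
    simp only [mul_zero, List.drop_zero] at hi
    exact absurd hi (not_le.2 this)
  have hiM : i ≤ E.length := by
    by_contra h
    have := hmin E.length (by omega)
    rw [drop_pw] at this
    exact lt_irrefl _ this
  obtain ⟨i, rfl⟩ := Nat.exists_eq_succ_of_ne_zero hi0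
  have hb := hmin i (Nat.lt_succ_self _)
  set b := y.drop (t * i) with hbdef
  have hti : t * i + t ≤ t * E.length := by
    calc t * i + t = t * (i + 1) := by ring
      _ ≤ t * E.length := Nat.mul_le_mul_left _ hiM
  have hbl : t ≤ b.length := by rw [hbdef, List.length_drop, hyl]; omega
  have hbt : b.drop t = y.drop (t * (i + 1)) := by
    rw [hbdef, List.drop_drop]; congr 1
  have hbB : ∀ j ≤ t, Blw E (b.drop j) := fun j hj => by
    rw [hbdef, List.drop_drop]; exact hyd _ (by omega)
  have hbB0 : Blw E b := by simpa using hbB 0 (Nat.zero_le _)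
  rw [Nat.succ_eq_add_one, ← hbt] at hi
  rcases hi.eq_or_lt with hi | hi
  · have hbe : b = b.take t ++ ρ' := by rw [← rk_inj hi, List.take_append_drop]
    refine ⟨b.take t, by simp [hbl], ?_, ?_, ?_⟩
    · rw [← hbe]; exact h1.trans hb
    · rw [← hbe]; exact hbB0
    · intro j hj; rw [← hbe]; exact Or.inr (hbB j hj)
  · have hwd : w.drop t = ρ := by rw [hw, ht, List.drop_left]
    obtain ⟨u', hu', hmid⟩ := exists_mid_of_drop t w b ρ' (by simp [hw, ht]) hbl
      (by rw [hwd]; exact Or.inr ⟨hi, h3⟩)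
    have h0 : Mid w (u' ++ ρ') b := by simpa using hmid 0 (Nat.zero_le _)
    refine ⟨u', hu', ?_, ?_, fun j hj => ?_⟩
    · rcases h0 with h0 | h0
      · exact hxw.trans_lt h0.1
      · exact (h1.trans hb).trans h0.1
    · rcases h0 with h0 | h0
      · exact hbB0.mono hE hE0 h0.2.le
      · exact hwB.mono hE hE0 h0.2.le
    · rcases hmid j hj with h | h
      · exact Or.inr ((hbB j hj).mono hE hE0 h.2.le)
      · exact Or.inl h.2

theorem flip_lt_iff {p x y : List Bool} {a : Bool} :
    rk (p ++ a :: x) < rk (p ++ (!a) :: y) ↔ Ev (p ++ [a]) := by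
  refine ⟨fun h => ?_, fun h => rk_lt_flip h x y⟩
  by_contra h'
  have := rk_lt_flip (ev_flip.2 h') y x
  rw [Bool.not_not] at this
  exact lt_asymm h this

theorem prefix_or_diff : ∀ x y : List Bool, x <+: y ∨ y <+: x ∨
    ∃ p a x' y', x = p ++ a :: x' ∧ y = p ++ (!a) :: y'
  | [], y => Or.inl (List.nil_prefix)
  | a :: x, [] => Or.inr (Or.inl (List.nil_prefix))
  | a :: x, b :: y => by
    by_cases hab : b = a
    · subst hab
      rcases prefix_or_diff x y with h | h | ⟨p, c, x', y', rfl, rfl⟩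
      · exact Or.inl ((List.prefix_cons_inj _).2 h)
      · exact Or.inr (Or.inl ((List.prefix_cons_inj _).2 h))
      · exact Or.inr (Or.inr ⟨b :: p, c, x', y', rfl, rfl⟩)
    · refine Or.inr (Or.inr ⟨[], a, x, y, rfl, ?_⟩)
      cases a <;> cases b <;> simp at hab ⊢

/-- A word is lexical if it is nonempty and exceeds all its proper suffixes. -/
def Lx (w : List Bool) : Prop := w ≠ [] ∧ ∀ u v, w = u ++ v → u ≠ [] → rk v < rk w

/-- A lexical word does not start with the square of an odd word. -/
theorem not_lx_odd_square {A z : List Bool} (hA : ¬ Ev A) (h : Lx (A ++ (A ++ z))) : False := by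
  have hA0 : A ≠ [] := by rintro rfl; exact hA ev_nil
  have h1 := h.2 A (A ++ z) rfl hA0
  have h2 := h.2 (A ++ A) z (by simp) (by simp [hA0])
  rw [rk_append_lt_odd hA] at h1
  have hq := pow_length_lt_one hA0
  have hq0 : (0 : ℚ) < (1 / 4) ^ A.length := by positivity
  rw [rk_append_odd hA] at h1 h2
  rw [rk_append_odd hA] at h2
  nlinarith

theorem suffix_concat_cases {v H : List Bool} {s : Bool} (h : v <:+ H ++ [s]) :
    v = [] ∨ ∃ y, v = y ++ [s] ∧ y <:+ H := by
  obtain ⟨u, hu⟩ := h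
  rcases List.eq_nil_or_concat v with rfl | ⟨y, c, rfl⟩
  · exact Or.inl rfl
  · rw [List.concat_eq_append, ← List.append_assoc] at hu
    obtain ⟨h1, h2⟩ := List.append_inj' hu rfl
    simp only [List.cons.injEq, and_true] at h2
    exact Or.inr ⟨y, by rw [List.concat_eq_append, h2], u, h1⟩

theorem crossing_not_prefix {H κ : List Bool} {s : Bool} (hα : Lx (H ++ s :: κ))
    {X y : List Bool} (hH : H = X ++ y) (hX : X ≠ []) (hy : ¬ y <+: H)
    (T T' : List Bool) : rk (y ++ T) < rk (H ++ T') := by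
  have h := hα.2 X (y ++ s :: κ) (by rw [hH, List.append_assoc]) hX
  rcases prefix_or_diff y H with h' | h' | ⟨p, a, y', H', h1, h2⟩
  · exact absurd h' hy
  · have h1 := h'.length_le
    have h2 := List.length_pos_iff.2 hX
    rw [hH, List.length_append] at h1; omega
  · rw [h1, h2] at h ⊢
    simp only [List.append_assoc, List.cons_append] at h ⊢
    rw [flip_lt_iff] at h ⊢
    exact h

theorem prefix_letter {H κ ζ : List Bool} {s : Bool} (hs : Ev (H ++ [s])) (hα : Lx (H ++ s :: κ))
    (hγ : Lx (H ++ (!s) :: ζ)) {X y : List Bool} {c : Bool} (hH : H = X ++ y) (hX : X ≠ [])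
    (hy : y <+: H) (hc : Ev (y ++ [c])) : ∃ z, H = y ++ (!c) :: z := by
  obtain ⟨z, hz⟩ := hy
  rcases z with _ | ⟨d, z⟩
  · have h1 := congrArg List.length hz
    have h2 := congrArg List.length hH
    have := List.length_pos_iff.2 hX
    simp at h1 h2; omega
  by_cases hd : d = !c
  · exact ⟨z, by rw [← hz, hd]⟩
  have hd : d = c := by cases c <;> cases d <;> simp at hd ⊢
  exfalso
  subst hd
  by_cases hcs : d = s
  · subst hcs
    have h := hγ.2 X (y ++ (!d) :: ζ) (by rw [hH, List.append_assoc]) hX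
    conv_rhs at h => rw [← hz, List.append_assoc, List.cons_append]
    exact lt_asymm h (rk_lt_flip hc _ _)
  · have hcs : s = !d := by cases d <;> cases s <;> simp at hcs ⊢
    have h := hα.2 X (y ++ s :: κ) (by rw [hH, List.append_assoc]) hX
    conv_rhs at h => rw [← hz, List.append_assoc, List.cons_append]
    rw [hcs] at h
    exact lt_asymm h (rk_lt_flip hc _ _)

theorem crossing_even {H κ ζ : List Bool} {s : Bool} (hs : Ev (H ++ [s])) (hα : Lx (H ++ s :: κ))
    (hγ : Lx (H ++ (!s) :: ζ)) {X y : List Bool} {c : Bool} (hH : H = X ++ y) (hX : X ≠ [])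
    (hc : Ev (y ++ [c])) (T T' : List Bool) : rk (y ++ c :: T) < rk (H ++ T') := by
  by_cases hy : y <+: H
  · obtain ⟨z, hz⟩ := prefix_letter hs hα hγ hH hX hy hc
    rw [hz, List.append_assoc, List.cons_append]
    exact rk_lt_flip hc _ _
  · exact crossing_not_prefix hα hH hX hy _ _

theorem suffix_lt {H κ ζ : List Bool} {s : Bool} (hs : Ev (H ++ [s])) (hα : Lx (H ++ s :: κ))
    (hγ : Lx (H ++ (!s) :: ζ)) {X y : List Bool} (hH : H = X ++ y) (hX : X ≠ []) (T' : List Bool) :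
    rk y < rk (H ++ T') := by
  by_cases hy : y <+: H
  · obtain ⟨c, hc⟩ : ∃ c, Ev (y ++ [c]) := by
      by_cases h : Ev y
      · exact ⟨false, by simp [ev_append, h, ev_singleton]⟩
      · exact ⟨true, by simp [ev_append, h, ev_singleton]⟩
    obtain ⟨z, hz⟩ := prefix_letter hs hα hγ hH hX hy hc
    rw [hz, List.append_assoc, List.cons_append]
    refine rk_self_lt_append_odd ?_ _
    rw [ev_flip]; exact not_not.2 hc
  · simpa using crossing_not_prefix hα hH hX hy [] T'

theorem lx_head {H κ ζ : List Bool} {s : Bool} (hs : Ev (H ++ [s])) (hα : Lx (H ++ s :: κ))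
    (hγ : Lx (H ++ (!s) :: ζ)) (hH0 : H ≠ []) : Lx H :=
  ⟨hH0, fun _ _ h hu => by simpa using suffix_lt hs hα hγ h hu []⟩

theorem head_ne_nil {H κ ζ : List Bool} {s : Bool} (hs : Ev (H ++ [s])) (hα : Lx (H ++ s :: κ))
    (hγ : Lx (H ++ (!s) :: ζ)) : H ≠ [] := by
  rintro rfl
  have : s = false := by simpa [ev_singleton] using hs
  subst this
  have h := hα.2 (false :: κ) [] (by simp) (by simp)
  have := rk_false_neg κ
  simp [rk] at h this
  linarith

theorem head_start {H κ ζ : List Bool} {s : Bool} (hs : Ev (H ++ [s])) (hα : Lx (H ++ s :: κ))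
    (hγ : Lx (H ++ (!s) :: ζ)) : ∃ H', H = true :: false :: H' := by
  have h0 := head_ne_nil hs hα hγ
  have h1 := (lx_head hs hα hγ h0).2 H [] (by simp) h0
  have hodd : ¬ Ev [true] := by simp [ev_singleton]
  rcases H with _ | ⟨a, _ | ⟨b, H⟩⟩
  · exact absurd rfl h0
  · have := rk_false_neg []
    cases a
    · simp [rk] at h1; linarith
    · cases s
      · simp [Ev] at hs
      · exact (not_lx_odd_square hodd (z := κ) (by simpa using hα)).elim
  · have := rk_false_neg (b :: H)
    cases a
    · have h2 : rk [] = 0 := rfl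
      rw [h2] at h1; linarith
    · cases b
      · exact ⟨H, rfl⟩
      · exact (not_lx_odd_square hodd (z := H)
          (by simpa using lx_head hs hα hγ h0)).elim

theorem lifts {H κ ζ : List Bool} {s : Bool} (hs : Ev (H ++ [s])) (hα : Lx (H ++ s :: κ))
    (hγ : Lx (H ++ (!s) :: ζ)) : Lifts (H ++ [s]) := by
  have hE0 : H ++ [s] ≠ [] := by simp
  intro x T v hx hxT hT hv
  rcases suffix_concat_cases hv with rfl | ⟨y, rfl, X, h⟩
  · exact hT
  by_cases hX : X = []
  · subst hX
    rw [List.nil_append] at h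
    subst h
    exact (blw_append hs).2 hT
  by_cases hc : Ev (y ++ [s])
  · have := crossing_even hs hα hγ h.symm hX hc T ([s] ++ (y ++ [s] ++ T))
    simpa [Blw] using this
  · have h1 : Blw (H ++ [s]) (y ++ [s] ++ x) := hx _ ⟨X, by simp [← h]⟩
    refine h1.mono hs hE0 ?_
    rcases hxT.eq_or_lt with h2 | h2
    · rw [rk_inj h2]
    · exact ((rk_append_lt_odd hc).2 h2).le

/-- The tail of the lower word is good. -/
theorem good_tail {H κ : List Bool} {s : Bool} (hs : Ev (H ++ [s])) (hα : Lx (H ++ s :: κ)) :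
    Good (H ++ [s]) κ := by
  have hE0 : H ++ [s] ≠ [] := by simp
  have key : ∀ n v, v.length = n → v <:+ (H ++ [s]) ++ κ → Blw (H ++ [s]) v := by
    intro n
    induction n using Nat.strong_induction_on with
    | _ n ih =>
      intro v hn hv
      subst hn
      refine (blw_or_abv hE0 v).resolve_right fun hA => ?_
      obtain ⟨u, hu⟩ := hv
      obtain ⟨v', rfl⟩ : ∃ v', v = (H ++ [s]) ++ v' := by
        by_cases hu0 : u = []
        · exact ⟨κ, by rw [← hu, hu0, List.nil_append]⟩
        · have h1 := hα.2 u v (by simpa using hu.symm) hu0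
          obtain ⟨t, ht, -⟩ := sandwich (u := H ++ [s]) (x := v) (z := v) (y := κ)
            (Or.inl ⟨hA, by simpa using h1⟩)
          exact ⟨t, ht⟩
      rw [abv_append hs] at hA
      exact lt_asymm hA (ih v'.length (by simp only [List.length_append, List.length_cons]; omega)
        v' rfl ((List.suffix_append _ _).trans ⟨u, hu⟩))
  exact fun v hv => key _ v rfl hv

/-- Lexicality of `H c x` amounts to two conditions on the suffixes. -/
theorem lx_of {H κ ζ : List Bool} {s : Bool} (hs : Ev (H ++ [s])) (hα : Lx (H ++ s :: κ))
    (hγ : Lx (H ++ (!s) :: ζ))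
    {c : Bool} {x : List Bool} (h1 : ∀ v, v <:+ x → rk v < rk (H ++ c :: x))
    (h2 : ∀ X y, H = X ++ y → X ≠ [] → y <+: H → ¬ Ev (y ++ [c]) →
      rk (y ++ c :: x) < rk (H ++ c :: x)) : Lx (H ++ c :: x) := by
  refine ⟨by simp, fun u v huv hu => ?_⟩
  have huv' : u ++ v = (H ++ [c]) ++ x := by simp [← huv]
  rcases suffix_append_cases ⟨u, huv'⟩ with h | ⟨v', rfl, h⟩
  · exact h1 v h
  rcases suffix_concat_cases h with rfl | ⟨y, rfl, X, hX⟩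
  · exact h1 x List.suffix_rfl
  have hX0 : X ≠ [] := by
    rintro rfl
    rw [List.nil_append] at hX
    subst hX
    exact hu (List.append_left_eq_self.1 huv')
  simp only [List.append_assoc, List.singleton_append]
  by_cases hy : y <+: H
  · by_cases hc : Ev (y ++ [c])
    · exact crossing_even hs hα hγ hX.symm hX0 hc _ _
    · exact h2 X y hX.symm hX0 hy hc
  · exact crossing_not_prefix hα hX.symm hX0 hy _ _

theorem exists_good_max {E κ : List Bool} (h : Good E κ) :
    ∃ x : List Bool, x.length = κ.length ∧ Good E x ∧ rk κ ≤ rk x ∧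
      ∀ z : List Bool, z.length = κ.length → Good E z → rk z ≤ rk x := by
  obtain ⟨x, ⟨hx1, hx2⟩, hmax⟩ := Set.exists_max_image
    {z : List Bool | z.length = κ.length ∧ Good E z} rk
    ((List.finite_length_eq Bool κ.length).subset fun z hz => hz.1) ⟨κ, rfl, h⟩
  exact ⟨x, hx1, hx2, hmax κ ⟨rfl, h⟩, fun z h1 h2 => hmax z ⟨h1, h2⟩⟩

theorem lx_of_good_max {H κ ζ : List Bool} {s : Bool} (hs : Ev (H ++ [s])) (hα : Lx (H ++ s :: κ))
    (hγ : Lx (H ++ (!s) :: ζ)) {x : List Bool} (hx : Good (H ++ [s]) x) (hκx : rk κ ≤ rk x)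
    (hmax : ∀ z : List Bool, z.length = x.length → Good (H ++ [s]) z → rk z ≤ rk x) :
    Lx (H ++ s :: x) := by
  have hE0 : H ++ [s] ≠ [] := by simp
  have hL := lifts hs hα hγ
  have hEx : H ++ s :: x = (H ++ [s]) ++ x := by simp
  refine lx_of hs hα hγ (fun v hv => ?_) (fun X y hH hX hy hc => ?_)
  · by_contra hlt
    rw [hEx] at hlt
    have hlt := rk_lt_of_le_of_length (not_lt.1 hlt) (by
      have := hv.length_le
      simp only [List.length_append, List.length_cons]; omega)
    have hv1 : Blw (H ++ [s]) v := hx.blw_suffix hv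
    obtain ⟨ρ', rfl, -⟩ := sandwich (Or.inl ⟨hlt, hv1⟩)
    rw [rk_append_lt_ev hs] at hlt
    rw [blw_append hs] at hv1
    obtain ⟨u, hu⟩ := hv
    have hu0 : u ≠ [] := by
      rintro rfl
      have h3 : Blw (H ++ [s]) ρ' := hv1
      rw [List.nil_append] at hu
      have := (h3 : rk ρ' < _)
      have h4 := hx.blw_suffix (v := x) List.suffix_rfl
      rw [← hu] at h4 hlt
      exact lt_asymm this hlt
    obtain ⟨u', hu', h1, h2, h3⟩ := hL.replace_suffix hs hE0 hx hlt hv1 le_rfl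
      (hx.blw_suffix List.suffix_rfl) hu.symm hu0 hv1
    have hz : Good (H ++ [s]) (u' ++ ρ') := by
      refine hL.good hx h1.le fun v hv => ?_
      rcases le_total v.length ρ'.length with h | h
      · exact hx.blw_suffix (((List.suffix_of_suffix_length_le hv (List.suffix_append _ _) h).trans
          (List.suffix_append _ _)).trans ⟨u, hu⟩)
      · have hv' := List.suffix_iff_eq_drop.1 hv
        rw [hv']
        rcases h3 ((u' ++ ρ').length - v.length) (by simp; omega) with h4 | h4
        · exact (hx.blw_suffix (List.drop_suffix _ _)).mono hs hE0 h4.le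
        · exact h4
    have h5 := hmax (pw (H ++ [s]) 1 (u' ++ ρ')) (by
      rw [length_pw, ← hu]; simp [hu']; omega) (hL.good_pw hs hz 1)
    have h6 := le_pw hs h2 1
    linarith
  · have h1 := hα.2 X (y ++ s :: κ) (by rw [hH, List.append_assoc]) hX
    have h2 : rk (y ++ [s] ++ x) ≤ rk (y ++ [s] ++ κ) := by
      rcases hκx.eq_or_lt with h | h
      · rw [rk_inj h]
      · exact ((rk_append_lt_odd hc).2 h).le
    have h3 : rk (H ++ [s] ++ κ) ≤ rk (H ++ [s] ++ x) := by
      rcases hκx.eq_or_lt with h | h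
      · rw [rk_inj h]
      · exact ((rk_append_lt_ev hs).2 h).le
    simp only [List.append_assoc, List.singleton_append] at h2 h3
    linarith

theorem tail_max {H κ ζ : List Bool} {s : Bool} (hs : Ev (H ++ [s])) (hα : Lx (H ++ s :: κ))
    (hγ : Lx (H ++ (!s) :: ζ)) (hadj : ∀ w : List Bool, w.length = (H ++ s :: κ).length → Lx w →
      rk (H ++ s :: κ) < rk w → rk w < rk (H ++ (!s) :: ζ) → False)
    (z : List Bool) (hz : z.length = κ.length) (hzg : Good (H ++ [s]) z) : rk z ≤ rk κ := by
  obtain ⟨x, hx1, hx2, hx3, hx4⟩ := exists_good_max (good_tail hs hα)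
  have hlx := lx_of_good_max hs hα hγ hx2 hx3 (by rw [hx1]; exact hx4)
  have h := hadj _ (by simp [hx1]) hlx
  rcases hx3.eq_or_lt with h' | h'
  · rw [h']; exact hx4 z hz hzg
  · refine (h ?_ (rk_lt_flip hs _ _)).elim
    have := (rk_append_lt_ev hs).2 h'
    simpa using this

theorem tail_start {H κ ζ : List Bool} {s : Bool} (hs : Ev (H ++ [s])) (hα : Lx (H ++ s :: κ))
    (hγ : Lx (H ++ (!s) :: ζ))
    (hmax : ∀ z : List Bool, z.length = κ.length → Good (H ++ [s]) z → rk z ≤ rk κ) :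
    κ = [] ∨ ∃ t, κ = true :: t := by
  by_contra hcon
  have hE0 : H ++ [s] ≠ [] := by simp
  have hG := good_tail hs hα
  have hL := lifts hs hα hγ
  obtain ⟨H', hH'⟩ := head_start hs hα hγ
  have hdec : ∀ w : List Bool, ∃ j κ₁, w = List.replicate j false ++ κ₁ ∧
      (κ₁ = [] ∨ ∃ t, κ₁ = true :: t) := by
    intro w
    induction w with
    | nil => exact ⟨0, [], rfl, Or.inl rfl⟩
    | cons a w ih =>
      cases a
      · obtain ⟨j, κ₁, rfl, h⟩ := ih
        exact ⟨j + 1, κ₁, rfl, h⟩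
      · exact ⟨0, _, rfl, Or.inr ⟨w, rfl⟩⟩
  obtain ⟨j, κ₁, hκ, hκ₁⟩ := hdec κ
  rcases j with _ | j
  · rw [List.replicate_zero, List.nil_append] at hκ
    rw [hκ] at hcon
    exact hcon hκ₁
  have hev : ∀ j, Ev (List.replicate j false) := fun j => by simp [Ev, List.count_replicate]
  have hκ' : κ = List.replicate j false ++ (false :: κ₁) := by
    rw [hκ, List.replicate_succ']; simp
  have hlt : rk κ < rk (List.replicate j false ++ true :: κ₁) := by
    rw [hκ', rk_append_lt_ev (hev j)]; exact rk_false_lt_true _ _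
  refine absurd (hmax (List.replicate j false ++ true :: κ₁) (by simp [hκ']) ?_) (not_le.2 hlt)
  refine hL.good hG hlt.le fun v hv => ?_
  have hR : ∀ T, rk (true :: κ₁) < rk (H ++ T) := by
    intro T
    rw [hH']
    simp only [List.cons_append, rk_true_lt]
    rcases hκ₁ with rfl | ⟨t, rfl⟩
    · exact rk_false_neg _
    · exact rk_false_lt_true _ _
  rcases suffix_append_cases hv with h | ⟨v', rfl, h⟩
  · rcases List.suffix_cons_iff.1 h with rfl | h
    · rw [Blw, List.append_assoc]; exact hR _
    · exact hG.blw_suffix (h.trans (by rw [hκ]; exact List.suffix_append _ _))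
  · rcases v' with _ | ⟨a, v'⟩
    · rw [Blw, List.nil_append, List.append_assoc]; exact hR _
    · have : a = false := List.eq_of_mem_replicate (h.subset List.mem_cons_self)
      subst this
      rw [Blw, hH']
      exact rk_false_lt_true _ _

theorem lx_flip_of {H κ ζ : List Bool} {s : Bool} (hs : Ev (H ++ [s])) (hα : Lx (H ++ s :: κ))
    (hγ : Lx (H ++ (!s) :: ζ))
    (h : ∀ X y z, H = X ++ y → X ≠ [] → H = y ++ (!s) :: z → Ev (y ++ [s]) →
    Ev (z ++ [!s]) → rk (z ++ (!s) :: κ) < rk κ) : Lx (H ++ (!s) :: κ) := by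
  refine lx_of hs hα hγ (fun v hv => ?_) (fun X y hH hX hy hc => ?_)
  · have h1 : rk v < rk _ := (good_tail hs hα).blw_suffix hv
    rw [List.append_assoc] at h1
    exact h1.trans (rk_lt_flip hs _ _)
  · have hc' : Ev (y ++ [s]) := by rw [ev_flip] at hc; exact not_not.1 hc
    obtain ⟨z, hz⟩ := prefix_letter hs hα hγ hH hX hy hc'
    have hzs : Ev (z ++ [!s]) := by
      rw [ev_flip]
      intro h1
      have h2 : H ++ [s] = (y ++ [!s]) ++ (z ++ [s]) := by
        conv_lhs => rw [hz]
        simp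
      rw [h2, ev_append] at hs
      exact hc (hs.2 h1)
    have h1 := (rk_append_lt_odd hc).2 (h X y z hH hX hz hc' hzs)
    have h2 : H ++ (!s) :: κ = (y ++ [!s]) ++ (z ++ (!s) :: κ) := by
      conv_lhs => rw [hz]
      simp
    rw [h2]
    simpa using h1

theorem lx_flip_of_dvd {H κ ζ : List Bool} {s : Bool} (hs : Ev (H ++ [s])) (hα : Lx (H ++ s :: κ))
    (hγ : Lx (H ++ (!s) :: ζ))
    (hmax : ∀ z : List Bool, z.length = κ.length → Good (H ++ [s]) z → rk z ≤ rk κ)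
    (hdvd : H.length + 1 ∣ κ.length + 1) : Lx (H ++ (!s) :: κ) := by
  have hE0 : H ++ [s] ≠ [] := by simp
  have hG := good_tail hs hα
  have hL := lifts hs hα hγ
  obtain ⟨b, hb⟩ := hdvd
  obtain ⟨b, rfl⟩ : ∃ k, b = k + 1 := Nat.exists_eq_succ_of_ne_zero (by rintro rfl; simp at hb)
  refine lx_flip_of hs hα hγ fun X y z _ _ hz _ hzs => ?_
  by_contra hlt
  have hzl : H.length = y.length + (z.length + 1) := by conv_lhs => rw [hz]; simp
  have hκl : κ.length + 1 = b * (H.length + 1) + (H.length + 1) := by rw [hb]; ring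
  have hκz : rk κ < rk z := (not_lt.1 hlt).trans_lt (rk_append_lt_self_ev hzs κ)
  have hzsuf : ∀ v, v <:+ z → Blw (H ++ [s]) v := by
    rintro v ⟨u, rfl⟩
    rw [Blw, List.append_assoc]
    exact suffix_lt hs hα hγ (X := y ++ (!s) :: u) (by conv_lhs => rw [hz]
                                                       simp) (by simp) _
  have hκB := hG.blw_suffix (v := κ) List.suffix_rfl
  have hw : pw (H ++ [s]) (b + 1) κ = pw (H ++ [s]) b (y ++ [!s]) ++ (z ++ s :: κ) := by
    rw [← pw_append, pw_succ']
    congr 1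
    conv_lhs => rw [hz]
    simp
  obtain ⟨u', hu', h1, h2, h3⟩ := hL.replace_suffix hs hE0 hG hκz (hzsuf z List.suffix_rfl)
    (le_pw hs hκB (b + 1)) ((blw_pw hs).2 hκB) hw
    (fun h => by have := congrArg List.length h; simp [length_pw] at this)
    (rk_self_lt_append_odd (by rw [← ev_flip]; exact hzs) κ)
  have hz : Good (H ++ [s]) (u' ++ z) := by
    refine hL.good hG h1.le fun v hv => ?_
    rcases le_total v.length z.length with h | h
    · exact hzsuf v (List.suffix_of_suffix_length_le hv (List.suffix_append _ _) h)
    · have hv' := List.suffix_iff_eq_drop.1 hv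
      rw [hv']
      rcases h3 ((u' ++ z).length - v.length) (by simp; omega) with h4 | h4
      · exact ((hL.good_pw hs hG (b + 1)).blw_suffix (List.drop_suffix _ _)).mono hs hE0 h4.le
      · exact h4
  have h5 := hmax (u' ++ z) (by
    rw [List.length_append, hu', length_pw]
    simp only [List.length_append, List.length_singleton]
    omega) hz
  exact absurd h1 (not_lt.2 h5)

theorem head_length_dvd_of_abv {H : List Bool} {s : Bool} (hs : Ev (H ++ [s]))
    {β W : List Bool} (hβ : Abv (H ++ [s]) β)
    (hW : ∀ v, v <:+ W → rk v ≤ rk (H ++ (!s) :: β)) :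
    ∀ v, v <:+ W → Abv (H ++ [s]) v → H.length + 1 ∣ v.length + 1 := by
  have hE0 : H ++ [s] ≠ [] := by simp
  have hodd : ¬ Ev (H ++ [!s]) := by rw [ev_flip]; exact not_not.2 hs
  have key : ∀ n v, v.length = n → v <:+ W → Abv (H ++ [s]) v → H.length + 1 ∣ v.length + 1 := by
    intro n
    induction n using Nat.strong_induction_on with
    | _ n ih =>
      intro v hn hv hA
      subst hn
      obtain ⟨T, rfl⟩ : ∃ T, v = H ++ T := by
        rcases (hW v hv).eq_or_lt with h | h
        · exact ⟨_, rk_inj h⟩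
        · have h1 : rk _ < rk v := hA
          rw [List.append_assoc] at h1
          obtain ⟨t, ht, -⟩ := sandwich (Or.inl ⟨h1, h⟩)
          exact ⟨t, ht⟩
      rcases T with _ | ⟨c, v'⟩
      · simp
      have hv' : v' <:+ W :=
        ((List.suffix_cons c v').trans (List.suffix_append _ _)).trans hv
      have hA' : Abv (H ++ [s]) v' := by
        by_cases hc : c = s
        · subst hc
          rwa [List.append_cons (bs := v'), abv_append hs] at hA
        · have hc : c = !s := by cases c <;> cases s <;> simp at hc ⊢
          subst hc
          refine hβ.mono hs hE0 (not_lt.1 fun hlt => ?_)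
          have h1 := (rk_append_lt_odd hodd).2 hlt
          have h2 := hW _ hv
          rw [List.append_cons (bs := v'), List.append_cons (bs := β)] at h2
          exact absurd h1 (not_lt.2 h2)
      have h1 := ih v'.length (by simp; omega) v' rfl hv' hA'
      have h2 : (H ++ c :: v').length + 1 = (H.length + 1) + (v'.length + 1) := by simp; omega
      rw [h2]
      exact (Nat.dvd_add_right (dvd_refl _)).2 h1
  exact fun v hv hA => key _ v rfl hv hA

theorem exists_max_suffix (w : List Bool) : ∃ ρ, ρ <:+ w ∧ ∀ v, v <:+ w → rk v ≤ rk ρ := by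
  induction w with
  | nil => exact ⟨[], List.suffix_rfl, fun v hv => by rw [List.suffix_nil.1 hv]⟩
  | cons a w ih =>
    obtain ⟨ρ, h1, h2⟩ := ih
    rcases le_total (rk ρ) (rk (a :: w)) with h | h
    · refine ⟨_, List.suffix_rfl, fun v hv => ?_⟩
      rcases List.suffix_cons_iff.1 hv with rfl | hv
      · rfl
      · exact (h2 v hv).trans h
    · refine ⟨ρ, h1.trans (List.suffix_cons a w), fun v hv => ?_⟩
      rcases List.suffix_cons_iff.1 hv with rfl | hv
      · exact h
      · exact h2 v hv

/-- If the longest suffix of `w` above the infinite power has the right length, then deleting it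
and prepending powers of `E` produces a good word exceeding `κ`. -/
theorem false_of_forall_abv_dvd {H κ ζ : List Bool} {s : Bool} (hs : Ev (H ++ [s]))
    (hα : Lx (H ++ s :: κ)) (hγ : Lx (H ++ (!s) :: ζ))
    (hmax : ∀ z : List Bool, z.length = κ.length → Good (H ++ [s]) z → rk z ≤ rk κ)
    {w : List Bool} (hwl : w.length = κ.length) (hκw : rk κ < rk w) (hwB : Blw (H ++ [s]) w)
    (hdvd : ∀ v, v <:+ w → Abv (H ++ [s]) v → H.length + 1 ∣ v.length + 1)
    (hex : ∃ v, v <:+ w ∧ Abv (H ++ [s]) v) : False := by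
  have hE0 : H ++ [s] ≠ [] := by simp
  have hG := good_tail hs hα
  have hL := lifts hs hα hγ
  have hκB : ∀ v, v <:+ κ → Blw (H ++ [s]) v := fun v hv => hG.blw_suffix hv
  obtain ⟨ρ, ⟨hρw, hρA⟩, hρmax⟩ := Set.exists_max_image
    {v | v <:+ w ∧ Abv (H ++ [s]) v} List.length
    ((List.finite_toSet w.tails).subset fun v hv => by simpa using hv.1) hex
  obtain ⟨b, hb⟩ := hdvd ρ hρw hρA
  obtain ⟨u, hu⟩ := hρw
  obtain ⟨u, c, rfl⟩ : ∃ u' c, u = u' ++ [c] := by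
    rcases List.eq_nil_or_concat u with rfl | ⟨u', c, h⟩
    · rw [List.nil_append] at hu
      subst hu
      exact (lt_irrefl _ (hwB.lt_abv hs hE0 hρA)).elim
    · exact ⟨u', c, by simpa using h⟩
  replace hu : w = u ++ c :: ρ := by rw [← hu]; simp
  have hul : u.length + 1 + ρ.length = κ.length := by rw [← hwl, hu]; simp; omega
  have hκu : rk κ < rk u := by
    by_contra hcon
    have hlt := rk_lt_of_le_of_length (not_lt.1 hcon) (by omega)
    rw [hu] at hκw
    obtain ⟨x', hx', hρx⟩ := mid_self (Or.inl ⟨hlt, hκw⟩)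
    have h1 := hκB x' (by rw [hx']; exact (List.suffix_cons c x').trans (List.suffix_append _ _))
    exact lt_asymm hρx (h1.lt_abv hs hE0 hρA)
  have huB : ∀ v, v <:+ u → Blw (H ++ [s]) v := by
    intro v hv
    refine (blw_or_abv hE0 v).resolve_right fun hA => ?_
    have hvw : v ++ c :: ρ <:+ w := by
      obtain ⟨t, rfl⟩ := hv
      exact ⟨t, by rw [hu, List.append_assoc]⟩
    have hvB : Blw (H ++ [s]) (v ++ c :: ρ) := by
      refine (blw_or_abv hE0 _).resolve_right fun hA' => ?_
      have := hρmax _ ⟨hvw, hA'⟩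
      simp at this
      omega
    obtain ⟨k, h1, h2⟩ := exists_pw_between hs hE0 hvB hA κ
    obtain ⟨T, hT, hρT⟩ := mid_self (Or.inr ⟨h1, h2⟩)
    have h3 := (hL.good_pw hs hG k).blw_suffix (v := T)
      (by rw [hT]; exact (List.suffix_cons c T).trans (List.suffix_append _ _))
    exact lt_asymm hρT (h3.lt_abv hs hE0 hρA)
  have huG : Good (H ++ [s]) u := hL.good hG hκu.le huB
  have h4 := hmax (pw (H ++ [s]) b u) (by
    rw [length_pw]
    simp only [List.length_append, List.length_singleton]
    rw [Nat.mul_comm] at hb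
    omega) (hL.good_pw hs huG b)
  have h5 := le_pw hs (huB u List.suffix_rfl) b
  linarith

theorem tail_le_of_not_dvd {H κ ζ : List Bool} {s : Bool} (hs : Ev (H ++ [s]))
    (hα : Lx (H ++ s :: κ)) (hγ : Lx (H ++ (!s) :: ζ))
    (hmax : ∀ z : List Bool, z.length = κ.length → Good (H ++ [s]) z → rk z ≤ rk κ)
    (hlen : ζ.length = κ.length) (hnd : ¬ H.length + 1 ∣ κ.length + 1) : rk ζ ≤ rk κ := by
  have hE0 : H ++ [s] ≠ [] := by simp
  have hodd : ¬ Ev (H ++ [!s]) := by rw [ev_flip]; exact not_not.2 hs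
  have hG := good_tail hs hα
  have hL := lifts hs hα hγ
  by_contra hcon
  rw [not_le] at hcon
  have hζsuf : ∀ v, v <:+ ζ → rk v < rk (H ++ (!s) :: ζ) := by
    rintro v ⟨u, hu⟩
    exact hγ.2 (H ++ (!s) :: u) v (by rw [← hu]; simp) (by simp)
  have hζB : Blw (H ++ [s]) ζ := by
    refine (blw_or_abv hE0 ζ).resolve_right fun hA => hnd ?_
    rw [← hlen]
    exact head_length_dvd_of_abv hs hA (fun v hv => (hζsuf v hv).le) ζ List.suffix_rfl hA
  have hBlt : ∀ x T, Blw (H ++ [s]) x → rk x < rk (H ++ (!s) :: T) := by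
    intro x T hx
    have h1 : rk x < rk _ := hx
    rw [List.append_assoc] at h1
    exact h1.trans (rk_lt_flip hs _ _)
  choose mx hmx1 hmx2 using exists_max_suffix
  obtain ⟨w, ⟨hwl, hκw, hwB, hws⟩, hwmin⟩ := Set.exists_min_image
    {w : List Bool | w.length = κ.length ∧ rk κ < rk w ∧ Blw (H ++ [s]) w ∧
      ∀ v, v <:+ w → rk v < rk (H ++ (!s) :: ζ)} (fun w => rk (mx w))
    ((List.finite_length_eq Bool κ.length).subset fun z hz => hz.1) ⟨ζ, hlen, hcon, hζB, hζsuf⟩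
  have hex : ∃ v, v <:+ w ∧ Abv (H ++ [s]) v := by
    by_contra hno
    push Not at hno
    exact absurd hκw (not_lt.2 (hmax w hwl
      (hL.good hG hκw.le fun v hv => (blw_or_abv hE0 v).resolve_right (hno v hv))))
  have hρs := hmx1 w
  have hρm := hmx2 w
  set ρ := mx w
  have hρA : Abv (H ++ [s]) ρ := by
    obtain ⟨v, hv, hA⟩ := hex
    exact hA.mono hs hE0 (hρm v hv)
  have hfin : ∀ β, Abv (H ++ [s]) β → rk ρ ≤ rk (H ++ (!s) :: β) → False := fun β hβ hρβ =>
    false_of_forall_abv_dvd hs hα hγ hmax hwl hκw hwB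
      (head_length_dvd_of_abv hs hβ fun v hv => (hρm v hv).trans hρβ) hex
  have hHA : Abv (H ++ [s]) H := by
    rw [Abv, List.append_assoc]
    exact rk_append_lt_self_ev hs _
  obtain ⟨ρ₂, hρ₂⟩ : ∃ t, ρ = H ++ t := by
    have h1 : rk _ < rk ρ := hρA
    rw [List.append_assoc] at h1
    obtain ⟨t, ht, -⟩ := sandwich (Or.inl ⟨h1, hws ρ hρs⟩)
    exact ⟨t, ht⟩
  rcases ρ₂ with _ | ⟨c, ρ'⟩
  · refine hfin H hHA ?_
    rw [hρ₂, List.append_nil]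
    exact (rk_self_lt_append_odd hodd _).le
  by_cases hc : c = s
  · subst hc
    refine hfin H hHA ?_
    rw [hρ₂]
    exact (rk_lt_flip hs _ _).le
  have hc : c = !s := by cases c <;> cases s <;> simp at hc ⊢
  subst hc
  rcases blw_or_abv hE0 ρ' with hρ'B | hρ'A
  swap
  · exact hfin ρ' hρ'A (by rw [hρ₂])
  have hζρ : rk ζ < rk ρ' := by
    have h1 := hws ρ hρs
    rw [hρ₂, List.append_cons (bs := ρ'), List.append_cons (bs := ζ)] at h1
    exact (rk_append_lt_odd hodd).1 h1
  obtain ⟨u, hu⟩ := hρs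
  have hu0 : u ≠ [] := by
    rintro rfl
    rw [List.nil_append] at hu
    rw [← hu] at hwB
    exact lt_irrefl _ (hwB.lt_abv hs hE0 hρA)
  obtain ⟨u', hu', h1, h2, h3⟩ := hL.replace_suffix hs hE0 hG (hcon.trans hζρ) hρ'B hκw.le hwB
    hu.symm hu0 (hρ'B.lt_abv hs hE0 hρA)
  have hρ'ρ : ρ' <:+ ρ := by
    rw [hρ₂]; exact (List.suffix_cons _ _).trans (List.suffix_append _ _)
  have hρl : ρ.length = H.length + 1 + ρ'.length := by rw [hρ₂]; simp; omega
  have hwl' : w.length = u.length + ρ.length := by rw [← hu]; simp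
  have hall : ∀ v, v <:+ (H ++ [s]) ++ (u' ++ ρ') → rk v < rk ρ := by
    intro v hv
    rcases suffix_append_cases hv with h | ⟨v', rfl, h⟩
    · rcases le_total v.length ρ'.length with hl | hl
      · have h4 : v <:+ ρ' := List.suffix_of_suffix_length_le h (List.suffix_append _ _) hl
        refine rk_lt_of_le_of_length (hρm v ((h4.trans hρ'ρ).trans ⟨u, hu⟩)) ?_
        omega
      · have hv' := List.suffix_iff_eq_drop.1 h
        rw [hv']
        rcases h3 ((u' ++ ρ').length - v.length) (by simp; omega) with h4 | h4
        · exact h4.trans_le (hρm _ (List.drop_suffix _ _))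
        · exact h4.lt_abv hs hE0 hρA
    · exact (hL _ _ _ hG h1.le h2 h).lt_abv hs hE0 hρA
  have hmin := hwmin ((H ++ [s]) ++ (u' ++ ρ')) ⟨by simp; omega, h1.trans h2,
    (blw_append hs).2 h2, fun v hv => (hall v hv).trans (hws ρ ⟨u, hu⟩)⟩
  exact absurd (hall _ (hmx1 _)) (not_lt.2 hmin)

/-- The exchange principle for neighbouring lexical words. -/
theorem exchange {H κ ζ : List Bool} {s : Bool} (hs : Ev (H ++ [s])) (hα : Lx (H ++ s :: κ))
    (hγ : Lx (H ++ (!s) :: ζ)) (hlen : ζ.length = κ.length)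
    (hadj : ∀ w : List Bool, w.length = (H ++ s :: κ).length → Lx w →
      rk (H ++ s :: κ) < rk w → rk w < rk (H ++ (!s) :: ζ) → False) :
    Lx (H ++ (!s) :: κ) ∧ (κ = [] ∨ ∃ t, κ = true :: t) ∧
      (¬ H.length + 1 ∣ κ.length + 1 → ζ = κ) := by
  have hmax := tail_max hs hα hγ hadj
  have hodd : ¬ Ev (H ++ [!s]) := by rw [ev_flip]; exact not_not.2 hs
  have key : ¬ H.length + 1 ∣ κ.length + 1 → ζ = κ := by
    intro hnd
    have hle := tail_le_of_not_dvd hs hα hγ hmax hlen hnd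
    refine rk_inj (hle.eq_of_not_lt fun hlt => ?_)
    refine hadj (H ++ (!s) :: κ) (by simp) ?_ (rk_lt_flip hs _ _) ?_
    · refine lx_flip_of hs hα hγ fun X y z hH hX hz hc hzs => ?_
      have hc' : ¬ Ev (y ++ [!s]) := by rw [ev_flip]; exact not_not.2 hc
      have h1 := hγ.2 X (y ++ (!s) :: ζ) (by rw [hH, List.append_assoc]) hX
      have h2 : H ++ (!s) :: ζ = (y ++ [!s]) ++ (z ++ (!s) :: ζ) := by
        conv_lhs => rw [hz]
        simp
      rw [h2, List.append_cons (bs := ζ), rk_append_lt_odd hc', List.append_cons] at h1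
      rw [List.append_cons]
      exact Abv.mono hzs (by simp) h1 hlt.le
    · have := (rk_append_lt_odd hodd).2 hlt
      simpa using this
  refine ⟨?_, tail_start hs hα hγ hmax, key⟩
  by_cases hd : H.length + 1 ∣ κ.length + 1
  · exact lx_flip_of_dvd hs hα hγ hmax hd
  · rw [← key hd]; exact hγ

/-- The binary word of an α-sequence: a cell `a` becomes `true` followed by `a - 1` times
`false`. -/
def enc : List ℕ → List Bool
  | [] => []
  | a :: t => true :: (List.replicate (a - 1) false ++ enc t)

theorem enc_append (p q : List ℕ) : enc (p ++ q) = enc p ++ enc q := by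
  induction p with
  | nil => rfl
  | cons a p ih => simp [enc, ih]

theorem enc_start (p : List ℕ) : enc p = [] ∨ ∃ t, enc p = true :: t := by
  cases p with
  | nil => exact Or.inl rfl
  | cons a p => exact Or.inr ⟨_, rfl⟩

theorem length_enc {p : List ℕ} (hp : ∀ x ∈ p, 0 < x) : (enc p).length = p.sum := by
  induction p with
  | nil => rfl
  | cons a p ih =>
    have h1 := hp a List.mem_cons_self
    have h2 := ih fun x hx => hp x (List.mem_cons_of_mem _ hx)
    simp [enc, h2]; omega

theorem ev_enc (p : List ℕ) : Ev (enc p) ↔ Even p.length := by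
  induction p with
  | nil => simp [enc, Ev]
  | cons a p ih =>
    have : Ev (List.replicate (a - 1) false) := by simp [Ev, List.count_replicate]
    rw [enc, ev_cons, ev_append, ih]
    simp [this, Nat.even_add_one]

theorem rk_enc_nonneg (p : List ℕ) : 0 ≤ rk (enc p) := by
  rcases enc_start p with h | ⟨t, h⟩
  · rw [h]; exact le_rfl
  · rw [h]; exact (rk_true_pos t).le

theorem Al_cons_zero (a : ℕ) (s : List ℕ) : Al (a :: s) 0 = a := by simp [Al]

theorem Al_cons_succ (a : ℕ) (s : List ℕ) (i : ℕ) : Al (a :: s) (i + 1) = -Al s i := by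
  simp [Al, pow_succ]

theorem Al_nil (i : ℕ) : Al [] i = 0 := by simp [Al]

theorem lexLt_cons {a b : ℕ} {s t : List ℕ} :
    lexLt (a :: s) (b :: t) ↔ a < b ∨ (a = b ∧ lexLt t s) := by
  constructor
  · rintro ⟨i, h1, h2⟩
    rcases i with _ | i
    · left; simpa [Al_cons_zero] using h2
    · right
      refine ⟨by simpa [Al_cons_zero] using h1 0 (Nat.succ_pos i), i, fun j hj => ?_, ?_⟩
      · have := h1 (j + 1) (by omega)
        rw [Al_cons_succ, Al_cons_succ] at this
        linarith
      · rw [Al_cons_succ, Al_cons_succ] at h2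
        linarith
  · rintro (h | ⟨rfl, i, h1, h2⟩)
    · exact ⟨0, by simp, by simpa [Al_cons_zero] using h⟩
    · refine ⟨i + 1, fun j hj => ?_, ?_⟩
      · rcases j with _ | j
        · simp [Al_cons_zero]
        · rw [Al_cons_succ, Al_cons_succ, h1 j (by omega)]
      · rw [Al_cons_succ, Al_cons_succ]
        linarith

theorem rk_enc_cons_lt {a b : ℕ} (ha : 0 < a) (hab : a < b) (s t : List ℕ) :
    rk (enc (a :: s)) < rk (enc (b :: t)) := by
  obtain ⟨c, rfl⟩ : ∃ c, b = a + 1 + c := ⟨b - a - 1, by omega⟩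
  have h : a + 1 + c - 1 = (a - 1) + (c + 1) := by omega
  have hev : Ev (List.replicate (a - 1) false) := by simp [Ev, List.count_replicate]
  rw [enc, enc, rk_true_lt, h, List.replicate_add, List.append_assoc, rk_append_lt_ev hev,
    List.replicate_succ, List.cons_append]
  exact (rk_false_neg _).trans_le (rk_enc_nonneg s)

theorem lexLt_iff : ∀ {p q : List ℕ}, (∀ x ∈ p, 0 < x) → (∀ x ∈ q, 0 < x) →
    (lexLt p q ↔ rk (enc p) < rk (enc q))
  | [], [], _, _ => by simp [lexLt]
  | [], b :: q, _, hq => by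
    have hb := hq b List.mem_cons_self
    refine iff_of_true ⟨0, by simp, ?_⟩ (rk_true_pos _)
    simpa [Al_nil, Al_cons_zero] using hb
  | a :: p, [], hp, _ => by
    have ha := hp a List.mem_cons_self
    refine iff_of_false ?_ (not_lt.2 (rk_true_pos _).le)
    rintro ⟨i, h1, h2⟩
    rcases i with _ | i
    · simp [Al_nil, Al_cons_zero] at h2; omega
    · have := h1 0 (Nat.succ_pos i)
      simp [Al_nil, Al_cons_zero] at this; omega
  | a :: p, b :: q, hp, hq => by
    have ih := lexLt_iff (p := q) (q := p) (fun x hx => hq x (List.mem_cons_of_mem _ hx))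
      (fun x hx => hp x (List.mem_cons_of_mem _ hx))
    have hev : Ev (List.replicate (a - 1) false) := by simp [Ev, List.count_replicate]
    rw [lexLt_cons]
    rcases lt_trichotomy a b with h | rfl | h
    · exact iff_of_true (Or.inl h) (rk_enc_cons_lt (hp a List.mem_cons_self) h _ _)
    · simp only [lt_irrefl, false_or, true_and]
      rw [ih, enc, enc, rk_true_lt, rk_append_lt_ev hev]
    · refine iff_of_false (by omega) ?_
      exact not_lt.2 (rk_enc_cons_lt (hq b List.mem_cons_self) h _ _).le
  termination_by p q => p.length + q.length

/-- A factorization of an encoded word in front of a `true` comes from a factorization of the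
sequence. -/
theorem enc_split : ∀ {p : List ℕ} {u v : List Bool}, enc p = u ++ v →
    (v = [] ∨ ∃ t, v = true :: t) → ∃ p₁ p₂, p = p₁ ++ p₂ ∧ u = enc p₁ ∧ v = enc p₂
  | [], u, v, h, _ => by
    rw [enc, eq_comm, List.append_eq_nil_iff] at h
    exact ⟨[], [], rfl, h.1, h.2⟩
  | a :: p, u, v, h, hv => by
    rw [enc, ← List.cons_append] at h
    rcases List.append_eq_append_iff.1 h with ⟨c, h1, h2⟩ | ⟨c, h1, h2⟩
    · obtain ⟨p₁, p₂, rfl, rfl, rfl⟩ := enc_split h2 hv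
      exact ⟨a :: p₁, p₂, rfl, by rw [h1]; rfl, rfl⟩
    · rcases c with _ | ⟨d, c⟩
      · exact ⟨[a], p, rfl, by simpa [enc] using h1.symm, by simpa using h2⟩
      · rcases u with _ | ⟨e, u⟩
        · exact ⟨[], a :: p, rfl, rfl, by rw [h2, enc, ← List.cons_append, h1]; rfl⟩
        · exfalso
          rw [List.cons_append, List.cons.injEq] at h1
          have hd : d = false := List.eq_of_mem_replicate (n := a - 1)
            (by rw [h1.2]; simp)
          rcases hv with rfl | ⟨t, rfl⟩
          · simp at h2
          · simp [hd] at h2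

theorem isLexical_iff {p : List ℕ} (hp : IsAlphaSeq p) : IsLexical p ↔ Lx (enc p) := by
  obtain ⟨a, t, rfl⟩ := List.exists_cons_of_ne_nil hp.1
  constructor
  · rintro ⟨-, h⟩
    refine ⟨by simp [enc], fun u v huv hu => ?_⟩
    rcases v with _ | ⟨_ | _, v⟩
    · exact rk_true_pos _
    · exact rk_false_lt_true _ _
    · obtain ⟨p₁, p₂, hp12, rfl, hv⟩ := enc_split huv (Or.inr ⟨v, rfl⟩)
      have h1 : p₁ ≠ [] := by rintro rfl; exact hu rfl
      have h2 : p₂ ≠ [] := by rintro rfl; simp [enc] at hv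
      have h3 := List.length_pos_iff.2 h1
      have h4 := List.length_pos_iff.2 h2
      have h5 := h (p₁.length + 1) (by omega) (by rw [hp12, List.length_append]; omega)
      rw [Nat.add_sub_cancel, hp12, List.drop_left, ← hp12, lexLt_iff _ hp.2] at h5
      · rw [hv]; exact h5
      · exact fun x hx => hp.2 x (by rw [hp12]; simp [hx])
  · intro h
    refine ⟨hp, fun i h1 h2 => ?_⟩
    rw [lexLt_iff (fun x hx => hp.2 x (List.mem_of_mem_drop hx)) hp.2]
    refine h.2 (enc ((a :: t).take (i - 1))) _ ?_ ?_
    · rw [← enc_append, List.take_append_drop]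
    · obtain ⟨j, hj⟩ : ∃ j, i - 1 = j + 1 := ⟨i - 2, by omega⟩
      simp [hj, enc]

theorem enc_split_cell {p q : List ℕ} {a : ℕ} (ha : 1 < a) :
    enc (p ++ a :: q) = enc (p ++ [a - 1]) ++ false :: enc q ∧
      enc (p ++ (a - 1) :: 1 :: q) = enc (p ++ [a - 1]) ++ true :: enc q := by
  obtain ⟨c, rfl⟩ : ∃ c, a = c + 2 := ⟨a - 2, by omega⟩
  simp [enc_append, enc, List.replicate_succ']

theorem enc_merge_cell {p q : List ℕ} {b : ℕ} (hb : 0 < b) :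
    enc (p ++ b :: 1 :: q) = enc (p ++ [b]) ++ true :: enc q ∧
      enc (p ++ (b + 1) :: q) = enc (p ++ [b]) ++ false :: enc q := by
  have := enc_split_cell (p := p) (q := q) (a := b + 1) (by omega)
  exact ⟨this.2, this.1⟩

theorem wedge_append (p s t : List ℕ) : wedge (p ++ s) (p ++ t) = p ++ wedge s t := by
  induction p with
  | nil => rfl
  | cons a p ih => simp [wedge, ih]

theorem exists_of_esApplicable {α : List ℕ} {i : ℕ} (h : EsApplicable α i) :
    ∃ p a q, α = p ++ a :: q ∧ 1 < a ∧ p.length + 1 = i ∧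
      applyEs α i = p ++ (a - 1) :: 1 :: q := by
  obtain ⟨h1, h2, h3⟩ := h
  have hi : i - 1 < α.length := by omega
  have hd : α.drop (i - 1) = α[i - 1] :: α.drop i := by
    rw [List.drop_eq_getElem_cons hi]; congr 2; omega
  have hg : α.getD (i - 1) 0 = α[i - 1] := by simp [hi]
  refine ⟨α.take (i - 1), α[i - 1], α.drop i, ?_, by rw [← hg]; exact h3,
    by simp; omega, ?_⟩
  · rw [← hd, List.take_append_drop]
  · rw [applyEs, hg]; simp

theorem exists_of_ecApplicable {α : List ℕ} {i : ℕ} (h : EcApplicable α i) :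
    ∃ p b q, α = p ++ b :: 1 :: q ∧ p.length + 2 = i ∧
      applyEc α i = p ++ (b + 1) :: q := by
  obtain ⟨h1, h2, h3⟩ := h
  have hi : i - 1 < α.length := by omega
  have hi2 : i - 2 < α.length := by omega
  have hd : α.drop (i - 1) = α[i - 1] :: α.drop i := by
    rw [List.drop_eq_getElem_cons hi]; congr 2; omega
  have hd2 : α.drop (i - 2) = α[i - 2] :: α.drop (i - 1) := by
    rw [List.drop_eq_getElem_cons hi2]; congr 2; omega
  have hg : α.getD (i - 1) 0 = α[i - 1] := by simp [hi]
  have hg2 : α.getD (i - 2) 0 = α[i - 2] := by simp [hi2]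
  rw [hg] at h3
  refine ⟨α.take (i - 2), α[i - 2], α.drop i, ?_, by simp; omega, ?_⟩
  · rw [← h3, ← hd, ← hd2, List.take_append_drop]
  · rw [applyEc, hg2]; simp

theorem ElemOpAt.enc_flip {α α' : List ℕ} {i : ℕ} (hα : ∀ x ∈ α, 0 < x) (hi : Even i)
    (h : ElemOpAt α i α') : ∃ F s τ, enc α = F ++ s :: τ ∧ enc α' = F ++ (!s) :: τ ∧
      Ev (F ++ [s]) ∧ F.length = (wedge α α').sum ∧ F.length + 1 = (α.take i).sum := by
  rcases h with ⟨h, rfl⟩ | ⟨h, rfl⟩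
  · obtain ⟨p, a, q, rfl, ha, hp, h2⟩ := exists_of_esApplicable h
    rw [h2]
    obtain ⟨e1, e2⟩ := enc_split_cell (p := p) (q := q) ha
    have hl : (enc (p ++ [a - 1])).length = (p ++ [a - 1]).sum :=
      length_enc fun x hx => by
        rcases List.mem_append.1 hx with hx | hx
        · exact hα x (by simp [hx])
        · rw [List.mem_singleton.1 hx]; omega
    have e3 := (enc_split_cell (p := p) (q := []) ha).1
    refine ⟨_, _, _, e1, e2, ?_, ?_, ?_⟩
    · have : enc [] = [] := rfl
      rw [this] at e3
      rw [← e3, ev_enc]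
      simpa [hp] using hi
    · rw [hl, wedge_append, wedge, if_neg (by omega), min_eq_right (by omega)]
    · rw [hl, ← hp, List.take_length_add_append]
      simp; omega
  · obtain ⟨p, b, q, rfl, hp, h2⟩ := exists_of_ecApplicable h
    rw [h2]
    obtain ⟨e1, e2⟩ := enc_merge_cell (p := p) (q := q) (hα b (by simp))
    have hl : (enc (p ++ [b])).length = (p ++ [b]).sum :=
      length_enc fun x hx => hα x (by
        rcases List.mem_append.1 hx with hx | hx
        · simp [hx]
        · simp [List.mem_singleton.1 hx])
    have e3 := (enc_merge_cell (p := p) (q := []) (hα b (by simp))).1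
    refine ⟨_, _, _, e1, e2, ?_, ?_, ?_⟩
    · have : enc [] = [] := rfl
      rw [this] at e3
      rw [← e3, ev_enc]
      simpa [hp] using hi
    · rw [hl, wedge_append, wedge, if_neg (by omega), min_eq_left (by omega)]
    · rw [hl, ← hp, List.take_length_add_append]
      simp; omega

/-- Flipping a letter after an even number of cells, in front of a cell boundary, is an elementary
operation at an even index. -/
theorem exists_elemOpAt_of_enc_eq {α : List ℕ} {H κ : List Bool} {s : Bool}
    (hα : ∀ x ∈ α, 0 < x) (h : enc α = H ++ s :: κ) (hs : Ev (H ++ [s]))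
    (hκ : κ = [] ∨ ∃ t, κ = true :: t) :
    ∃ j α', Even j ∧ ElemOpAt α j α' ∧ IsAlphaSeq α' ∧ enc α' = H ++ (!s) :: κ ∧
      (α.take j).sum = H.length + 1 := by
  obtain ⟨β, q, rfl, h1, rfl⟩ := enc_split (p := α) (u := H ++ [s]) (v := κ) (by simp [h]) hκ
  have hβ : Even β.length := by rwa [h1, ev_enc] at hs
  have hsum : ((β ++ q).take β.length).sum = H.length + 1 := by
    rw [List.take_left, ← length_enc fun x hx => hα x (List.mem_append_left _ hx), ← h1]
    simp
  rcases List.eq_nil_or_concat β with rfl | ⟨p, a, rfl⟩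
  · simp [enc] at h1
  rw [List.concat_eq_append] at *
  refine ⟨(p ++ [a]).length, ?_⟩
  rcases Nat.lt_or_ge 1 a with ha | ha
  · obtain ⟨e1, e2⟩ := enc_split_cell (p := p) (q := q) ha
    rw [show p ++ [a] ++ q = p ++ a :: q by simp] at *
    rw [h] at e1
    obtain ⟨rfl, h3⟩ := List.append_inj' e1 rfl
    obtain ⟨rfl, -⟩ := List.cons.inj h3
    refine ⟨p ++ (a - 1) :: 1 :: q, hβ, Or.inl ⟨⟨by simp, by simp, ?_⟩, ?_⟩,
      ⟨by simp, fun x hx => ?_⟩, e2, hsum⟩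
    · simpa using ha
    · simp [applyEs, List.drop_append]
    · simp only [List.mem_append, List.mem_cons] at hx
      rcases hx with hx | rfl | rfl | hx
      · exact hα x (by simp [hx])
      · omega
      · exact one_pos
      · exact hα x (by simp [hx])
  · obtain rfl : a = 1 := le_antisymm ha (hα a (by simp))
    rcases List.eq_nil_or_concat p with rfl | ⟨p, b, rfl⟩
    · simp at hβ
    rw [List.concat_eq_append] at *
    obtain ⟨e1, e2⟩ := enc_merge_cell (p := p) (q := q) (hα b (by simp))
    rw [show p ++ [b] ++ [1] ++ q = p ++ b :: 1 :: q by simp] at *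
    rw [h] at e1
    obtain ⟨rfl, h3⟩ := List.append_inj' e1 rfl
    obtain ⟨rfl, -⟩ := List.cons.inj h3
    refine ⟨p ++ (b + 1) :: q, hβ, Or.inr ⟨⟨by simp, by simp, by simp⟩, ?_⟩,
      ⟨by simp, fun x hx => ?_⟩, e2, hsum⟩
    · simp [applyEc, List.drop_append]
    · simp only [List.mem_append, List.mem_cons] at hx
      rcases hx with hx | rfl | hx
      · exact hα x (by simp [hx])
      · omega
      · exact hα x (by simp [hx])

/-- Among the lexical words of length `N` strictly between `x` and `y` there is a least one. -/
theorem exists_least_between {x y w : List Bool} {N : ℕ} (hw : w.length = N) (hL : Lx w)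
    (h1 : rk x < rk w) (h2 : rk w < rk y) :
    ∃ v, v.length = N ∧ Lx v ∧ rk x < rk v ∧ rk v < rk y ∧
      ∀ w', w'.length = N → Lx w' → rk x < rk w' → rk w' < rk v → False := by
  have hfin : {v : List Bool | v.length = N ∧ Lx v ∧ rk x < rk v ∧ rk v < rk y}.Finite :=
    (List.finite_length_eq Bool N).subset fun v hv => hv.1
  obtain ⟨v, ⟨hv1, hv2, hv3, hv4⟩, hv⟩ := hfin.exists_minimalFor rk _ ⟨w, hw, hL, h1, h2⟩
  exact ⟨v, hv1, hv2, hv3, hv4, fun w' a b c d =>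
    absurd (hv ⟨a, b, c, d.trans hv4⟩ d.le) (not_le.2 d)⟩

/-- adjacency criterion, case `r > 0`. -/
theorem stmt_11 (n : ℕ) (hn : 3 ≤ n) (α : List ℕ) (hα : α ∈ Lset n)
    (hng : ¬ GreatestIn (Lset n) α)
    (i : ℕ) (hi : GoodEvenIndex α i) (himax : ∀ j, GoodEvenIndex α j → j ≤ i)
    (α' : List ℕ) (hop : ElemOpAt α i α') (hα' : α' ∈ Lset n)
    (f : List ℕ) (hf : f = wedge α α') (hflex : IsLexical f)
    (m d r : ℕ) (hm : m = 1 + f.sum) (hmd : n = m * d + r) (hrm : r < m)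
    (hr : 0 < r) :
    AdjLtIn (Lset n) α α' := by
  obtain ⟨F, s, τ, hF, hF', hs, hFw, hFi⟩ := ElemOpAt.enc_flip hα.1.1.2 hi.1 hop
  have hlt : rk (enc α) < rk (enc α') := by rw [hF, hF']; exact rk_lt_flip hs _ _
  refine ⟨(lexLt_iff hα.1.1.2 hα'.1.1.2).2 hlt, fun γ hγ hbetween => ?_⟩
  rw [lexLt_iff hα.1.1.2 hγ.1.1.2, lexLt_iff hγ.1.1.2 hα'.1.1.2] at hbetween
  have hlen : (enc α).length = (enc γ).length := by
    rw [length_enc hα.1.1.2, length_enc hγ.1.1.2]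
    have := hα.2
    have := hγ.2
    omega
  obtain ⟨v, hvl, hvL, hv1, hv2, hmin⟩ := exists_least_between hlen.symm
    ((isLexical_iff hγ.1.1).1 hγ.1) hbetween.1 hbetween.2
  rcases prefix_or_diff (enc α) v with hp | hp | ⟨H, s₁, κ, ζ, hH, rfl⟩
  · exact hv1.ne (congrArg rk (hp.eq_of_length hvl.symm))
  · exact hv1.ne' (congrArg rk (hp.eq_of_length hvl))
  have hs₁ : Ev (H ++ [s₁]) := by rwa [hH, flip_lt_iff] at hv1
  have hζ : ζ.length = κ.length := by simpa [hH] using hvl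
  obtain ⟨t, ht, -⟩ := sandwich (u := F) (Or.inl ⟨by rwa [hF] at hv1, by rwa [hF'] at hv2⟩)
  have hFH : F.length ≤ H.length := by
    by_contra! hlt'
    have h1 : H ++ [s₁] <+: F := List.prefix_of_prefix_length_le
      ⟨κ, by rw [hH]; simp⟩ ⟨s :: τ, hF.symm⟩ (by simpa using hlt')
    have h2 : H ++ [!s₁] <+: F := List.prefix_of_prefix_length_le
      (l₃ := H ++ (!s₁) :: ζ) ⟨ζ, by simp⟩ ⟨t, ht.symm⟩ (by simpa using hlt')
    have h3 := (List.prefix_of_prefix_length_le h1 h2 (by simp)).eq_of_length (by simp)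
    simp at h3
  have hαL := (isLexical_iff hα.1.1).1 hα.1
  rw [hH] at hαL hv1 hmin hvl
  obtain ⟨hL, hκ, hdvd⟩ := exchange hs₁ hαL hvL hζ hmin
  obtain ⟨j, α'', hj, hop'', hα'', he, hjs⟩ := exists_elemOpAt_of_enc_eq hα.1.1.2 hH hs₁ hκ
  have hji := himax j ⟨hj, α'', hop'', (isLexical_iff hα'').2 (he ▸ hL)⟩
  have hsum : (α.take j).sum ≤ (α.take i).sum :=
    (List.take_sublist_take_left hji).sum_le_sum (by simp)
  have heq := hF.symm.trans hH
  obtain ⟨rfl, h4⟩ := List.append_inj heq (by omega)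
  obtain ⟨rfl, rfl⟩ := List.cons.inj h4
  have hn1 := hα.2
  rw [← length_enc hα.1.1.2, hF, List.length_append, List.length_cons] at hn1
  have hm' : m = F.length + 1 := by rw [hm, hf, ← hFw, add_comm]
  have hζτ := hdvd fun hd => by
    rw [← hm'] at hd
    have h5 : m ∣ n := by
      rw [← hn1, show 1 + (F.length + (τ.length + 1)) = m + (τ.length + 1) by omega]
      exact (dvd_refl m).add hd
    have h6 : m ∣ r := (Nat.dvd_add_right ⟨d, rfl⟩).1 (hmd ▸ h5)
    exact absurd (Nat.le_of_dvd hr h6) (not_le.2 hrm)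
  rw [hζτ, hF'] at hv2
  exact lt_irrefl _ hv2
end

section
/- Let n ≥ 3 and let α ∈ L_n not be the greatest element of L_n. Suppose there is an even index of α at which applying the applicable elementary operation (E_s or E_c) yields a lexical sequence; let i be the largest such even index and let α′ ∈ L_n be the result of applying that operation at cell i. Set f = α ∧ α′ and suppose f is lexical; let m = 1 + D(f) and write n = md + r with 0 ≤ r < m. If r = 0, then α is adjacent to f ⋆ λ in L_n, where λ is the least element of L_d and d = n/m. -/
namespace Word

section

/-- Comparison of words, each letter `true` reversing the order of what follows; the end of a
word lies strictly between the letters `false` and `true`. -/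
def cmp : List Bool → List Bool → ℤ
  | [], [] => 0
  | [], b :: _ => if b then -1 else 1
  | a :: _, [] => if a then 1 else -1
  | a :: x, b :: y => if a = b then (if a then - cmp x y else cmp x y) else (if a then 1 else -1)

def wlt (x y : List Bool) : Prop := cmp x y < 0

def wle (x y : List Bool) : Prop := cmp x y ≤ 0

infix:50 " <ʷ " => wlt
infix:50 " ≤ʷ " => wle

/-- Parity of the number of letters `true`. -/
def par : List Bool → Bool
  | [] => false
  | a :: x => xor a (par x)

@[simp] theorem par_nil : par [] = false := rfl

@[simp] theorem par_cons (a x) : par (a :: x) = xor a (par x) := rfl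

@[simp] theorem par_append (x y) : par (x ++ y) = xor (par x) (par y) := by
  induction x with
  | nil => simp
  | cons a x ih => simp [ih]

theorem cmp_swap (x y) : cmp y x = - cmp x y := by
  induction x generalizing y with
  | nil => cases y with
    | nil => rfl
    | cons b y => cases b <;> simp [cmp]
  | cons a x ih => cases y with
    | nil => cases a <;> simp [cmp]
    | cons b y => cases a <;> cases b <;> simp [cmp, ih y]

@[simp] theorem cmp_self (x) : cmp x x = 0 := by have := cmp_swap x x; omega

theorem eq_of_cmp {x y} (h : cmp x y = 0) : x = y := by
  induction x generalizing y with
  | nil => cases y with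
    | nil => rfl
    | cons b y => cases b <;> simp [cmp] at h
  | cons a x ih => cases y with
    | nil => cases a <;> simp [cmp] at h
    | cons b y =>
      cases a <;> cases b <;> simp [cmp] at h ⊢ <;> exact ih h

theorem cmp_trans (x y z) :
    (cmp x y < 0 → cmp y z < 0 → cmp x z < 0) ∧ (0 < cmp x y → 0 < cmp y z → 0 < cmp x z) := by
  induction x generalizing y z with
  | nil =>
    rcases y with _ | ⟨_ | _, y⟩ <;> rcases z with _ | ⟨_ | _, z⟩ <;> simp [cmp]
  | cons a x ih =>
    rcases y with _ | ⟨_ | _, y⟩ <;> rcases z with _ | ⟨_ | _, z⟩ <;> cases a <;> simp [cmp]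
    · exact ih y z
    · exact ⟨(ih y z).2, (ih y z).1⟩

theorem wlt_irrefl (x) : ¬ x <ʷ x := by simp [wlt]

theorem wle_refl (x) : x ≤ʷ x := by simp [wle]

theorem wlt_trans {x y z} (h : x <ʷ y) (h' : y <ʷ z) : x <ʷ z := (cmp_trans x y z).1 h h'

theorem wle_iff {x y} : x ≤ʷ y ↔ x <ʷ y ∨ x = y := by
  constructor
  · intro h
    rcases lt_or_eq_of_le h with h | h
    · exact Or.inl h
    · exact Or.inr (eq_of_cmp h)
  · rintro (h | rfl)
    · exact le_of_lt h
    · exact wle_refl x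

theorem wle_of_lt {x y} (h : x <ʷ y) : x ≤ʷ y := wle_iff.2 (Or.inl h)

theorem not_wlt {x y} : ¬ x <ʷ y ↔ y ≤ʷ x := by
  have := cmp_swap x y
  simp only [wlt, wle]; omega

theorem wlt_of_lt_of_le {x y z} (h : x <ʷ y) (h' : y ≤ʷ z) : x <ʷ z := by
  rcases wle_iff.1 h' with h' | rfl
  · exact wlt_trans h h'
  · exact h

theorem wlt_of_le_of_lt {x y z} (h : x ≤ʷ y) (h' : y <ʷ z) : x <ʷ z := by
  rcases wle_iff.1 h with h | rfl
  · exact wlt_trans h h'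
  · exact h'

theorem wle_trans {x y z} (h : x ≤ʷ y) (h' : y ≤ʷ z) : x ≤ʷ z := by
  rcases wle_iff.1 h with h | rfl
  · exact wle_of_lt (wlt_of_lt_of_le h h')
  · exact h'

theorem wlt_asymm {x y} (h : x <ʷ y) (h' : y <ʷ x) : False := wlt_irrefl _ (wlt_trans h h')

theorem wlt_tri {x y : List Bool} (h : x ≠ y) : x <ʷ y ∨ y <ʷ x := by
  by_contra! hc
  exact h (by rcases wle_iff.1 (not_wlt.1 hc.2) with h | h
              · exact absurd h hc.1
              · exact h)

theorem append_cmp (p x y) : cmp (p ++ x) (p ++ y) = if par p then - cmp x y else cmp x y := by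
  induction p with
  | nil => simp
  | cons a p ih => cases a <;> cases hp : par p <;> simp [cmp, ih, hp]

theorem append_lt_even {p} (h : par p = false) {x y} : p ++ x <ʷ p ++ y ↔ x <ʷ y := by
  simp [wlt, append_cmp, h]

theorem append_lt_odd {p} (h : par p = true) {x y} : p ++ x <ʷ p ++ y ↔ y <ʷ x := by
  simp [wlt, append_cmp, h, cmp_swap y x]

theorem append_le_even {p} (h : par p = false) {x y} : p ++ x ≤ʷ p ++ y ↔ x ≤ʷ y := by
  simp [wle, append_cmp, h]

/-- The truth value of a comparison decided at the letter `b` following `p` in the right word. -/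
theorem diff_lt {p : List Bool} {a b : Bool} (hab : a ≠ b) {x y} :
    p ++ a :: x <ʷ p ++ b :: y ↔ par (p ++ [b]) = true := by
  cases hp : par p <;> cases a <;> cases b <;> simp_all [wlt, append_cmp, cmp]

theorem end_lt {p : List Bool} {b : Bool} {y} :
    p <ʷ p ++ b :: y ↔ par (p ++ [b]) = true := by
  have := append_cmp p [] (b :: y)
  rw [List.append_nil] at this
  cases hp : par p <;> cases b <;> simp_all [wlt, cmp]

theorem lt_end {p : List Bool} {b : Bool} {y} :
    p ++ b :: y <ʷ p ↔ par (p ++ [b]) = false := by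
  have := append_cmp p (b :: y) []
  rw [List.append_nil] at this
  cases hp : par p <;> cases b <;> simp_all [wlt, cmp]

theorem wlt_cases {x y} (h : x <ʷ y) :
    (∃ b y', y = x ++ b :: y' ∧ par (x ++ [b]) = true) ∨
    (∃ a x', x = y ++ a :: x' ∧ par (y ++ [a]) = false) ∨
    (∃ p a b x' y', a ≠ b ∧ x = p ++ a :: x' ∧ y = p ++ b :: y' ∧ par (p ++ [b]) = true ∧
      par (p ++ [a]) = false) := by
  have key : x ≠ y → (∃ b y', y = x ++ b :: y') ∨ (∃ a x', x = y ++ a :: x') ∨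
      (∃ p a b x' y', a ≠ b ∧ x = p ++ a :: x' ∧ y = p ++ b :: y') := by
    clear h
    induction x generalizing y with
    | nil => cases y with
      | nil => simp
      | cons b y => intro _; exact Or.inl ⟨b, y, rfl⟩
    | cons a x ih => cases y with
      | nil => intro _; exact Or.inr (Or.inl ⟨a, x, rfl⟩)
      | cons b y =>
        intro hne
        by_cases hab : a = b
        · subst hab
          rcases ih (y := y) (by simpa using hne) with ⟨c, y', h⟩ | ⟨c, y', h⟩ |
            ⟨p, c, d, x', y', h⟩
          · exact Or.inl ⟨c, y', by simp [h]⟩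
          · exact Or.inr (Or.inl ⟨c, y', by simp [h]⟩)
          · exact Or.inr (Or.inr ⟨a :: p, c, d, x', y', by simp [h]⟩)
        · exact Or.inr (Or.inr ⟨[], a, b, x, y, hab, rfl, rfl⟩)
  rcases key (by rintro rfl; exact wlt_irrefl _ h) with ⟨b, y', rfl⟩ | ⟨a, x', rfl⟩ |
    ⟨p, a, b, x', y', hab, rfl, rfl⟩
  · exact Or.inl ⟨b, y', rfl, end_lt.1 h⟩
  · exact Or.inr (Or.inl ⟨a, x', rfl, lt_end.1 h⟩)
  · have h1 := (diff_lt hab).1 h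
    refine Or.inr (Or.inr ⟨p, a, b, x', y', hab, rfl, rfl, h1, ?_⟩)
    cases a <;> cases b <;> simp_all

theorem sandwich {u x y x'} (h : u ++ x <ʷ y) (h' : y <ʷ u ++ x') : ∃ z, y = u ++ z := by
  induction u generalizing x y x' with
  | nil => exact ⟨y, rfl⟩
  | cons a u ih =>
    cases y with
    | nil => cases a <;> simp_all [wlt, cmp]
    | cons b y =>
      have hab : a = b := by
        by_contra hab
        cases a <;> cases b <;> simp_all [wlt, cmp]
      subst hab
      cases a
      · obtain ⟨z, hz⟩ := ih (x := x) (y := y) (x' := x') (by simpa [wlt, cmp] using h)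
          (by simpa [wlt, cmp] using h')
        exact ⟨z, by simp [hz]⟩
      · obtain ⟨z, hz⟩ := ih (x := x') (y := y) (x' := x)
          (by have := cmp_swap y (u ++ x'); simp [wlt, cmp] at *; omega)
          (by have := cmp_swap y (u ++ x); simp [wlt, cmp] at *; omega)
        exact ⟨z, by simp [hz]⟩

/-- A word strictly above all its proper suffixes. -/
def Max (u : List Bool) : Prop := ∀ t s, u = t ++ s → t ≠ [] → s <ʷ u

/-- All suffixes of `y`, `y` included, lie strictly below `α`. -/
def Adm (α y : List Bool) : Prop := ∀ t s, y = t ++ s → s <ʷ α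

variable {α : List Bool}

theorem Max.border {g g' t x : List Bool} {c : Bool} (hg : Max g) (h : g = t ++ g') (ht : t ≠ [])
    (h' : g = g' ++ c :: x) : par (g' ++ [c]) = true := by
  have := hg t g' h ht
  rw [h'] at this
  exact end_lt.1 this

theorem max_of_two {A r₁ r₂ x₁ x₂ : List Bool} (hr : r₁.head? ≠ r₂.head?)
    (h₁ : ∀ t s, A = t ++ s → t ≠ [] → s ++ r₁ <ʷ A ++ x₁)
    (h₂ : ∀ t s, A = t ++ s → t ≠ [] → s ++ r₂ <ʷ A ++ x₂) : Max A := by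
  intro t s hA ht
  by_contra hlt
  have hne : A ≠ s := by
    rintro rfl
    exact ht (by simpa using hA)
  rcases wlt_cases ((wlt_tri hne).resolve_right hlt) with ⟨b, y', h, -⟩ | ⟨c, x', h, hp⟩ |
    ⟨p, a, b, x', y', hab, h, h', hp, -⟩
  · have h1 := congrArg List.length h
    have h2 := congrArg List.length hA
    simp at h1 h2
    omega
  · have key : ∀ r x, s ++ r <ʷ A ++ x → r.head? = some c := by
      intro r x hlt
      rcases r with _ | ⟨e, r⟩
      · rw [h, List.append_nil, List.append_assoc, List.cons_append] at hlt
        rw [end_lt.1 hlt] at hp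
        simp at hp
      · rw [h, List.append_assoc, List.cons_append] at hlt
        by_contra hec
        rw [diff_lt (by simpa using hec)] at hlt
        simp_all
    exact hr ((key _ _ (h₁ t s hA ht)).trans (key _ _ (h₂ t s hA ht)).symm)
  · have h1 := h₁ t s hA ht
    rw [h, h', List.append_assoc, List.append_assoc, List.cons_append, List.cons_append,
      diff_lt hab.symm] at h1
    cases a <;> cases b <;> simp_all

theorem max_of_max_of_max {u v w : List Bool} {a b : Bool} (hab : a ≠ b)
    (h : Max (u ++ a :: v)) (h' : Max (u ++ b :: w)) : Max u :=
  max_of_two (r₁ := a :: v) (r₂ := b :: w) (by simpa using hab)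
    (fun t s hu ht => h t _ (by simp [hu]) ht) (fun t s hu ht => h' t _ (by simp [hu]) ht)

theorem par_flip {g : List Bool} {a : Bool} (h : par (g ++ [a]) = false) :
    par (g ++ [!a]) = true := by
  cases a <;> simp_all

/-- If replacing the letter `a` by `!a` after `g` destroys maximality, some border of `g` is
responsible. -/
theorem exists_border_of_not_max {g v : List Bool} {a : Bool} (hg : Max g)
    (hα : Max (g ++ a :: v)) (hpar : par (g ++ [a]) = false) (hn : ¬ Max (g ++ (!a) :: v)) :
    ∃ t P z, t ≠ [] ∧ g = t ++ P ∧ g = P ++ (!a) :: z ∧ par (P ++ [!a]) = true ∧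
      v ≤ʷ z ++ (!a) :: v := by
  simp only [Max, not_forall] at hn
  obtain ⟨t, s, hs, ht, hlt⟩ := hn
  have hflip : g ++ a :: v <ʷ g ++ (!a) :: v := (diff_lt (by simp)).2 (par_flip hpar)
  have hcase : (∃ P, g = t ++ P ∧ s = P ++ (!a) :: v) ∨ ∃ a', v = a' ++ s := by
    rcases List.append_eq_append_iff.1 hs with ⟨_ | ⟨e, a'⟩, rfl, h⟩ | ⟨P, h, h'⟩
    · exact Or.inl ⟨[], by simp, by simpa using h.symm⟩
    · simp only [List.cons_append, List.cons.injEq] at h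
      exact Or.inr ⟨a', h.2⟩
    · exact Or.inl ⟨P, h, h'⟩
  rcases hcase with ⟨P, hP, rfl⟩ | ⟨a', h⟩
  · have hPg := hg t P hP ht
    rcases wlt_cases hPg with ⟨c, y', h, hp⟩ | ⟨c, x', h, hp⟩ | ⟨p, d, b, x', y', hab, h, h', hp, -⟩
    · by_cases hc : c = !a
      · subst hc
        refine ⟨t, P, y', ht, hP, h, hp, ?_⟩
        rw [← not_wlt, ← append_lt_odd hp]
        rw [h] at hlt
        simpa using hlt
      · refine absurd ?_ hlt
        rw [h, List.append_assoc, List.cons_append]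
        exact (diff_lt (Ne.symm hc)).2 hp
    · have h1 := congrArg List.length h
      have h2 := congrArg List.length hP
      simp at h1 h2
      omega
    · refine absurd ?_ hlt
      rw [h, h', List.append_assoc, List.append_assoc, List.cons_append, List.cons_append]
      exact (diff_lt hab).2 hp
  · exact absurd (wlt_trans (hα (g ++ a :: a') s (by simp [h]) (by simp)) hflip) hlt

theorem cons_true {x y : List Bool} : true :: x <ʷ true :: y ↔ y <ʷ x :=
  append_lt_odd (p := [true]) rfl

theorem not_max_pinch (x : List Bool) :
    ¬ (true :: true :: x <ʷ x ∧ x <ʷ true :: x) ∧ ¬ (true :: x <ʷ x ∧ x <ʷ true :: true :: x) := by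
  induction x with
  | nil => simp [wlt, cmp]
  | cons a x ih =>
    cases a
    · simp [wlt, cmp]
    · rw [cons_true, cons_true, cons_true, cons_true]
      exact ⟨fun h => ih.2 ⟨h.2, by simpa [cons_true] using h.1⟩,
        fun h => ih.1 ⟨by simpa [cons_true] using h.2, h.1⟩⟩

theorem Max.head {e : Bool} {α : List Bool} (h : Max (e :: α)) : e = true := by
  have := h (e :: α) [] (by simp) (by simp)
  cases e <;> simp_all [wlt, cmp]

theorem Max.start {e c : Bool} {α : List Bool} (h : Max (e :: c :: α)) : e = true ∧ c = false := by
  obtain rfl := h.head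
  refine ⟨rfl, ?_⟩
  cases c
  · rfl
  · exfalso
    have h1 := h [true] (true :: α) rfl (by simp)
    have h2 := h [true, true] α (by simp) (by simp)
    have h1 : true :: α <ʷ α := by
      rwa [cons_true] at h1
    exact (not_max_pinch α).2 ⟨h1, h2⟩

theorem Max.adm_replicate {α : List Bool} (h : Max α) (h2 : 2 ≤ α.length) (k : ℕ) :
    Adm α (List.replicate k true) := by
  intro t s hs
  obtain ⟨-, -, hs⟩ := List.append_eq_replicate_iff.1 hs.symm
  rcases α with _ | ⟨e, _ | ⟨c, α⟩⟩
  · simp at h2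
  · simp at h2
  · obtain ⟨rfl, rfl⟩ := h.start
    rw [hs]
    rcases s.length with _ | _ | n <;> simp [List.replicate, wlt, cmp]

theorem Adm.suffix {α t s : List Bool} (h : Adm α (t ++ s)) : Adm α s :=
  fun t' s' hs => h (t ++ t') s' (by simp [hs])

theorem wlt_same_length {x y : List Bool} (h : x <ʷ y) (hl : x.length = y.length) :
    ∃ p a x' y', x = p ++ a :: x' ∧ y = p ++ (!a) :: y' ∧ par (p ++ [!a]) = true ∧
      par (p ++ [a]) = false := by
  rcases wlt_cases h with ⟨b, y', rfl, -⟩ | ⟨c, x', rfl, -⟩ | ⟨p, a, b, x', y', hab, h1, h2, hp, hp'⟩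
  · simp at hl
  · simp at hl
  · obtain rfl : b = !a := by cases a <;> cases b <;> simp_all
    exact ⟨p, a, x', y', h1, h2, hp, hp'⟩

theorem wlt_replicate (w : List Bool) : false :: w <ʷ List.replicate (w.length + 1) true := by
  simp [List.replicate, wlt, cmp]

theorem border_split {u T t s : List Bool} {a : Bool} (h : u ++ a :: T = t ++ s) :
    (∃ t', T = t' ++ s) ∨ ∃ X, s = X ++ a :: T ∧ u = t ++ X := by
  rcases List.append_eq_append_iff.1 h with ⟨_ | ⟨e, a'⟩, rfl, h₂⟩ | ⟨P, h, h'⟩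
  · exact Or.inr ⟨[], by simpa using h₂.symm, by simp⟩
  · exact Or.inl ⟨a', (List.cons.inj h₂).2⟩
  · exact Or.inr ⟨P, h', h⟩

theorem border_par {u t X T x : List Bool} {a : Bool} (hu : Max u) (hX : u = t ++ X) (ht : t ≠ [])
    (h : u ++ a :: T = X ++ a :: x) : par (X ++ [a]) = true := by
  have hl : X.length < u.length := by
    have := List.length_pos_iff.2 ht
    rw [hX, List.length_append]
    omega
  rcases List.append_eq_append_iff.1 h with ⟨a', rfl, -⟩ | ⟨_ | ⟨e, P⟩, h, h'⟩
  · simp at hl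
  · simp [h] at hl
  · obtain rfl : a = e := by simpa using (List.cons.inj h').1
    exact hu.border hX ht h

/-- Maximality of a prefix `u a T` of a maximal word, when `T d` is even and follows the odd
border condition. -/
theorem max_extend {u T w : List Bool} {a d : Bool} (hα : Max (u ++ a :: (T ++ d :: w)))
    (hu : Max u) (hp : par (T ++ [d]) = false)
    (hT : ∀ t s x, T = t ++ s → u ++ a :: (T ++ d :: w) = s ++ d :: x → par (s ++ [d]) = true) :
    Max (u ++ a :: T) := by
  intro t s hs ht
  by_contra hlt
  have hne : u ++ a :: T ≠ s := by
    intro h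
    have := congrArg List.length hs
    have ht' := List.length_pos_iff.2 ht
    simp only [← h, List.length_append] at this
    omega
  have hsα : s ++ d :: w <ʷ (u ++ a :: T) ++ d :: w := by
    simpa using hα t (s ++ d :: w) (by rw [← List.append_assoc, ← hs]; simp) ht
  rcases wlt_cases ((wlt_tri hne).resolve_right hlt) with ⟨b, x, h, -⟩ | ⟨c, x, h, hc⟩ |
    ⟨p, b, c, x, x', hbc, h, h', hpc, -⟩
  · have h1 := congrArg List.length h
    have h2 := congrArg List.length hs
    simp only [List.length_append, List.length_cons] at h1 h2
    omega
  · have hcd : d = c := by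
      by_contra hcd
      rw [h, List.append_assoc, List.cons_append, diff_lt hcd, hc] at hsα
      simp at hsα
    subst hcd
    rcases border_split hs with ⟨t', hT'⟩ | ⟨X, rfl, hX⟩
    · have := hT t' s (x ++ d :: w) hT' (by
        rw [← List.cons_append, ← List.append_assoc, h, List.append_assoc]; rfl)
      rw [hc] at this
      simp at this
    · have := border_par hu hX ht (x := T ++ d :: x) (by rw [h]; simp)
      simp only [par_append, par_cons, par_nil] at hp hc this
      revert hp hc this
      cases par X <;> cases a <;> cases par T <;> cases d <;> simp
  · rw [h, h', List.append_assoc, List.append_assoc, List.cons_append, List.cons_append,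
      diff_lt hbc.symm] at hsα
    clear * - hsα hpc hbc
    simp only [par_append, par_cons, par_nil] at hsα hpc
    revert hsα hpc hbc
    cases par p <;> cases b <;> cases c <;> simp

/-- Given an admissible word above the tail of `α`, some later even boundary can be flipped. -/
theorem exists_flip (v : List Bool) : ∀ (u : List Bool) (a : Bool) (y : List Bool),
    Max (u ++ a :: v) → par (u ++ [a]) = false → Max u → Adm (u ++ a :: v) y →
    v.length = y.length → v <ʷ y →
    ∃ g d w, u ++ a :: v = g ++ d :: w ∧ u.length < g.length ∧ par (g ++ [d]) = false ∧
      w.head? ≠ some false ∧ Max (g ++ (!d) :: w) := by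
  induction hk : v.length using Nat.strong_induction_on generalizing v with
  | _ k ih =>
  intro u a y hα hpar hu hy hlen hvy
  subst hk
  obtain ⟨T, d, w, y', rfl, rfl, hp', hp⟩ := wlt_same_length hvy hlen
  set g := u ++ a :: T with hgdef
  have hαg : u ++ a :: (T ++ d :: w) = g ++ d :: w := by simp [hgdef]
  rw [hαg] at hα hy ⊢
  have hgd : par (g ++ [d]) = false := by
    simp only [hgdef, par_append, par_cons, par_nil] at hp hpar ⊢
    revert hp hpar
    cases par u <;> cases a <;> cases par T <;> cases d <;> simp
  have hg : Max g := by
    refine max_extend (d := d) (w := w) (by rwa [hαg]) hu hp fun t s x hT hx => ?_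
    have := hy t (s ++ (!d) :: y') (by simp [hT])
    rwa [← hαg, hx, diff_lt (by simp)] at this
  have hlt : u.length < g.length := by simp [hgdef]
  have hlen' : w.length < (T ++ d :: w).length := by simp; omega
  have hpos : w.head? ≠ some false → ∃ g' d' w', g ++ d :: w = g' ++ d' :: w' ∧
      u.length < g'.length ∧ par (g' ++ [d']) = false ∧ w'.head? ≠ some false ∧
      Max (g' ++ (!d') :: w') := by
    intro hw
    by_cases hm : Max (g ++ (!d) :: w)
    · exact ⟨g, d, w, rfl, hlt, hgd, hw, hm⟩
    · obtain ⟨t, P, z, ht, hs, hz, hP, hwz⟩ := exists_border_of_not_max hg hα hgd hm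
      rcases border_split (hgdef.symm.trans hs) with ⟨t', hT⟩ | ⟨X, rfl, hX⟩
      · have h1 := hy t' (P ++ (!d) :: y') (by simp [hT])
        rw [hz, List.append_assoc, List.cons_append, ← List.singleton_append, ← List.append_assoc,
          ← List.singleton_append (l := z ++ d :: w), ← List.append_assoc, append_lt_odd hP] at h1
        have h2 : z ++ (!d) :: w <ʷ z ++ d :: w := by
          rw [diff_lt (by simp)]
          have := par_flip hgd
          rw [hz] at hgd
          simp only [par_append, par_cons, par_nil] at hP hgd ⊢
          revert hP hgd
          cases par P <;> cases par z <;> cases d <;> simp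
        have h3 : w <ʷ y' := wlt_of_le_of_lt hwz (wlt_trans h2 h1)
        obtain ⟨g', d', w', h1, h2, h3⟩ := ih _ hlen' w rfl g d y' hα hgd hg
          (Adm.suffix (t := T ++ [!d]) (by simpa using hy)) (by simpa using hlen) h3
        exact ⟨g', d', w', h1, by omega, h3⟩
      · exfalso
        have := border_par hu hX ht (x := T ++ (!d) :: z) (by rw [← hgdef, hz]; simp)
        simp only [par_append, par_cons, par_nil] at hp' hP this
        revert hp' hP this
        cases par X <;> cases a <;> cases par T <;> cases d <;> simp
  rcases w with _ | ⟨_ | _, w⟩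
  · exact hpos (by simp)
  · obtain ⟨g', d', w', h1, h2, h3⟩ := ih _ hlen' (false :: w) rfl g d
      (List.replicate (w.length + 1) true) hα hgd hg (hα.adm_replicate (by simp; omega) _)
      (by simp) (wlt_replicate w)
    exact ⟨g', d', w', h1, by omega, h3⟩
  · exact hpos (by simp)

def lcp : List Bool → List Bool → List Bool
  | a :: x, b :: y => if a = b then a :: lcp x y else []
  | _, _ => []

theorem prefix_split {X r Y r' : List Bool} {c : Bool} (h : X ++ r = Y ++ c :: r')
    (hl : Y.length < X.length) : ∃ x, X = Y ++ c :: x := by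
  rcases List.append_eq_append_iff.1 h with ⟨a, rfl, -⟩ | ⟨_ | ⟨e, a⟩, h1, h2⟩
  · simp at hl
  · simp [h1] at hl
  · obtain rfl : c = e := by simpa using (List.cons.inj h2).1
    exact ⟨a, h1⟩

theorem drop_of_eq {α G r : List Bool} {b : Bool} (h : α = G ++ b :: r) :
    α.drop (G.length + 1) = r := by
  rw [h, ← List.singleton_append, ← List.append_assoc]
  exact List.drop_left' (by simp)

theorem lcp_spec (x y : List Bool) :
    ∃ r r', x = lcp x y ++ r ∧ y = lcp x y ++ r' ∧ ∀ e, r.head? = some e → r'.head? ≠ some e := by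
  induction x generalizing y with
  | nil => exact ⟨[], y, by simp [lcp], by simp [lcp], by simp⟩
  | cons a x ih =>
    rcases y with _ | ⟨b, y⟩
    · exact ⟨a :: x, [], by simp [lcp], by simp [lcp], by simp⟩
    · by_cases hab : a = b
      · subst hab
        obtain ⟨r, r', h1, h2, h3⟩ := ih y
        exact ⟨r, r', by simpa [lcp] using h1, by simpa [lcp] using h2, h3⟩
      · refine ⟨a :: x, b :: y, by simp [lcp, hab], by simp [lcp, hab], ?_⟩
        simp only [List.head?_cons, Option.some.injEq, ne_eq]
        rintro e rfl rfl
        exact hab rfl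

theorem length_le_lcp (A x y : List Bool) : A.length ≤ (lcp (A ++ x) (A ++ y)).length := by
  induction A with
  | nil => simp
  | cons a A ih => simpa [lcp] using ih

/-- One plus the length of the longest common prefix of `α` and its suffix from position `s`. -/
def hop (α : List Bool) (s : ℕ) : ℕ := (lcp (α.drop s) α).length + 1

theorem hop_gt {α A x y : List Bool} {s : ℕ} (h : α.drop s = A ++ x) (h' : α = A ++ y) :
    A.length < hop α s := by
  have := length_le_lcp A x y
  rw [← h, ← h'] at this
  exact Nat.lt_succ_of_le this

theorem hop_spec {α : List Bool} {s : ℕ} (hα : Max α) (h1 : 1 ≤ s) (h2 : s ≤ α.length) :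
    ∃ A e r, A.length + 1 = hop α s ∧ α = A ++ e :: r ∧ par (A ++ [e]) = true ∧ Max A ∧
      (α.drop s = A ∨ ∃ x, α.drop s = A ++ (!e) :: x) := by
  obtain ⟨x, y, hx, hy, hxy⟩ := lcp_spec (α.drop s) α
  have hhop : (lcp (α.drop s) α).length + 1 = hop α s := rfl
  generalize lcp (α.drop s) α = A at *
  have ht : α.take s ≠ [] := by
    rw [← List.length_pos_iff, List.length_take]
    omega
  have hlt := hα (α.take s) (α.drop s) (by simp) ht
  have hlen := congrArg List.length hx
  have hlen' := congrArg List.length hy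
  simp only [List.length_append, List.length_drop] at hlen hlen'
  rcases y with _ | ⟨e, r⟩
  · simp at hlen'
    omega
  · have hx' : x = [] ∨ ∃ x', x = (!e) :: x' := by
      rcases x with _ | ⟨d, x⟩
      · exact Or.inl rfl
      · right
        have := hxy d rfl
        clear * - this
        cases d <;> cases e <;> simp at this ⊢
    have hpar : par (A ++ [e]) = true := by
      rw [hx, hy] at hlt
      rcases hx' with rfl | ⟨x', rfl⟩
      · rwa [List.append_nil, end_lt] at hlt
      · rwa [diff_lt (by simp)] at hlt
    refine ⟨A, e, r, hhop, hy, hpar, ?_, ?_⟩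
    · refine max_of_two (r₁ := x) (r₂ := e :: r) (x₁ := e :: r) (x₂ := e :: r) ?_ ?_ ?_
      · rcases hx' with rfl | ⟨x', rfl⟩ <;> simp
      · intro t s' hs hts
        rw [← hy]
        refine hα (α.take s ++ t) _ ?_ (by simp [hts])
        rw [List.append_assoc, ← List.append_assoc t, ← hs, ← hx, List.take_append_drop]
      · intro t s' hs hts
        rw [← hy]
        refine hα t _ ?_ hts
        rw [← List.append_assoc, ← hs, ← hy]
    · rcases hx' with rfl | ⟨x', rfl⟩
      · left; simpa using hx
      · exact Or.inr ⟨x', hx⟩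

/-- Positions of the chain: `h` is in the chain when the prefix of length `h` is odd and its
prefix of length `h - 1` is maximal. -/
def InS (α : List Bool) (h : ℕ) : Prop :=
  ∃ G b r, α = G ++ b :: r ∧ h = G.length + 1 ∧ Max G ∧ par (G ++ [b]) = true

theorem InS.pos {s : ℕ} (hs : InS α s) : 1 ≤ s := by
  obtain ⟨G, b, r, -, rfl, -⟩ := hs
  omega

theorem InS.le {s : ℕ} (hs : InS α s) : s ≤ α.length := by
  obtain ⟨G, b, r, rfl, rfl, -⟩ := hs
  simp

theorem inS_hop {s : ℕ} (hα : Max α) (h1 : 1 ≤ s) (h2 : s ≤ α.length) : InS α (hop α s) := by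
  obtain ⟨A, e, r, h, h', hp, hA, -⟩ := hop_spec hα h1 h2
  exact ⟨A, e, r, h', h.symm, hA, hp⟩

theorem add_hop_le {s : ℕ} (hα : Max α) (h1 : 1 ≤ s) (h2 : s ≤ α.length) :
    s + hop α s ≤ α.length + 1 := by
  obtain ⟨A, e, r, h, h', hp, hA, h3⟩ := hop_spec hα h1 h2
  rcases h3 with h3 | ⟨x, h3⟩ <;>
  · have := congrArg List.length h3
    simp at this
    omega

theorem InS.split {s p : ℕ} (hs : InS α s) (hp : InS α p) (hsp : s < p) :
    ∃ G b m c r, α = G ++ b :: (m ++ c :: r) ∧ s = G.length + 1 ∧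
      p = (G ++ b :: m).length + 1 ∧ Max G ∧ par (G ++ [b]) = true ∧ Max (G ++ b :: m) ∧
      par (m ++ [c]) = false := by
  obtain ⟨G, b, r, h1, rfl, hG, hb⟩ := hs
  obtain ⟨G', c, r', h2, rfl, hG', hc⟩ := hp
  obtain ⟨m, rfl⟩ : ∃ m, G' = G ++ b :: m := by
    rcases List.append_eq_append_iff.1 (h1.symm.trans h2) with ⟨_ | ⟨e, a⟩, h, h'⟩ | ⟨a, h, h'⟩
    · simp at h
      subst h
      omega
    · obtain rfl : b = e := by simpa using (List.cons.inj h').1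
      exact ⟨a, h⟩
    · simp [h] at hsp
  refine ⟨G, b, m, c, r', by simp [h2], rfl, rfl, hG, hb, hG', ?_⟩
  simp only [par_append, par_cons, par_nil] at hb hc ⊢
  revert hb hc
  cases par G <;> cases b <;> cases par m <;> cases c <;> simp

theorem InS.add_hop {s : ℕ} (hα : Max α) (hs : InS α s) (h : s + hop α s ≤ α.length) :
    InS α (s + hop α s) := by
  obtain ⟨A, e, r, h1, h2, hp, hA, h3⟩ := hop_spec hα hs.pos hs.le
  obtain ⟨G, b, β, h4, h5, hG, hb⟩ := hs
  have hd : α.drop s = β := h5 ▸ drop_of_eq h4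
  rcases h3 with h3 | ⟨x, h3⟩
  · have := congrArg List.length h3
    simp at this
    omega
  · have hβ := hd.symm.trans h3
    have hpe : par (A ++ [!e]) = false := by
      revert hp
      simp only [par_append, par_cons, par_nil]
      cases par A <;> cases e <;> simp
    rw [hβ] at h4
    refine ⟨G ++ b :: A, !e, x, by simp [h4], by simp; omega, ?_, ?_⟩
    · refine max_extend (d := !e) (w := x) (h4 ▸ hα) hG hpe fun t s' y hT hy => ?_
      rw [← h4] at hy
      rcases t with _ | ⟨c, t⟩
      · rw [h2] at hy
        simp at hT
        simp [hT] at hy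
      · have := hα (c :: t) (s' ++ e :: r) (by rw [← List.append_assoc, ← hT, h2]) (by simp)
        rwa [hy, diff_lt (by simp)] at this
    · simp only [par_append, par_cons, par_nil] at hb hpe ⊢
      revert hb hpe
      cases par G <;> cases b <;> cases par A <;> cases e <;> simp

theorem InS.add_hop_le {s p : ℕ} (hα : Max α) (hs : InS α s) (hp : InS α p) (hsp : s < p) :
    s + hop α s ≤ p := by
  obtain ⟨G, b, m, c, r, h1, h2, h3, hG, hb, hm, hc⟩ := hs.split hp hsp
  obtain ⟨A, e, r', h4, h5, -, -, h6⟩ := hop_spec hα hs.pos hs.le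
  by_contra! hlt
  have hd : α.drop s = m ++ c :: r := h2 ▸ drop_of_eq h1
  have hlen : m.length < A.length := by
    simp at h3
    omega
  obtain ⟨x, hx⟩ : ∃ x, A = m ++ c :: x := by
    rcases h6 with h6 | ⟨x, h6⟩
    · exact ⟨r, h6.symm.trans hd⟩
    · exact prefix_split (h6.symm.trans hd) hlen
  obtain ⟨y, hy⟩ : ∃ y, G ++ b :: m = m ++ c :: y := by
    refine prefix_split (r := c :: r) (r' := x ++ e :: r') ?_ (by simp; omega)
    rw [List.append_assoc, List.cons_append, ← h1, h5, hx]
    simp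
  have := hm.border (t := G ++ [b]) (by simp) (by simp) hy
  rw [hc] at this
  simp at this

theorem InS.hop_le {s : ℕ} (hα : Max α) (hs : InS α s) : hop α s ≤ s := by
  by_contra! h
  have := hs.add_hop_le hα (inS_hop hα hs.pos hs.le) h
  have := hs.pos
  omega

theorem par_not {g : List Bool} {a : Bool} : par (g ++ [!a]) = !par (g ++ [a]) := by
  cases a <;> simp

theorem cons_eq {g x : List Bool} {a : Bool} : g ++ a :: x = (g ++ [a]) ++ x := by simp

/-- `A d y` is admissible as soon as it is below `α` and, for the borders of `A`, it dominates
a suffix of `α`. -/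
theorem adm_glue {A x y : List Bool} {d e : Bool} {r : List Bool} (hA : Max A)
    (hαA : α = A ++ e :: r)
    (hx : ∀ t s, A = t ++ s → t ≠ [] → s ++ d :: x <ʷ α) (hxy : x ≤ʷ y) (hy : Adm α y)
    (hlt : A ++ d :: y <ʷ α) : Adm α (A ++ d :: y) := by
  intro t s hs
  rcases border_split hs with ⟨t', ht⟩ | ⟨X, rfl, hX⟩
  · exact hy t' s ht
  · rcases t with _ | ⟨a, t⟩
    · rwa [← show A = X from hX]
    · have h1 := hx _ X hX (by simp)
      rcases wlt_cases (hA _ X hX (by simp)) with ⟨c, z, h, hp⟩ | ⟨c, z, h, hp⟩ |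
        ⟨p, c, c', z, z', hcc, h, h', hp, -⟩
      · by_cases hc : d = c
        · subst hc
          rw [hαA, h, List.append_assoc, List.cons_append, cons_eq, cons_eq (x := z ++ _),
            append_lt_odd hp] at h1 ⊢
          exact wlt_of_lt_of_le h1 hxy
        · rw [hαA, h, List.append_assoc, List.cons_append, diff_lt hc, hp]
      · have h1 := congrArg List.length h
        have h2 := congrArg List.length hX
        simp at h1 h2
        omega
      · rw [hαA, h, h', List.append_assoc, List.append_assoc, List.cons_append, List.cons_append,
          diff_lt hcc, hp]

/-- Some admissible word of length `j - 1` is at least the suffix of `α` from position `s`. -/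
def Reach (α : List Bool) (s j : ℕ) : Prop :=
  ∃ y, Adm α y ∧ y.length + 1 = j ∧ α.drop s ≤ʷ y

theorem adm_prefix {A r : List Bool} {e : Bool} (hA : Max A) (h : α = A ++ e :: r)
    (hp : par (A ++ [e]) = true) : Adm α A := by
  intro t s hs
  have hAα : A <ʷ α := by rw [h, end_lt, hp]
  rcases t with _ | ⟨a, t⟩
  · rwa [← show A = s from hs]
  · exact wlt_trans (hA _ s hs (by simp)) hAα

theorem reach_hop {s : ℕ} (hα : Max α) (h1 : 1 ≤ s) (h2 : s ≤ α.length) :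
    Reach α s (hop α s) := by
  obtain ⟨A, e, r, h, h', hp, hA, h3⟩ := hop_spec hα h1 h2
  refine ⟨A, adm_prefix hA h' hp, h, ?_⟩
  rcases h3 with h3 | ⟨x, h3⟩
  · rw [h3]; exact wle_refl _
  · rw [h3]
    exact wle_of_lt (lt_end.2 (by rw [par_not, hp]; rfl))

theorem reach_next {s j : ℕ} (hα : Max α) (h1 : 1 ≤ s) (h2 : s + hop α s ≤ α.length)
    (hj : Reach α (s + hop α s) j) : Reach α s (hop α s + j) := by
  obtain ⟨A, e, r, h, h', hp, hA, h3⟩ := hop_spec hα h1 (by omega)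
  obtain ⟨y, hy, hyl, hle⟩ := hj
  have hp' : par (A ++ [!e]) = false := by rw [par_not, hp]; rfl
  rcases h3 with h3 | ⟨x, h3⟩
  · have := congrArg List.length h3
    simp at this
    omega
  · have hx : α.drop (s + hop α s) = x := by
      rw [← List.drop_drop, ← h, drop_of_eq h3]
    rw [hx] at hle
    refine ⟨A ++ (!e) :: y, adm_glue hA h' ?_ hle hy ?_, by simp; omega, ?_⟩
    · intro t s' hs ht
      refine hα (α.take s ++ t) _ ?_ (by simp [ht])
      rw [List.append_assoc, ← List.append_assoc t, ← hs, ← h3, List.take_append_drop]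
    · rw [h', diff_lt (by simp), hp]
    · rw [h3, cons_eq, cons_eq (x := y), append_le_even hp']
      exact hle

theorem adm_double {A y r : List Bool} {e : Bool} (hα : Max α) (hA : Max A) (h : α = A ++ e :: r)
    (hp : par (A ++ [e]) = true) (hy : Adm α y) (hle : r ≤ʷ y) (hl : r.length ≠ y.length) :
    Adm α (A ++ e :: y) := by
  refine adm_glue hA h ?_ hle hy ?_
  · intro t s hs ht
    exact hα t _ (by rw [← List.append_assoc, ← hs, h]) ht
  · rw [h, cons_eq, cons_eq (x := r), append_lt_odd hp]
    rcases wle_iff.1 hle with h | h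
    · exact h
    · exact absurd (congrArg List.length h) hl

theorem reach_double {s j : ℕ} (hα : Max α) (h1 : 1 ≤ s) (h2 : s ≤ α.length)
    (hj : Reach α (hop α s) j) (hlt : hop α s + j ≤ α.length) : Reach α s (hop α s + j) := by
  obtain ⟨A, e, r, h, h', hp, hA, h3⟩ := hop_spec hα h1 h2
  obtain ⟨y, hy, hyl, hle⟩ := hj
  rw [← h, drop_of_eq h'] at hle
  have := congrArg List.length h'
  simp only [List.length_append, List.length_cons] at this
  refine ⟨A ++ e :: y, adm_double hα hA h' hp hy hle (by omega), by simp; omega, ?_⟩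
  rcases h3 with h3 | ⟨x, h3⟩
  · rw [h3]
    exact wle_of_lt (end_lt.2 hp)
  · rw [h3]
    exact wle_of_lt ((diff_lt (by simp)).2 hp)

theorem reach_of_le {s t j : ℕ} (hα : Max α) (hs : InS α s) (ht : InS α t) (hst : s ≤ t)
    (hj : Reach α t j) : Reach α s (t - s + j) := by
  induction hk : t - s using Nat.strong_induction_on generalizing s with
  | _ k ih =>
  subst hk
  rcases hst.eq_or_lt with rfl | hlt
  · simpa using hj
  · have h1 := hs.add_hop_le hα ht hlt
    have h2 : s + hop α s ≤ α.length := h1.trans ht.le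
    have h3 : 0 < hop α s := Nat.succ_pos _
    have := ih (t - (s + hop α s)) (by omega) (hs.add_hop hα h2) h1 rfl
    have := reach_next hα hs.pos h2 this
    rwa [show hop α s + (t - (s + hop α s) + j) = t - s + j by omega] at this

theorem exists_pred {g t : ℕ} (hα : Max α) (hg : InS α g) (ht : InS α t) (hgt : g < t) :
    ∃ s, InS α s ∧ g ≤ s ∧ s + hop α s = t := by
  induction hk : t - g using Nat.strong_induction_on generalizing g with
  | _ k ih =>
  subst hk
  have h1 := hg.add_hop_le hα ht hgt
  rcases h1.eq_or_lt with h1 | h1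
  · exact ⟨g, hg, le_rfl, h1⟩
  · have h2 : g + hop α g ≤ α.length := h1.le.trans ht.le
    have h3 : 0 < hop α g := Nat.succ_pos _
    obtain ⟨s, hs, hgs, h⟩ := ih _ (by omega) (hg.add_hop hα h2) h1 rfl
    exact ⟨s, hs, by omega, h⟩

theorem exists_last {g : ℕ} (hα : Max α) (hg : InS α g) :
    ∃ s, InS α s ∧ g ≤ s ∧ s + hop α s = α.length + 1 := by
  induction hk : α.length - g using Nat.strong_induction_on generalizing g with
  | _ k ih =>
  subst hk
  have h1 := Word.add_hop_le hα hg.pos hg.le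
  rcases h1.eq_or_lt with h1 | h1
  · exact ⟨g, hg, le_rfl, h1⟩
  · have h3 : 0 < hop α g := Nat.succ_pos _
    obtain ⟨s, hs, hgs, h⟩ := ih _ (by omega) (hg.add_hop hα (by omega)) rfl
    exact ⟨s, hs, by omega, h⟩

theorem dvd_of_hop_ge {g t : ℕ} (hα : Max α) (hg : InS α g) (ht : InS α t) (hgt : g ≤ t)
    (hge : ∀ s, InS α s → g ≤ s → s < t → g ≤ hop α s) : g ∣ t := by
  induction t using Nat.strong_induction_on with
  | _ t ih =>
  rcases hgt.eq_or_lt with rfl | hlt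
  · exact dvd_rfl
  · obtain ⟨s, hs, hgs, rfl⟩ := exists_pred hα hg ht hlt
    have h3 : 0 < hop α s := Nat.succ_pos _
    have h4 := hs.hop_le hα
    have h5 := hs.pos
    refine dvd_add (ih s (by omega) hs hgs fun x hx h1 h2 => hge x hx h1 (by omega))
      (ih _ (by omega) (inS_hop hα hs.pos hs.le) (hge s hs hgs (by omega))
        fun x hx h1 h2 => hge x hx h1 (by omega))

/-- Descent to a chain position `g` below which no later hop falls. -/
theorem exists_base {s R : ℕ} (hα : Max α) (hs : InS α s) (hR : InS α R) (hsR : s ≤ R) :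
    ∃ g, InS α g ∧ g ≤ s ∧ (∀ t, InS α t → g ≤ t → t < R → g ≤ hop α t) ∧
      ∃ T, T + g ≤ R ∧ g ∣ T ∧ ∀ j, T + j ≤ α.length → Reach α g j → Reach α s (T + j) := by
  induction s using Nat.strong_induction_on generalizing R with
  | _ s ih =>
  by_cases hall : ∀ t, InS α t → s ≤ t → t < R → s ≤ hop α t
  · exact ⟨s, hs, le_rfl, hall, 0, by omega, dvd_zero _, fun j _ h => by simpa using h⟩
  · push Not at hall
    have hex : ∃ h t, InS α t ∧ s ≤ t ∧ t < R ∧ hop α t < s ∧ hop α t = h := by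
      obtain ⟨t, h⟩ := hall
      exact ⟨_, t, h.1, h.2.1, h.2.2.1, h.2.2.2, rfl⟩
    classical
    obtain ⟨t, ht, hst, htR, hts, hth⟩ := Nat.find_spec hex
    have hmin := fun m => Nat.find_min hex (m := m)
    rw [← hth] at hmin
    clear hth hex
    have hs' := inS_hop hα ht.pos ht.le
    have htR' := ht.add_hop_le hα hR htR
    have htS := ht.add_hop hα (htR'.trans hR.le)
    obtain ⟨g, hg, hgs, hge, T, hT, hgT, hreach⟩ := ih _ hts hs' hs hts.le
    have hge' : ∀ x, InS α x → g ≤ x → x < R → g ≤ hop α x := by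
      intro x hx hgx hxR
      rcases lt_or_ge x s with hxs | hxs
      · exact hge x hx hgx hxs
      · by_contra! hlt
        exact hmin (hop α x) (by omega) ⟨x, hx, hxs, hxR, by omega, rfl⟩
    refine ⟨g, hg, by omega, hge', t + hop α t - s + T, by omega, ?_, ?_⟩
    · refine dvd_add (Nat.dvd_sub ?_ ?_) hgT
      · exact dvd_of_hop_ge hα hg htS (by omega) fun x hx h1 h2 => hge' x hx h1 (by omega)
      · exact dvd_of_hop_ge hα hg hs (by omega) fun x hx h1 h2 => hge' x hx h1 (by omega)
    · intro j hj hgj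
      have h1 := hreach j (by omega) hgj
      have h2 := reach_double hα ht.pos ht.le h1 (by omega)
      have h3 := reach_of_le hα hs ht hst h2
      rwa [show t - s + (hop α t + (T + j)) = t + hop α t - s + T + j by omega] at h3

/-- Concatenation of the blocks `G c`, for `c` in `cs`. -/
def blocks (G : List Bool) (cs : List Bool) : List Bool := cs.flatMap fun c => G ++ [c]

@[simp] theorem blocks_nil {G} : blocks G [] = [] := rfl

theorem blocks_cons {G c cs} : blocks G (c :: cs) = G ++ c :: blocks G cs := by
  simp [blocks]

theorem blocks_append {G cs ds} : blocks G (cs ++ ds) = blocks G cs ++ blocks G ds := by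
  simp [blocks]

theorem blocks_concat {G cs c} : blocks G (cs ++ [c]) = blocks G cs ++ (G ++ [c]) := by
  simp [blocks]

theorem length_blocks (G cs) : (blocks G cs).length = (G.length + 1) * cs.length := by
  induction cs with
  | nil => simp
  | cons c cs ih => simp [blocks_cons, ih]; ring

theorem take_blocks (G cs : List Bool) (i : ℕ) :
    (blocks G cs).take ((G.length + 1) * i) = blocks G (cs.take i) := by
  induction cs generalizing i with
  | nil => simp
  | cons c cs ih =>
    cases i with
    | zero => simp
    | succ i =>
      rw [List.take_succ_cons, blocks_cons, blocks_cons, cons_eq, cons_eq (x := blocks G _), ← ih,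
        show (G.length + 1) * (i + 1) = (G ++ [c]).length + (G.length + 1) * i by simp; ring,
        List.take_length_add_append]

theorem par_blocks {G cs : List Bool} (h : ∀ c ∈ cs, par (G ++ [c]) = false) :
    par (blocks G cs) = false := by
  induction cs with
  | nil => rfl
  | cons c cs ih =>
    have h1 := h c (by simp)
    rw [blocks_cons, cons_eq, par_append, h1, ih fun d hd => h d (by simp [hd])]
    rfl

theorem take_eq_blocks {G r : List Bool} {b : Bool} {t : ℕ} (hα : Max α) (hG : Max G)
    (h : α = G ++ b :: r) (hb : par (G ++ [b]) = true) (ht : InS α t) (hgt : G.length + 1 ≤ t)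
    (hge : ∀ s, InS α s → G.length + 1 ≤ s → s < t → G.length + 1 ≤ hop α s) :
    ∃ cs, α.take t = blocks G (b :: cs) := by
  have hg : InS α (G.length + 1) := ⟨G, b, r, h, rfl, hG, hb⟩
  induction t using Nat.strong_induction_on with
  | _ t ih =>
  rcases hgt.eq_or_lt with rfl | hlt
  · refine ⟨[], ?_⟩
    rw [h, cons_eq, List.take_left' (by simp)]
    simp [blocks]
  · obtain ⟨s, hs, hgs, rfl⟩ := exists_pred hα hg ht hlt
    have h3 : 0 < hop α s := Nat.succ_pos _
    have h4 := hs.hop_le hα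
    have h5 := hs.pos
    obtain ⟨cs, hcs⟩ := ih s (by omega) hs hgs fun x hx h1 h2 => hge x hx h1 (by omega)
    obtain ⟨ds, hds⟩ := ih _ (by omega) (inS_hop hα hs.pos hs.le) (hge s hs hgs (by omega))
        fun x hx h1 h2 => hge x hx h1 (by omega)
    obtain ⟨A, e, r', h6, h7, hp, hA, h8⟩ := hop_spec hα hs.pos hs.le
    have h8 : ∃ x, α.drop s = A ++ (!e) :: x := by
      refine h8.resolve_left fun h8 => ?_
      have h9 := congrArg List.length h8
      have := ht.le
      simp at h9
      omega
    obtain ⟨x, h8⟩ := h8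
    obtain ⟨l, d, hl⟩ : ∃ l d, b :: ds = l ++ [d] :=
      ⟨_, _, (List.dropLast_append_getLast (List.cons_ne_nil b ds)).symm⟩
    have hA' : A = blocks G l ++ G := by
      rw [hl, blocks_concat, ← h6] at hds
      rw [h7, cons_eq, List.take_left' (by simp), ← List.append_assoc] at hds
      exact List.append_inj_left' hds rfl
    refine ⟨cs ++ (l ++ [!e]), ?_⟩
    rw [List.take_add, hcs, h8, ← h6, cons_eq (x := x), List.take_left' (by simp), hA',
      ← List.cons_append, blocks_append, blocks_concat]
    simp

theorem blocks_replicate_lt {G τ ρ : List Bool} {a : Bool} (hp : par (G ++ [a]) = false)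
    (hτ : ∀ x, τ <ʷ G ++ x) (cs : List Bool) {j : ℕ} (hj : j < cs.length) :
    blocks G (List.replicate j a) ++ τ <ʷ blocks G cs ++ ρ := by
  induction j generalizing cs with
  | zero =>
    rcases cs with _ | ⟨c, cs⟩
    · simp at hj
    · rw [blocks_cons, List.append_assoc]
      exact hτ _
  | succ j ih =>
    rcases cs with _ | ⟨c, cs⟩
    · simp at hj
    · rw [List.replicate_succ, blocks_cons, blocks_cons, List.append_assoc, List.append_assoc,
        List.cons_append, List.cons_append]
      by_cases hac : a = c
      · subst hac
        rw [cons_eq, cons_eq (x := blocks G cs ++ ρ), append_lt_even hp]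
        exact ih cs (by simpa using hj)
      · rw [diff_lt hac]
        obtain rfl : c = !a := by cases a <;> cases c <;> simp_all
        rw [par_not, hp]; rfl

theorem last_split {b : Bool} {cs : List Bool} (h : b ∈ cs) :
    ∃ l j, cs = l ++ b :: List.replicate j (!b) := by
  induction cs with
  | nil => simp at h
  | cons c cs ih =>
    by_cases hb : b ∈ cs
    · obtain ⟨l, j, rfl⟩ := ih hb
      exact ⟨c :: l, j, rfl⟩
    · obtain rfl : b = c := by simpa [hb] using h
      refine ⟨[], cs.length, ?_⟩
      rw [List.nil_append, List.cons.injEq]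
      refine ⟨rfl, List.eq_replicate_iff.2 ⟨rfl, fun d hd => ?_⟩⟩
      have : d ≠ b := fun h => hb (h ▸ hd)
      revert this
      cases d <;> cases b <;> simp

/-- An odd block in the block decomposition of `α` prevents the rest from being too small. -/
theorem odd_block_absurd {G τ cs : List Bool} {b : Bool} (hα : Max α)
    (h : α = G ++ b :: (blocks G cs ++ τ)) (hb : par (G ++ [b]) = true) (hcs : b ∈ cs)
    (hτ : ∀ x, τ <ʷ G ++ x) : False := by
  obtain ⟨l, j, hl⟩ := last_split hcs
  have h1 : G ++ b :: (blocks G (List.replicate j (!b)) ++ τ) <ʷ α := by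
    refine hα (G ++ b :: blocks G l) _ ?_ (by simp)
    rw [h, hl, blocks_append, blocks_cons]
    simp
  rw [h, cons_eq, cons_eq (x := blocks G cs ++ τ), append_lt_odd hb] at h1
  refine wlt_asymm h1 (blocks_replicate_lt (by rw [par_not, hb]; rfl) hτ cs ?_)
  simp [hl]
  omega

theorem hop_ge {G r₀ : List Bool} {b : Bool} {r q : ℕ} (hα : Max α) (hG : Max G)
    (h : α = G ++ b :: r₀) (hb : par (G ++ [b]) = true) (hr : InS α r)
    (hge : ∀ s, InS α s → G.length + 1 ≤ s → s ≤ r → G.length + 1 ≤ hop α s)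
    (hq : q ≤ r + hop α r) (hgq : G.length + 1 ≤ q) (hdvd : G.length + 1 ∣ q)
    (hpar : par (α.take q) = false) (t : ℕ) (ht : InS α t) (hgt : G.length + 1 ≤ t) :
    G.length + 1 ≤ hop α t := by
  induction t using Nat.strong_induction_on with
  | _ t ih =>
  rcases le_or_gt t r with htr | htr
  · exact hge t ht hgt htr
  · have hqt := hq.trans (hr.add_hop_le hα ht htr)
    obtain ⟨cs, hcs⟩ := take_eq_blocks hα hG h hb ht hgt fun s hs h1 h2 => ih s h2 hs h1
    have hbcs : b ∈ cs := by
      by_contra hbcs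
      obtain ⟨i, rfl⟩ := hdvd
      have h1 : α.take ((G.length + 1) * i) = blocks G ((b :: cs).take i) := by
        rw [← take_blocks, ← hcs, List.take_take, min_eq_left hqt]
      rw [h1] at hpar
      rcases i with _ | i
      · simp at hgq
      · rw [List.take_succ_cons, blocks_cons, cons_eq, par_append, hb, par_blocks] at hpar
        · simp at hpar
        · intro c hc
          have hcb : c ≠ b := fun h => hbcs (h ▸ List.mem_of_mem_take hc)
          obtain rfl : c = !b := by
            revert hcb
            cases c <;> cases b <;> simp
          rw [par_not, hb]; rfl
    by_contra! hlt
    obtain ⟨A, e, r', h6, h7, hp, hA, h8⟩ := hop_spec hα ht.pos ht.le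
    obtain ⟨x, hx⟩ : ∃ x, G = A ++ e :: x := prefix_split (h.symm.trans h7) (by omega)
    refine odd_block_absurd (τ := α.drop t) hα ?_ hb hbcs fun w => ?_
    · rw [← List.cons_append, ← List.append_assoc, ← blocks_cons, ← hcs, List.take_append_drop]
    · rw [hx, List.append_assoc, List.cons_append]
      rcases h8 with h8 | ⟨x', h8⟩
      · rw [h8, end_lt, hp]
      · rw [h8, diff_lt (by simp), hp]

theorem dvd_length {g : ℕ} (hα : Max α) (hg : InS α g)
    (hge : ∀ s, InS α s → g ≤ s → g ≤ hop α s) : g ∣ α.length + 1 := by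
  obtain ⟨s, hs, hgs, h⟩ := exists_last hα hg
  rw [← h]
  have := hs.hop_le hα
  exact dvd_add (dvd_of_hop_ge hα hg hs hgs fun x hx h1 _ => hge x hx h1)
    (dvd_of_hop_ge hα hg (inS_hop hα hs.pos hs.le) (hge s hs hgs) fun x hx h1 _ => hge x hx h1)

/-- The chain step `X` closing the word `u` before an even boundary: the position `r` is the last
chain position of `u`. -/
theorem exists_closing {u : List Bool} {a : Bool} {p : ℕ} (hu : Max u)
    (hpar : par (u ++ [a]) = false) (hp : InS u p) :
    ∃ r X x, InS u r ∧ p ≤ r ∧ r + (X.length + 1) = u.length + 1 ∧ u = u.take r ++ X ∧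
      Max X ∧ par (X ++ [a]) = true ∧ u = X ++ a :: x := by
  obtain ⟨r, hr, hpr, h⟩ := exists_last hu hp
  obtain ⟨X, e, x, h1, h2, h3, h4, h5⟩ := hop_spec hu hr.pos hr.le
  have h5 : u.drop r = X := by
    refine h5.resolve_right fun ⟨x, h5⟩ => ?_
    have := congrArg List.length h5
    simp at this
    omega
  have hux : u = u.take r ++ X := by rw [← h5, List.take_append_drop]
  have hrp : par (u.take r) = true := by
    obtain ⟨G, b, y, h6, rfl, -, h7⟩ := hr
    rw [h6, cons_eq, List.take_left' (by simp), h7]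
  rw [hux, List.append_assoc, par_append, hrp] at hpar
  refine ⟨r, X, x, hr, hpr, by omega, hux, h4, by simpa using hpar, ?_⟩
  obtain rfl : e = a := by
    simp only [par_append, par_cons, par_nil] at hpar h3
    revert hpar h3
    cases par X <;> cases a <;> cases e <;> simp
  exact h2

theorem InS.append {u w : List Bool} {s : ℕ} (h : InS u s) : InS (u ++ w) s := by
  obtain ⟨G, b, r, rfl, h1, h2, h3⟩ := h
  exact ⟨G, b, r ++ w, by simp, h1, h2, h3⟩

theorem reach_multiple {g : ℕ} (hα : Max α) (hg : InS α g) (hgg : hop α g = g) (i : ℕ)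
    (hi : g * (i + 1) ≤ α.length) : Reach α g (g * (i + 1)) := by
  induction i with
  | zero => simpa [hgg] using reach_hop hα hg.pos hg.le
  | succ i ih =>
    have h1 : g * (i + 1 + 1) = g + g * (i + 1) := by ring
    rw [h1] at hi ⊢
    have := reach_double hα hg.pos hg.le (j := g * (i + 1))
      (by rw [hgg]; exact ih (by omega)) (by rw [hgg]; exact hi)
    rwa [hgg] at this

/-- Solutions of `N O = O N` compatible with the chain of `α`. -/
theorem eq_of_commute {X G G₂ r : List Bool} {a : Bool} (hα : Max α)
    (hG : InS α (G.length + 1)) (hX : InS α (X.length + 1)) (hαG : α = G ++ r)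
    (h₁ : G = X ++ a :: G₂) (h₂ : G = G₂ ++ a :: X) : G₂ = X := by
  have hω := hX.hop_le hα
  have hαX : α = X ++ a :: (G₂ ++ r) := by rw [hαG, h₁]; simp
  have hαG₂ : α = G₂ ++ a :: (X ++ r) := by rw [hαG, h₂]; simp
  have hcomm : (X ++ [a]) ++ (G₂ ++ [a]) = (G₂ ++ [a]) ++ (X ++ [a]) := by
    have := h₁.symm.trans h₂
    simpa using congrArg (· ++ [a]) this
  rcases List.append_eq_append_iff.1 hcomm with ⟨O, hO, hO'⟩ | ⟨N, hN, hN'⟩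
  · rcases O with _ | ⟨o, O⟩
    · rw [List.append_nil] at hO
      exact List.append_inj_left' hO rfl
    · exfalso
      obtain ⟨O₁, hO₁⟩ : ∃ O₁, G₂ = (X ++ [a]) ++ O₁ := by
        obtain ⟨l, d, hl⟩ : ∃ l d, o :: O = l ++ [d] :=
          ⟨_, _, (List.dropLast_append_getLast (List.cons_ne_nil o O)).symm⟩
        rw [hl, ← List.append_assoc] at hO
        exact ⟨l, List.append_inj_left' hO rfl⟩
      have := hop_gt (s := X.length + 1) (A := X ++ [a]) (x := O₁ ++ r) (y := G₂ ++ r)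
        (by rw [drop_of_eq hαX, hO₁]; simp) (by rw [← cons_eq]; exact hαX)
      simp at this
      omega
  · rcases N with _ | ⟨o, N⟩
    · rw [List.append_nil] at hN
      exact (List.append_inj_left' hN rfl).symm
    · exfalso
      have hlen := congrArg List.length hN
      have hlen' := congrArg List.length h₁
      simp at hlen hlen'
      have h3 := hX.add_hop_le hα hG (by omega)
      have h4 := hop_gt (s := X.length + 1) (A := G₂) (drop_of_eq hαX) hαG₂
      have h5 : hop α (X.length + 1) = G₂.length + 1 := by omega
      have h6 := inS_hop hα hX.pos hX.le
      rw [h5] at h6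
      have h7 := h6.add_hop_le hα hX (by omega)
      have hα₁ : α = G₂ ++ a :: (o :: N ++ (G₂ ++ r)) := by
        rw [hαX, cons_eq, hN]
        simp
      have hα₂ : α = o :: N ++ ((G₂ ++ [a]) ++ (G₂ ++ r)) := by
        rw [hαX, cons_eq, hN']
        simp
      have h8 := hop_gt (A := o :: N) (drop_of_eq hα₁) hα₂
      simp at h8
      omega

/-- The case where the closing part `X` is shorter than the base `G`. -/
theorem exists_adm_of_short {u v P z X x G G₀ t : List Bool} {a b : Bool} {r : ℕ}
    (hα : Max (u ++ a :: v)) (hu : Max u) (hpar : par (u ++ [a]) = false)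
    (hu₁ : u = t ++ P) (hu₂ : u = P ++ (!a) :: z) (hPS : InS u (P.length + 1))
    (hr : InS u r) (hPr : P.length + 1 ≤ r) (hrX : r + (X.length + 1) = u.length + 1)
    (huX : u = u.take r ++ X) (hX : Max X) (hXp : par (X ++ [a]) = true) (hXu : u = X ++ a :: x)
    (hG : Max G) (hαG : u ++ a :: v = G ++ b :: G₀) (hGb : par (G ++ [b]) = true)
    (hGP : G.length ≤ P.length)
    (hge : ∀ s, InS (u ++ a :: v) s → G.length + 1 ≤ s → s < r →
      G.length + 1 ≤ hop (u ++ a :: v) s)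
    (hlt : X.length < G.length) (huv : u.length ≤ v.length) :
    ∃ y, Adm (u ++ a :: v) y ∧ y.length = v.length ∧ z ++ (!a) :: v <ʷ y := by
  have hgS : InS (u ++ a :: v) (G.length + 1) := ⟨G, b, G₀, hαG, rfl, hG, hGb⟩
  have hrS : InS (u ++ a :: v) r := hr.append
  have hXS : InS (u ++ a :: v) (X.length + 1) := ⟨X, a, x ++ a :: v, by rw [hXu]; simp, rfl, hX, hXp⟩
  have htake : (u ++ a :: v).take r = u.take r := List.take_append_of_le_length hr.le
  obtain ⟨cs, hcs⟩ := take_eq_blocks hα hG hαG hGb hrS (by omega) hge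
  rw [htake] at hcs
  -- the last block
  obtain ⟨l, c, hl⟩ : ∃ l c, b :: cs = l ++ [c] :=
    ⟨_, _, (List.dropLast_append_getLast (List.cons_ne_nil b cs)).symm⟩
  -- the prefix of length `|P| + 1` is a union of blocks
  obtain ⟨i, hi⟩ := dvd_of_hop_ge hα hgS hPS.append (by omega)
    fun s hs h1 h2 => hge s hs h1 (by omega)
  have hP : P ++ [!a] = blocks G ((b :: cs).take i) := by
    rw [← take_blocks, ← hcs, ← hi, List.take_take, min_eq_left hPr]
    have h : (P ++ (!a) :: z).take (P.length + 1) = P ++ [!a] := by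
      rw [cons_eq, List.take_left' (by simp)]
    rw [← hu₂] at h
    exact h.symm
  have hi0 : i ≠ 0 := by
    rintro rfl
    simp at hi
  obtain ⟨i, rfl⟩ := Nat.exists_eq_succ_of_ne_zero hi0
  obtain ⟨l', d, hl'⟩ : ∃ l' d, (b :: cs).take (i + 1) = l' ++ [d] :=
    ⟨_, _, (List.dropLast_append_getLast (by simp)).symm⟩
  rw [hl', blocks_concat, ← List.append_assoc] at hP
  replace ⟨hP, hd⟩ := List.append_inj' hP rfl
  have hd : (!a) = d := by simpa using hd
  -- comparing the two occurrences of `G` at the end of `u`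
  have hub : u = blocks G (b :: cs) ++ X := by rw [← hcs]; exact huX
  have huG : u = (t ++ blocks G l') ++ G := by rw [List.append_assoc, ← hP]; exact hu₁
  have huc : u = blocks G l ++ (G ++ c :: X) := by rw [hub, hl, blocks_concat]; simp
  obtain ⟨Y, hY⟩ : G <:+ G ++ c :: X :=
    List.suffix_of_suffix_length_le ⟨_, huG.symm⟩ ⟨_, huc.symm⟩ (by simp)
  have hGα : X ++ (a :: (x ++ a :: v)) = G ++ b :: G₀ := by rw [← hαG, hXu]; simp
  obtain ⟨G₂, hG₂⟩ := prefix_split (hGα.symm.trans rfl) hlt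
  have hYX : X ++ [a] = Y ∧ G₂ ++ c :: X = G := by
    have h := hY
    nth_rw 2 [hG₂] at h
    rw [List.append_assoc, List.cons_append, cons_eq] at h
    have hl := congrArg List.length hY
    exact List.append_inj h.symm (by simp at hl ⊢; omega)
  obtain rfl : c = a := by
    have h := congrArg par (hG₂.symm.trans hYX.2.symm)
    simp only [par_append, par_cons] at h
    revert h
    cases par X <;> cases par G₂ <;> cases a <;> cases c <;> simp
  obtain rfl : G₂ = X := eq_of_commute hα hgS hXS hαG hG₂ hYX.2.symm
  have hGc : par (G ++ [c]) = false := by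
    rw [hG₂, List.append_assoc, List.cons_append, cons_eq, par_append, hXp]; rfl
  obtain rfl : b = !c := by
    revert hGb hGc
    simp only [par_append]
    cases par G <;> cases b <;> cases c <;> simp
  have hu₃ : u = G ++ (!c) :: (blocks G cs ++ G₂) := by rw [hub, blocks_cons]; simp
  have hcs' : cs = List.replicate cs.length c := by
    refine List.eq_replicate_of_mem fun e he => ?_
    by_contra hne
    obtain rfl : e = !c := by revert hne; cases e <;> cases c <;> simp
    refine odd_block_absurd hu hu₃ hGb he fun x => ?_
    rw [hG₂, List.append_assoc, List.cons_append]
    exact end_lt.2 hXp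
  set j := cs.length with hj
  -- hence `P = G`
  obtain rfl : l' = [] := by
    rcases l' with _ | ⟨e, l'⟩
    · rfl
    · have h : d ∈ cs.take i := by
        rw [List.take_succ_cons, List.cons_append] at hl'
        rw [(List.cons.inj hl').2]; simp
      have h := List.mem_of_mem_take h
      rw [hcs'] at h
      rw [List.eq_of_mem_replicate h] at hd
      cases c <;> simp at hd
  rw [blocks_nil, List.nil_append] at hP
  have hz : z = blocks G cs ++ G₂ := by
    have := hu₂.symm.trans hu₃
    rw [hP] at this
    simpa using this
  have hbl : ∀ k, blocks G (List.replicate k c) = blocks G₂ (List.replicate (2 * k) c) := by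
    intro k
    induction k with
    | zero => rfl
    | succ k ih =>
      rw [List.replicate_succ, blocks_cons, ih, hG₂, Nat.mul_succ, List.replicate_succ,
        List.replicate_succ, blocks_cons, blocks_cons]
      simp
  -- the hops of `α` are at least `|X| + 1`
  have hGl : G.length + 1 = (G₂.length + 1) * 2 := by rw [hG₂]; simp; omega
  have hrl : r = (G.length + 1) * (j + 1) := by
    have := congrArg List.length hcs
    rw [length_blocks, List.length_take, min_eq_left hr.le] at this
    simpa using this
  have hdr : (u ++ c :: v).drop r = (G₂ ++ [c]) ++ v := by
    rw [List.drop_append_of_le_length hr.le]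
    have : u.drop r = G₂ := by
      have h : u.take r ++ u.drop r = u.take r ++ G₂ := by rw [List.take_append_drop]; exact huX
      exact List.append_cancel_left h
    rw [this]; simp
  have hω := hop_gt hdr (y := x ++ c :: v) (by rw [hXu]; simp)
  have hαX : u ++ c :: v = G₂ ++ c :: (G₂ ++ ((!c) :: G₀)) := by rw [hαG, hG₂]; simp
  have hω' := hop_gt (drop_of_eq hαX) hαX
  have hge' := hop_ge (q := r + (G₂.length + 1)) hα hX (by rw [hXu]; simp; rfl) hXp hrS
    (by
      intro s hs h1 h2
      rcases h1.eq_or_lt with rfl | h1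
      · exact hω'
      have h3 := hXS.add_hop_le hα hs h1
      rcases h2.eq_or_lt with rfl | h2
      · simp at hω; omega
      · have := hge s hs (by omega) h2
        omega)
    (by simp at hω; omega) (by omega)
    ⟨2 * (j + 1) + 1, by rw [hrl, hGl]; ring⟩
    (by rw [hrX, cons_eq, List.take_left' (by simp), hpar])
  have hdv := dvd_length hα hXS fun s hs h => hge' s hs h
  have hul : u.length + 1 = (G₂.length + 1) * (2 * j + 3) := by rw [← hrX, hrl, hGl]; ring
  obtain ⟨K, hK⟩ : G₂.length + 1 ∣ v.length + 1 := by
    refine (Nat.dvd_add_right (Dvd.intro _ hul.symm)).1 ?_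
    convert hdv using 1
    simp; omega
  have hKj : 2 * j + 3 ≤ K := by
    refine Nat.le_of_mul_le_mul_left (c := G₂.length + 1) ?_ (by omega)
    omega
  have hy : ∀ k < K, Adm (u ++ c :: v) (blocks G₂ (List.replicate k c) ++ G₂) := by
    intro k hk
    induction k with
    | zero => exact adm_prefix hX hαX hXp
    | succ k ih =>
      have := adm_double hα hX hαX hXp (ih (by omega)) ?_ ?_
      · rw [List.replicate_succ, blocks_cons]
        simpa using this
      · apply wle_of_lt
        rcases k with _ | k
        · exact lt_end.2 (by rw [par_not, hXp]; rfl)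
        · rw [List.replicate_succ, blocks_cons, List.append_assoc, List.cons_append]
          exact (diff_lt (by cases c <;> simp)).2 hXp
      · intro h
        have h1 := congrArg List.length hαX
        simp only [List.length_append, List.length_cons, length_blocks, List.length_replicate]
          at h h1
        have h2 : (G₂.length + 1) * (k + 1) = (G₂.length + 1) * (2 * j + 2 + K) := by
          have h3 : (G₂.length + 1) * (2 * j + 3) = (G₂.length + 1) * (2 * j + 2)
            + (G₂.length + 1) := by ring
          rw [mul_add _ (2 * j + 2), mul_add _ k]
          omega
        have := Nat.eq_of_mul_eq_mul_left (by omega) h2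
        omega
  refine ⟨_, hy (K - 1) (by omega), ?_, ?_⟩
  · rw [List.length_append, length_blocks, List.length_replicate]
    obtain ⟨K, rfl⟩ := Nat.exists_eq_add_of_le' (show 1 ≤ K by omega)
    rw [Nat.mul_succ] at hK
    simp at hK ⊢
    omega
  · rw [show K - 1 = 2 * j + 1 + (K - 2 - 2 * j) by omega, List.replicate_add,
      List.replicate_succ', List.append_assoc, blocks_append, ← hbl, hz, ← hcs',
      List.append_assoc, List.append_assoc, List.singleton_append, blocks_cons]
    refine (append_lt_even (par_blocks fun e he => ?_)).2 ?_
    · rw [hcs'] at he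
      rw [List.eq_of_mem_replicate he, hGc]
    · rw [List.append_assoc, List.cons_append]
      exact (diff_lt (by cases c <;> simp)).2 hXp

theorem exists_adm_of_length_le {u v P z t : List Bool} {a : Bool}
    (hα : Max (u ++ a :: v)) (hu : Max u) (hpar : par (u ++ [a]) = false)
    (ht : t ≠ []) (hu₁ : u = t ++ P) (hu₂ : u = P ++ (!a) :: z) (hP : par (P ++ [!a]) = true)
    (hv : v ≤ʷ z ++ (!a) :: v) (huv : u.length ≤ v.length) :
    ∃ y, Adm (u ++ a :: v) y ∧ y.length = v.length ∧ v <ʷ y := by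
  have hPM : Max P := by
    refine max_of_two (r₁ := a :: v) (r₂ := (!a) :: (z ++ a :: v)) (x₁ := (!a) :: (z ++ a :: v))
      (x₂ := (!a) :: (z ++ a :: v)) (by cases a <;> simp) ?_ ?_
    · intro t' s h h'
      have := hα (t ++ t') (s ++ a :: v) (by rw [hu₁, h]; simp) (by simp [ht])
      conv at this => rhs; rw [hu₂]
      simpa using this
    · intro t' s h h'
      have := hα t' (s ++ (!a) :: (z ++ a :: v)) (by rw [hu₂, h]; simp) h'
      rw [hu₂] at this
      simpa using this
  have hPS : InS u (P.length + 1) := ⟨P, !a, z, hu₂, rfl, hPM, hP⟩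
  obtain ⟨r, X, x, hr, hPr, hrX, huX, hX, hXp, hXu⟩ := exists_closing hu hpar hPS
  have hrS : InS (u ++ a :: v) r := hr.append
  have hpS : InS (u ++ a :: v) (P.length + 1) := hPS.append
  suffices ∃ y, Adm (u ++ a :: v) y ∧ y.length = v.length ∧ z ++ (!a) :: v <ʷ y by
    obtain ⟨y, h1, h2, h3⟩ := this
    exact ⟨y, h1, h2, wlt_of_le_of_lt hv h3⟩
  obtain ⟨g, hg, hgp, hge, T, hTg, hgT, hT⟩ := exists_base hα hpS hrS hPr
  rcases Nat.lt_or_ge (X.length + 1) g with hlt | hle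
  · obtain ⟨G, b, G₀, hαG, rfl, hG, hGb⟩ := hg
    exact exists_adm_of_short hα hu hpar hu₁ hu₂ hPS hr hPr hrX huX hX hXp hXu hG hαG hGb
      (by omega) hge (by omega) huv
  · have hXS : InS (u ++ a :: v) (X.length + 1) :=
      ⟨X, a, x ++ a :: v, by rw [hXu]; simp, rfl, hX, hXp⟩
    have hdr : (u ++ a :: v).drop r = (X ++ [a]) ++ v := by
      rw [List.drop_append_of_le_length hr.le]
      have : u.drop r = X := by
        have h : u.take r ++ u.drop r = u.take r ++ X := by rw [List.take_append_drop]; exact huX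
        exact List.append_cancel_left h
      rw [this]; simp
    have hω := hop_gt hdr (y := x ++ a :: v) (by rw [hXu]; simp)
    have hωr := hrS.hop_le hα
    simp only [List.length_append, List.length_singleton] at hω
    have hgr := dvd_of_hop_ge hα hg hrS (by omega) hge
    have hgX := dvd_of_hop_ge hα hg hXS hle fun s hs h1 h2 => hge s hs h1 (by omega)
    have hgu : g ∣ u.length + 1 := hrX ▸ Nat.dvd_add hgr hgX
    have hge' : ∀ s, InS (u ++ a :: v) s → g ≤ s → g ≤ hop (u ++ a :: v) s := by
      obtain ⟨G, b, G₀, hαG, rfl, hG, hGb⟩ := id hg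
      refine fun s hs => hop_ge (q := u.length + 1) hα hG hαG hGb hrS (fun s hs h1 h2 => ?_)
        (by omega) (by omega) hgu (by rw [cons_eq, List.take_left' (by simp), hpar]) s hs
      rcases h2.eq_or_lt with rfl | h2
      · omega
      · exact hge s hs h1 h2
    have hgv : g ∣ v.length + 1 := by
      refine (Nat.dvd_add_right hgu).1 ?_
      convert dvd_length hα hg hge' using 1
      simp; omega
    obtain ⟨j, hj⟩ : ∃ j, v.length + 1 = T + g * (j + 1) := by
      obtain ⟨k, hk⟩ := (Nat.dvd_add_right hgT).1
        (show g ∣ T + (v.length + 1 - T) by rwa [Nat.add_sub_cancel' (by omega)])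
      rcases k with _ | j
      · rw [Nat.mul_zero] at hk
        omega
      · exact ⟨j, by omega⟩
    have hlen : (u ++ a :: v).length = u.length + (v.length + 1) := by simp
    have hR := hT (g * (j + 1)) (by omega) (reach_multiple hα hg
      (le_antisymm (hg.hop_le hα) (hge' g hg le_rfl)) j (by omega))
    rw [← hj] at hR
    obtain ⟨y, hy, hyl, hyd⟩ := hR
    have hαP : u ++ a :: v = P ++ (!a) :: (z ++ a :: v) := by
      conv => lhs; rw [hu₂]
      simp
    rw [drop_of_eq hαP] at hyd
    refine ⟨y, hy, by omega, wlt_of_lt_of_le ((diff_lt (by cases a <;> simp)).2 ?_) hyd⟩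
    rw [hu₂, List.append_assoc, List.cons_append, cons_eq, par_append, hP] at hpar
    simpa using hpar

theorem exists_adm_of_length_lt {u v w z t P : List Bool} {a : Bool}
    (hγ : Max (u ++ (!a) :: w)) (hpar : par (u ++ [a]) = false)
    (ht : t ≠ []) (hu₁ : u = t ++ P) (hu₂ : u = P ++ (!a) :: z) (hP : par (P ++ [!a]) = true)
    (hv : v ≤ʷ z ++ (!a) :: v) (hwv : w.length = v.length) (huv : v.length < u.length) :
    ∃ y, Adm (u ++ a :: v) y ∧ y.length = v.length ∧ v <ʷ y := by
  have hz : par (z ++ [!a]) = false := by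
    rw [hu₂, List.append_assoc, List.cons_append, cons_eq, par_append, hP] at hpar
    rw [par_not]
    simpa using hpar
  have hzb : ∀ N, par (blocks z (List.replicate N (!a))) = false := fun N =>
    par_blocks fun e he => by rw [List.eq_of_mem_replicate he, hz]
  have hsucc : ∀ N y, blocks z (List.replicate (N + 1) (!a)) ++ y =
      blocks z (List.replicate N (!a)) ++ (z ++ (!a) :: y) := by
    intro N y
    rw [List.replicate_succ', blocks_concat]
    simp
  have hv' : ∀ N, v ≤ʷ blocks z (List.replicate N (!a)) ++ v := by
    intro N
    induction N with
    | zero => exact wle_refl v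
    | succ N ih => exact wle_trans ih (by rw [hsucc]; exact (append_le_even (hzb N)).2 hv)
  have hw : z ++ (!a) :: w <ʷ w := by
    have := hγ t (P ++ (!a) :: w) (by rw [hu₁]; simp) ht
    conv at this => rhs; rw [hu₂]
    rw [List.append_assoc, List.cons_append, cons_eq, cons_eq (x := z ++ (!a) :: w)] at this
    exact (append_lt_odd hP).1 this
  have hw' : ∀ N, blocks z (List.replicate N (!a)) ++ w ≤ʷ w := by
    intro N
    induction N with
    | zero => exact wle_refl w
    | succ N ih => exact wle_trans (by rw [hsucc]; exact (append_le_even (hzb N)).2 (wle_of_lt hw)) ih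
  refine ⟨w, fun t' s hs => ?_, hwv, ?_⟩
  · by_contra h
    have hsγ : s <ʷ u ++ (!a) :: w := hγ (u ++ (!a) :: t') s (by rw [hs]; simp) (by simp)
    have hl := congrArg List.length hs
    rw [List.length_append] at hl
    rcases wle_iff.1 (not_wlt.1 h) with h | h
    · obtain ⟨x, rfl⟩ := sandwich h hsγ
      simp at hl
      omega
    · rw [← h] at hl
      simp at hl
      omega
  · by_contra h
    have h := wle_iff.1 (not_wlt.1 h)
    have h0 : ∀ x, (blocks z (List.replicate (v.length + 1) (!a)) ++ x).length > v.length := by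
      intro x
      rw [List.length_append, length_blocks, List.length_replicate]
      have := Nat.le_mul_of_pos_left (v.length + 1) (show 0 < z.length + 1 by omega)
      omega
    rcases wle_iff.1 (hw' (v.length + 1)) with h1 | h1
    · rcases wle_iff.1 (hv' (v.length + 1)) with h2 | h2
      · have h3 : w <ʷ _ := wlt_of_le_of_lt (wle_iff.2 h) h2
        obtain ⟨x, hx⟩ := sandwich h1 h3
        have := h0 x
        rw [← hx] at this
        omega
      · have := h0 v
        rw [← h2] at this
        omega
    · have := h0 w
      rw [h1] at this
      omega

/-- Every word `v` which may follow `u a` but not `u b` is smaller than an admissible word. -/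
theorem exists_adm {u v w z t P : List Bool} {a : Bool}
    (hα : Max (u ++ a :: v)) (hγ : Max (u ++ (!a) :: w)) (hpar : par (u ++ [a]) = false)
    (ht : t ≠ []) (hu₁ : u = t ++ P) (hu₂ : u = P ++ (!a) :: z) (hP : par (P ++ [!a]) = true)
    (hv : v ≤ʷ z ++ (!a) :: v) (hwv : w.length = v.length) :
    ∃ y, Adm (u ++ a :: v) y ∧ y.length = v.length ∧ v <ʷ y := by
  rcases Nat.lt_or_ge v.length u.length with h | h
  · exact exists_adm_of_length_lt hγ hpar ht hu₁ hu₂ hP hv hwv h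
  · exact exists_adm_of_length_le hα (max_of_max_of_max (by cases a <;> simp) hα hγ) hpar ht hu₁
      hu₂ hP hv h

/-- If no even boundary of `u a v` beyond `u a` can be flipped, no maximal word lies between
`u a v` and `u`. -/
theorem false_of_between {u v γ : List Bool} {a : Bool} (hα : Max (u ++ a :: v))
    (hpar : par (u ++ [a]) = false)
    (hmax : ∀ g d w, u ++ a :: v = g ++ d :: w → u.length < g.length → par (g ++ [d]) = false →
      w.head? ≠ some false → ¬ Max (g ++ (!d) :: w))
    (hγ : Max γ) (hl : γ.length = (u ++ a :: v).length) (h₁ : u ++ a :: v <ʷ γ) (h₂ : γ <ʷ u) :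
    False := by
  obtain ⟨_ | ⟨c, w⟩, rfl⟩ := sandwich h₁ (x' := []) (by simpa using h₂)
  · simp at hl
  obtain rfl : c = a := by
    have h := lt_end.1 h₂
    revert h hpar
    simp only [par_append]
    cases par u <;> cases c <;> cases a <;> simp
  have h₃ : v <ʷ w := by
    rw [cons_eq, cons_eq (x := w)] at h₁
    exact (append_lt_even hpar).1 h₁
  obtain ⟨q, d, x, y, rfl, rfl, -, hq⟩ := wlt_same_length h₃ (by simpa using hl.symm)
  rw [← List.cons_append, ← List.append_assoc] at hα hγ hmax
  set p := u ++ c :: q with hp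
  have hup : u.length < p.length := by simp [hp]
  have hpd : par (p ++ [d]) = false := by
    rw [show p ++ [d] = (u ++ [c]) ++ (q ++ [d]) by simp [hp], par_append, hpar, hq]; rfl
  have hpM : Max p := max_of_max_of_max (by cases d <;> simp) hα hγ
  have hxy : y.length = x.length := by simpa using hl
  have key : ∀ z, Adm (p ++ d :: x) z → z.length = x.length → x <ʷ z → False := by
    intro z h1 h2 h3
    obtain ⟨g, e, w, h4, h5, h6, h7, h8⟩ := exists_flip x p d z hα hpd hpM h1 h2.symm h3
    exact hmax g e w h4 (by omega) h6 h7 h8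
  by_cases hx : x.head? = some false
  · obtain ⟨x, rfl⟩ : ∃ x', x = false :: x' := by
      rcases x with _ | ⟨e, x⟩
      · simp at hx
      · exact ⟨x, by simpa using hx⟩
    exact key _ (hα.adm_replicate (by simp [hp]; omega) (x.length + 1)) (by simp) (wlt_replicate x)
  · obtain ⟨t, P, z, ht, h1, h2, h3, h4⟩ := exists_border_of_not_max hpM hα hpd
      (hmax p d x rfl hup hpd hx)
    obtain ⟨y, hy₁, hy₂, hy₃⟩ := exists_adm hα hγ hpd ht h1 h2 h3 h4 hxy
    exact key y hy₁ hy₂ hy₃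

/-- The star product of words, where `b` is the odd letter after `u`. -/
def star (u : List Bool) (b : Bool) (w : List Bool) : List Bool :=
  blocks u (w.map (· == b)) ++ u

variable {u : List Bool} {b : Bool}

theorem star_nil : star u b [] = u := rfl

theorem star_cons {c : Bool} {w : List Bool} :
    star u b (c :: w) = u ++ (c == b) :: star u b w := by
  rw [star, List.map_cons, blocks_cons]
  simp [star]

theorem star_append {w w' : List Bool} :
    star u b (w ++ w') = blocks u (w.map (· == b)) ++ star u b w' := by
  rw [star, List.map_append, blocks_append, List.append_assoc]; rfl

theorem exists_star (u : List Bool) (b : Bool) (w : List Bool) : ∃ x, star u b w = u ++ x := by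
  rcases w with _ | ⟨c, w⟩
  · exact ⟨[], by simp [star_nil]⟩
  · exact ⟨_, star_cons⟩

theorem length_star {w : List Bool} :
    (star u b w).length + 1 = (u.length + 1) * (w.length + 1) := by
  rw [star, List.length_append, length_blocks, List.length_map]; ring

theorem par_star_cons (hb : par (u ++ [b]) = true) (c : Bool) : par (u ++ [c == b]) = c := by
  revert hb
  simp only [par_append]
  cases par u <;> cases b <;> cases c <;> simp

theorem par_blocks_map (hb : par (u ++ [b]) = true) (w : List Bool) :
    par (blocks u (w.map (· == b))) = par w := by
  induction w with
  | nil => rfl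
  | cons c w ih => rw [List.map_cons, blocks_cons, cons_eq, par_append, par_star_cons hb, ih]; rfl

theorem star_lt_of_lt (hb : par (u ++ [b]) = true) {w w' : List Bool} (h : w <ʷ w') :
    star u b w <ʷ star u b w' := by
  have hcmp : ∀ p x y, (par p = true → star u b y <ʷ star u b x) →
      (par p = false → star u b x <ʷ star u b y) → star u b (p ++ x) <ʷ star u b (p ++ y) := by
    intro p x y h1 h2
    rw [star_append, star_append]
    rcases hp : par p with _ | _
    · exact (append_lt_even (by rw [par_blocks_map hb, hp])).2 (h2 hp)
    · exact (append_lt_odd (by rw [par_blocks_map hb, hp])).2 (h1 hp)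
  rcases wlt_cases h with ⟨c, y, rfl, h'⟩ | ⟨c, y, rfl, h'⟩ | ⟨p, c, d, x, y, hcd, rfl, rfl, h', -⟩
  · have := hcmp w [] (c :: y)
    rw [List.append_nil, star_nil, star_cons] at this
    refine this (fun hp => lt_end.2 ?_) fun hp => end_lt.2 ?_ <;>
    · rw [par_star_cons hb]
      simpa [hp] using h'
  · have := hcmp w' (c :: y) []
    rw [List.append_nil, star_nil, star_cons] at this
    refine this (fun hp => end_lt.2 ?_) fun hp => lt_end.2 ?_ <;>
    · rw [par_star_cons hb]
      simpa [hp] using h'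
  · refine hcmp p _ _ (fun hp => ?_) fun hp => ?_ <;> rw [star_cons, star_cons]
    · refine (diff_lt ?_).2 ?_
      · revert hcd; cases b <;> cases c <;> cases d <;> simp
      · rw [par_star_cons hb]
        revert hcd h'; simp only [par_append, hp]; cases c <;> cases d <;> simp
    · refine (diff_lt ?_).2 ?_
      · revert hcd; cases b <;> cases c <;> cases d <;> simp
      · rw [par_star_cons hb]
        simpa [hp] using h'

theorem star_lt (hb : par (u ++ [b]) = true) {w w' : List Bool} :
    star u b w <ʷ star u b w' ↔ w <ʷ w' := by
  refine ⟨fun h => ?_, star_lt_of_lt hb⟩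
  by_contra hn
  rcases wle_iff.1 (not_wlt.1 hn) with h' | rfl
  · exact wlt_asymm h (star_lt_of_lt hb h')
  · exact wlt_irrefl _ h

theorem replicate_false_lt (w : List Bool) :
    ∀ M, w.length < M → List.replicate M false <ʷ w := by
  induction w with
  | nil =>
    intro M hM
    obtain ⟨M, rfl⟩ := Nat.exists_eq_succ_of_ne_zero hM.ne'
    exact lt_end (p := []).2 rfl
  | cons c w ih =>
    intro M hM
    obtain ⟨M, rfl⟩ := Nat.exists_eq_succ_of_ne_zero (Nat.ne_zero_of_lt hM)
    rw [List.replicate_succ]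
    rcases c with _ | _
    · exact (append_lt_even (p := [false]) rfl).2 (ih M (by simpa using hM))
    · exact (diff_lt (p := []) (by simp)).2 rfl

theorem exists_eq_star (hb : par (u ++ [b]) = true) {lam : List Bool} (n : ℕ) :
    ∀ y : List Bool, y.length ≤ n → (∀ t s, y = t ++ s → s <ʷ star u b (true :: lam)) →
      (∃ M₀, ∀ M, M₀ ≤ M → star u b (List.replicate M false) <ʷ y) → ∃ w, y = star u b w := by
  induction n with
  | zero =>
    rintro y hy h1 ⟨M, h2⟩
    rw [List.length_eq_zero_iff.1 (Nat.le_zero.1 hy)] at h1 h2 ⊢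
    have h2 := h2 M le_rfl
    have h1 := h1 [] [] rfl
    obtain ⟨x, hx⟩ := exists_star u b (List.replicate M false)
    rw [hx] at h2
    rw [star_cons] at h1
    obtain ⟨z, hz⟩ := sandwich h2 h1
    exact ⟨[], by rw [star_nil]; exact (List.append_eq_nil_iff.1 hz.symm).1.symm⟩
  | succ n ih =>
    rintro y hy h1 ⟨M, h2⟩
    obtain ⟨x, hx⟩ := exists_star u b (List.replicate M false)
    have h3 := h1 [] y rfl
    rw [star_cons] at h3
    obtain ⟨_ | ⟨c, y⟩, rfl⟩ := sandwich (hx ▸ h2 M le_rfl) h3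
    · exact ⟨[], by simp [star_nil]⟩
    have hb' : (true == b) = b := by cases b <;> rfl
    have hc : ∃ M₀, ∀ M, M₀ ≤ M → star u b (List.replicate M false) <ʷ y := by
      by_cases hcb : c = b
      · rw [hcb, hb', cons_eq, cons_eq (x := star u b lam)] at h3
        have h4 := (append_lt_odd hb).1 h3
        exact ⟨lam.length + 1, fun M hM =>
          wlt_trans ((star_lt hb).2 (replicate_false_lt lam M hM)) h4⟩
      · refine ⟨M, fun N hN => ?_⟩
        have h4 := h2 (N + 1) (by omega)
        have hc : (false == b) = c := by revert hcb; cases b <;> cases c <;> simp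
        rw [List.replicate_succ, star_cons, hc, cons_eq, cons_eq (x := y)] at h4
        refine (append_lt_even ?_).1 h4
        rw [← hc, par_star_cons hb]
    obtain ⟨w, hw⟩ := ih y (by simp at hy; omega)
      (fun t s h => h1 (u ++ c :: t) s (by rw [h]; simp)) hc
    refine ⟨(c == b) :: w, ?_⟩
    rw [star_cons, ← hw]
    cases b <;> cases c <;> rfl

/-- The maximal words between `u` and a star product with `u` are star products with `u`. -/
theorem exists_eq_star_of_max (hb : par (u ++ [b]) = true) {lam γ : List Bool} (hγ : Max γ)
    (h₁ : u <ʷ γ) (h₂ : γ <ʷ star u b (true :: lam)) :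
    ∃ w, γ = star u b (true :: w) ∧ Max (true :: w) ∧ true :: w <ʷ true :: lam := by
  have hb' : (true == b) = b := by cases b <;> rfl
  have h₂' := h₂
  rw [star_cons] at h₂'
  obtain ⟨_ | ⟨c, y⟩, h⟩ := sandwich (u := u) (x := []) (by simpa using h₁) h₂'
  · rw [List.append_nil] at h
    exact absurd (h ▸ h₁) (wlt_irrefl u)
  obtain rfl : c = b := by
    have h1 := end_lt.1 (h ▸ h₁)
    revert h1 hb
    simp only [par_append]
    cases par u <;> cases c <;> cases b <;> simp
  obtain ⟨w, rfl⟩ := exists_eq_star hb γ.length γ le_rfl (lam := lam)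
    (fun t s hs => by
      rcases t with _ | ⟨e, t⟩
      · rwa [← show γ = s from hs]
      · exact wlt_trans (hγ _ _ hs (by simp)) h₂)
    ⟨1, fun M hM => by
      obtain ⟨M, rfl⟩ := Nat.exists_eq_succ_of_ne_zero (Nat.ne_zero_of_lt hM)
      rw [h, List.replicate_succ, star_cons]
      exact (diff_lt (by cases c <;> simp)).2 hb⟩
  rcases w with _ | ⟨d, w⟩
  · rw [star_nil] at h
    simp at h
  obtain rfl : d = true := by
    rw [star_cons] at h
    have h := (List.cons.inj (List.append_cancel_left h)).1
    revert h; cases d <;> cases c <;> simp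
  refine ⟨w, rfl, fun t s hts ht => (star_lt hb).1 (hγ (blocks u (t.map (· == c))) _ ?_ ?_),
    (star_lt hb).1 h₂⟩
  · rw [hts, star_append]
  · rcases t with _ | ⟨e, t⟩
    · exact absurd rfl ht
    · rw [List.map_cons, blocks_cons]; simp

end

theorem Al_zero (a : ℕ) (α : List ℕ) : Al (a :: α) 0 = a := by simp [Al]

theorem Al_succ (a : ℕ) (α : List ℕ) (i : ℕ) : Al (a :: α) (i + 1) = - Al α i := by
  simp [Al, pow_succ]

theorem Al_nil (i : ℕ) : Al [] i = 0 := by simp [Al]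

theorem lexLt_cons {a b : ℕ} {α β : List ℕ} :
    lexLt (a :: α) (b :: β) ↔ a < b ∨ a = b ∧ lexLt β α := by
  constructor
  · rintro ⟨_ | i, h1, h2⟩
    · rw [Al_zero, Al_zero] at h2
      exact Or.inl (by exact_mod_cast h2)
    · have h0 := h1 0 (Nat.succ_pos i)
      rw [Al_zero, Al_zero] at h0
      refine Or.inr ⟨by exact_mod_cast h0, i, fun j hj => ?_, ?_⟩
      · have := h1 (j + 1) (by omega)
        rw [Al_succ, Al_succ] at this
        omega
      · rw [Al_succ, Al_succ] at h2
        omega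
  · rintro (h | ⟨rfl, i, h1, h2⟩)
    · exact ⟨0, by simp, by rw [Al_zero, Al_zero]; exact_mod_cast h⟩
    · refine ⟨i + 1, fun j hj => ?_, by rw [Al_succ, Al_succ]; omega⟩
      rcases j with _ | j
      · rw [Al_zero, Al_zero]
      · rw [Al_succ, Al_succ, h1 j (by omega)]

theorem not_lexLt_nil {α : List ℕ} (h : ∀ x ∈ α, 0 < x) : ¬ lexLt α [] := by
  rintro ⟨i, h1, h2⟩
  rcases α with _ | ⟨a, α⟩
  · exact lt_irrefl _ h2
  · have h3 : 0 < a := h a (by simp)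
    rcases i with _ | i
    · rw [Al_zero, Al_nil] at h2
      omega
    · have := h1 0 (Nat.succ_pos i)
      rw [Al_zero, Al_nil] at this
      omega

theorem nil_lexLt {a : ℕ} {α : List ℕ} (h : 0 < a) : lexLt [] (a :: α) :=
  ⟨0, by simp, by rw [Al_zero, Al_nil]; exact_mod_cast h⟩

theorem eq_of_not_lexLt {α : List ℕ} : ∀ {β : List ℕ}, (∀ x ∈ α, 0 < x) → (∀ x ∈ β, 0 < x) →
    ¬ lexLt α β → ¬ lexLt β α → α = β := by
  induction α with
  | nil =>
    rintro (_ | ⟨b, β⟩) - hβ h -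
    · rfl
    · exact absurd (nil_lexLt (hβ b (by simp))) h
  | cons a α ih =>
    rintro (_ | ⟨b, β⟩) hα hβ h h'
    · exact absurd (nil_lexLt (hα a (by simp))) h'
    · rw [lexLt_cons] at h h'
      push Not at h h'
      obtain rfl : a = b := le_antisymm h'.1 h.1
      rw [ih (fun x hx => hα x (by simp [hx])) (fun x hx => hβ x (by simp [hx])) (h'.2 rfl)
        (h.2 rfl)]

/-- The word of a sequence of positive integers: each entry `a` gives `true` followed by `a - 1`
letters `false`. -/
def enc (α : List ℕ) : List Bool := α.flatMap fun a => true :: List.replicate (a - 1) false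

@[simp] theorem enc_nil : enc [] = [] := rfl

theorem enc_cons (a : ℕ) (α : List ℕ) :
    enc (a :: α) = true :: (List.replicate (a - 1) false ++ enc α) := by simp [enc]

@[simp] theorem enc_append (α β : List ℕ) : enc (α ++ β) = enc α ++ enc β := by simp [enc]

theorem enc_cons_succ (a : ℕ) (α : List ℕ) :
    enc ((a + 2) :: α) = enc [a + 1] ++ false :: enc α := by
  simp [enc, List.replicate_succ']

theorem length_enc {α : List ℕ} (h : ∀ x ∈ α, 0 < x) : (enc α).length = α.sum := by
  induction α with
  | nil => rfl
  | cons a α ih =>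
    have h1 := h a (by simp)
    have h2 := ih fun x hx => h x (by simp [hx])
    rw [enc_cons, List.sum_cons, List.length_cons, List.length_append, List.length_replicate, h2]
    omega

theorem par_replicate_false (k : ℕ) : par (List.replicate k false) = false := by
  induction k with
  | zero => rfl
  | succ k ih => rw [List.replicate_succ, par_cons, ih]; rfl

theorem par_enc (α : List ℕ) : par (enc α) = false ↔ Even α.length := by
  induction α with
  | nil => simp
  | cons a α ih =>
    rw [enc_cons, par_cons, par_append, par_replicate_false, List.length_cons, Nat.even_add_one,
      ← ih]
    cases par (enc α) <;> simp

theorem lexLt_iff {α β : List ℕ} (hα : ∀ x ∈ α, 0 < x) (hβ : ∀ x ∈ β, 0 < x) :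
    lexLt α β ↔ enc α <ʷ enc β := by
  have nil_lt : ∀ a β, enc [] <ʷ enc (a :: β) := fun a β => by
    rw [enc_cons]; exact (end_lt (p := [])).2 rfl
  have lt : ∀ {a b : ℕ} {α β : List ℕ}, 0 < a → a < b → enc (a :: α) <ʷ enc (b :: β) := by
    intro a b α β ha hab
    have h : enc (b :: β) = (true :: List.replicate (a - 1) false) ++
        false :: (List.replicate (b - a - 1) false ++ enc β) := by
      rw [enc_cons, show b - 1 = (a - 1) + ((b - a - 1) + 1) by omega, List.replicate_add,
        List.replicate_succ]
      simp
    have hp : par ((true :: List.replicate (a - 1) false) ++ [false]) = true := by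
      rw [par_append, par_cons, par_replicate_false]; rfl
    rw [h, enc_cons, ← List.cons_append]
    rcases α with _ | ⟨c, α⟩
    · rw [enc_nil, List.append_nil]
      exact end_lt.2 hp
    · rw [enc_cons]
      exact (diff_lt (by simp)).2 hp
  induction h : α.length + β.length using Nat.strong_induction_on generalizing α β with
  | _ n ih =>
    rcases α with _ | ⟨a, α⟩ <;> rcases β with _ | ⟨b, β⟩
    · exact iff_of_false (not_lexLt_nil hα) (wlt_irrefl _)
    · exact iff_of_true (nil_lexLt (hβ b (by simp))) (nil_lt b β)
    · exact iff_of_false (not_lexLt_nil hα) fun h => wlt_asymm h (nil_lt a α)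
    · rw [lexLt_cons]
      rcases lt_trichotomy a b with h' | rfl | h'
      · exact iff_of_true (Or.inl h') (lt (hα a (by simp)) h')
      · have h1 : lexLt β α ↔ enc β <ʷ enc α := ih (β.length + α.length) (by simp at h; omega)
          (fun x hx => hβ x (by simp [hx])) (fun x hx => hα x (by simp [hx])) rfl
        rw [enc_cons, enc_cons, ← List.cons_append, ← List.cons_append, append_lt_odd, ← h1]
        · simp
        · rw [par_cons, par_replicate_false]; rfl
      · exact iff_of_false (by omega) fun h => wlt_asymm h (lt (hβ b (by simp)) h')

theorem enc_inj {α β : List ℕ} (hα : ∀ x ∈ α, 0 < x) (hβ : ∀ x ∈ β, 0 < x)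
    (h : enc α = enc β) : α = β := by
  refine eq_of_not_lexLt hα hβ ?_ ?_
  · rw [lexLt_iff hα hβ, h]; exact wlt_irrefl _
  · rw [lexLt_iff hβ hα, h]; exact wlt_irrefl _

theorem exists_replicate_enc (w : List Bool) :
    ∃ k α, (∀ x ∈ α, 0 < x) ∧ w = List.replicate k false ++ enc α := by
  induction w with
  | nil => exact ⟨0, [], by simp, rfl⟩
  | cons c w ih =>
    obtain ⟨k, α, hα, rfl⟩ := ih
    rcases c with _ | _
    · exact ⟨k + 1, α, hα, rfl⟩
    · refine ⟨0, (k + 1) :: α, ?_, by rw [enc_cons]; rfl⟩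
      rintro x (_ | ⟨_, hx⟩)
      · omega
      · exact hα x hx

theorem exists_enc {w : List Bool} (h : w.head? ≠ some false) :
    ∃ α, (∀ x ∈ α, 0 < x) ∧ enc α = w := by
  obtain ⟨_ | k, α, hα, rfl⟩ := exists_replicate_enc w
  · exact ⟨α, hα, rfl⟩
  · exact absurd rfl h

theorem enc_head (α : List ℕ) : (enc α).head? ≠ some false := by
  rcases α with _ | ⟨a, α⟩ <;> simp [enc_cons]

theorem enc_ne_nil {α : List ℕ} (h : α ≠ []) : enc α ≠ [] := by
  rcases α with _ | ⟨a, α⟩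
  · exact absurd rfl h
  · simp [enc_cons]

theorem enc_split {α : List ℕ} {t s : List Bool} (hα : ∀ x ∈ α, 0 < x) (h : enc α = t ++ s)
    (hs : s.head? ≠ some false) : ∃ α₁ α₂, α = α₁ ++ α₂ ∧ enc α₁ = t ∧ enc α₂ = s := by
  obtain ⟨α₂, h₂, rfl⟩ := exists_enc hs
  obtain ⟨α₁, h₁, rfl⟩ : ∃ α, (∀ x ∈ α, 0 < x) ∧ enc α = t := by
    refine exists_enc ?_
    have := enc_head α
    rw [h] at this
    rcases t with _ | ⟨c, t⟩ <;> simp_all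
  refine ⟨α₁, α₂, enc_inj hα ?_ (by rw [h, enc_append]), rfl, rfl⟩
  intro x hx
  rcases List.mem_append.1 hx with hx | hx
  exacts [h₁ x hx, h₂ x hx]

theorem isLexical_iff {α : List ℕ} : IsLexical α ↔ IsAlphaSeq α ∧ Max (enc α) := by
  refine and_congr_right fun ⟨hne, hα⟩ => ⟨fun h t s hts ht => ?_, fun h i h1 h2 => ?_⟩
  · obtain ⟨x, hx⟩ : ∃ x, enc α = true :: x := by
      rcases α with _ | ⟨a, α⟩
      · exact absurd rfl hne
      · exact ⟨_, enc_cons a α⟩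
    by_cases hs : s.head? = some false
    · obtain ⟨s, rfl⟩ : ∃ s', s = false :: s' := by
        rcases s with _ | ⟨e, s⟩
        · simp at hs
        · exact ⟨s, by simpa using hs⟩
      rw [hx]
      exact (diff_lt (p := []) (by simp)).2 rfl
    obtain ⟨α₁, α₂, rfl, rfl, rfl⟩ := enc_split hα hts hs
    rcases α₂ with _ | ⟨a, α₂⟩
    · rw [hx]
      exact (end_lt (p := [])).2 rfl
    have hα₁ : α₁ ≠ [] := by rintro rfl; exact ht rfl
    have := h (α₁.length + 1) (by have := List.length_pos_iff.2 hα₁; omega) (by simp)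
    rw [Nat.add_sub_cancel, List.drop_left] at this
    exact (lexLt_iff (fun x hx => hα x (by simp at hx ⊢; tauto)) hα).1 this
  · refine (lexLt_iff (fun x hx => hα x (List.mem_of_mem_drop hx)) hα).2
      (h (enc (α.take (i - 1))) _ (by rw [← enc_append, List.take_append_drop]) (enc_ne_nil ?_))
    rw [Ne, List.take_eq_nil_iff]
    exact fun h => h.elim (by omega) hne

theorem wedge_append (p α β : List ℕ) : wedge (p ++ α) (p ++ β) = p ++ wedge α β := by
  induction p with
  | nil => rfl
  | cons a p ih => rw [List.cons_append, List.cons_append, wedge, if_pos rfl, ih]; rfl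

theorem exists_elemOpAt {α : List ℕ} {j : ℕ} (hα : ∀ x ∈ α, 0 < x) (h2 : 2 ≤ j)
    (hj : j ≤ α.length) : ∃ α', ElemOpAt α j α' := by
  have h : 0 < α.getD (j - 1) 0 := by
    rw [List.getD_eq_getElem _ _ (by omega)]
    exact hα _ (List.getElem_mem _)
  rcases Nat.lt_or_ge 1 (α.getD (j - 1) 0) with h' | h'
  · exact ⟨_, Or.inl ⟨⟨by omega, hj, h'⟩, rfl⟩⟩
  · exact ⟨_, Or.inr ⟨⟨h2, hj, by omega⟩, rfl⟩⟩

theorem exists_eq_append_cons {α : List ℕ} {j : ℕ} (h : j < α.length) :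
    ∃ β a γ, α = β ++ a :: γ ∧ β.length = j :=
  ⟨α.take j, α[j], α.drop (j + 1), by rw [List.cons_getElem_drop_succ, List.take_append_drop],
    by simp; omega⟩

/-- An elementary operation at an even cell flips a letter of the word. -/
theorem flip_of_elemOpAt {α α' : List ℕ} {j : ℕ} (hα : ∀ x ∈ α, 0 < x) (hj : Even j)
    (hop : ElemOpAt α j α') :
    ∃ g d α₁ α₂, α = α₁ ++ α₂ ∧ α₁.length = j ∧ enc α₁ = g ++ [d] ∧
      enc α' = g ++ (!d) :: enc α₂ ∧ enc (wedge α α') = g ∧ IsAlphaSeq α' := by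
  rcases hop with ⟨⟨h1, h2, h3⟩, rfl⟩ | ⟨⟨h1, h2, h3⟩, rfl⟩
  · obtain ⟨k, rfl⟩ := Nat.exists_eq_add_of_le' h1
    obtain ⟨β, a, γ, rfl, rfl⟩ := exists_eq_append_cons h2
    obtain ⟨a, rfl⟩ : ∃ b, a = b + 2 := ⟨a - 2, by simp at h3; omega⟩
    have happ : applyEs (β ++ (a + 2) :: γ) (β.length + 1) = β ++ (a + 1) :: 1 :: γ := by
      simp [applyEs]
    refine ⟨enc β ++ enc [a + 1], false, β ++ [a + 2], γ, by simp, by simp, ?_, ?_, ?_, ?_⟩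
    · rw [enc_append, enc_cons_succ]; simp
    · rw [happ, enc_append, show (a + 1) :: 1 :: γ = [a + 1] ++ 1 :: γ from rfl, enc_append,
        enc_cons 1]
      simp
    · rw [happ, wedge_append, wedge, if_neg (by omega), enc_append]
      simp
    · rw [happ]
      refine ⟨by simp, fun x hx => ?_⟩
      simp at hx
      rcases hx with hx | rfl | rfl | hx
      · exact hα x (by simp [hx])
      · omega
      · omega
      · exact hα x (by simp [hx])
  · obtain ⟨k, rfl⟩ := Nat.exists_eq_add_of_le' h1
    obtain ⟨β, a, γ, rfl, rfl⟩ := exists_eq_append_cons (show k < α.length by omega)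
    rcases γ with _ | ⟨e, γ⟩
    · simp at h2
    obtain rfl : e = 1 := by
      simpa [List.getD_append_right] using h3
    obtain ⟨a, rfl⟩ : ∃ b, a = b + 1 := ⟨a - 1, by have := hα a (by simp); omega⟩
    have happ : applyEc (β ++ (a + 1) :: 1 :: γ) (β.length + 2) = β ++ (a + 2) :: γ := by
      simp [applyEc]
    refine ⟨enc β ++ enc [a + 1], true, β ++ [a + 1, 1], γ, by simp, by simp, ?_, ?_, ?_, ?_⟩
    · rw [enc_append, show [a + 1, 1] = [a + 1] ++ [1] from rfl, enc_append, enc_cons 1]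
      simp
    · rw [happ, enc_append, enc_cons_succ]; simp
    · rw [happ, wedge_append, wedge, if_neg (by omega), enc_append]
      simp
    · rw [happ]
      refine ⟨by simp, fun x hx => ?_⟩
      simp at hx
      rcases hx with hx | rfl | hx
      · exact hα x (by simp [hx])
      · omega
      · exact hα x (by simp [hx])

/-- A flip at an even boundary giving a maximal word is a good even index. -/
theorem goodEvenIndex_of_flip {α : List ℕ} {g w : List Bool} {d : Bool} (hα : ∀ x ∈ α, 0 < x)
    (h : enc α = g ++ d :: w) (hpar : par (g ++ [d]) = false) (hw : w.head? ≠ some false)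
    (hM : Max (g ++ (!d) :: w)) :
    ∃ α₁ α₂, α = α₁ ++ α₂ ∧ enc α₁ = g ++ [d] ∧ GoodEvenIndex α α₁.length := by
  rw [cons_eq] at h
  obtain ⟨α₁, α₂, rfl, h₁, rfl⟩ := enc_split hα h hw
  have hev : Even α₁.length := by rw [← par_enc, h₁, hpar]
  have hne : α₁.length ≠ 0 := by
    intro h0
    rw [List.length_eq_zero_iff.1 h0] at h₁
    simp at h₁
  obtain ⟨α', hop⟩ := exists_elemOpAt hα (j := α₁.length) (by obtain ⟨k, hk⟩ := hev; omega) (by simp)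
  obtain ⟨g', d', β₁, β₂, e1, e2, e3, e4, -, e5⟩ := flip_of_elemOpAt hα hev hop
  obtain ⟨rfl, rfl⟩ := List.append_inj e1 e2.symm
  obtain ⟨rfl, e⟩ := List.append_inj' (h₁.symm.trans e3) rfl
  obtain rfl : d = d' := by simpa using e
  exact ⟨α₁, α₂, rfl, h₁, hev, α', hop, isLexical_iff.2 ⟨e5, by rwa [e4]⟩⟩

theorem enc_bumpLast {f : List ℕ} (hf : IsAlphaSeq f) : enc (bumpLast f) = enc f ++ [false] := by
  obtain ⟨p, a, rfl⟩ : ∃ p a, f = p ++ [a] := ⟨_, _, (List.dropLast_append_getLast hf.1).symm⟩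
  have := hf.2 a (by simp)
  obtain ⟨a, rfl⟩ := Nat.exists_eq_add_of_le' this
  have h : bumpLast (p ++ [a + 1]) = p ++ [a + 2] := by simp [bumpLast]
  rw [h, enc_append, enc_append, enc_cons_succ]
  simp

theorem enc_seqO {f : List ℕ} {b : Bool} (hf : IsAlphaSeq f) (hb : par (enc f ++ [b]) = true) :
    enc (seqO f) = enc f ++ [b] := by
  rw [seqO]
  rw [par_append] at hb
  split_ifs with h
  · rw [(par_enc f).2 h] at hb
    obtain rfl : b = true := by simpa using hb
    rw [enc_append, enc_cons]; simp
  · rw [(par_enc f).not.2 h |> eq_true_of_ne_false] at hb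
    obtain rfl : b = false := by simpa using hb
    rw [enc_bumpLast hf]

theorem enc_seqE {f : List ℕ} {b : Bool} (hf : IsAlphaSeq f) (hb : par (enc f ++ [b]) = true) :
    enc (seqE f) = enc f ++ [!b] := by
  rw [seqE]
  rw [par_append] at hb
  split_ifs with h
  · rw [(par_enc f).2 h] at hb
    obtain rfl : b = true := by simpa using hb
    rw [enc_bumpLast hf]; rfl
  · rw [(par_enc f).not.2 h |> eq_true_of_ne_false] at hb
    obtain rfl : b = false := by simpa using hb
    rw [enc_append, enc_cons]; simp

theorem pos_starProd {f : List ℕ} (hf : ∀ x ∈ f, 0 < x) (lam : List ℕ) :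
    ∀ x ∈ starProd f lam, 0 < x := by
  have hB : ∀ x ∈ bumpLast f, 0 < x := by
    intro x hx
    rcases List.mem_append.1 hx with hx | hx
    · exact hf x (List.mem_of_mem_dropLast hx)
    · rw [List.mem_singleton.1 hx]; omega
  have h1 : ∀ x ∈ f ++ [1], 0 < x := by
    intro x hx
    rcases List.mem_append.1 hx with hx | hx
    · exact hf x hx
    · rw [List.mem_singleton.1 hx]; omega
  have hE : ∀ x ∈ seqE f, 0 < x := by rw [seqE]; split_ifs <;> assumption
  have hO : ∀ x ∈ seqO f, 0 < x := by rw [seqO]; split_ifs <;> assumption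
  intro x hx
  simp only [starProd, nrep, List.mem_append, List.mem_flatten, List.mem_map] at hx
  rcases hx with ⟨_, ⟨b, -, rfl⟩, hx⟩ | hx
  · rcases List.mem_append.1 hx with hx | hx
    · exact hO x hx
    · obtain ⟨l, hl, hx⟩ := List.mem_flatten.1 hx
      rw [List.eq_of_mem_replicate hl] at hx
      exact hE x hx
  · exact hf x hx

theorem enc_starProd {f : List ℕ} {b : Bool} (hf : IsAlphaSeq f)
    (hb : par (enc f ++ [b]) = true) (lam : List ℕ) :
    enc (starProd f lam) = star (enc f) b (enc lam) := by
  have hE : ∀ k, enc (nrep (seqE f) k) = blocks (enc f) ((List.replicate k false).map (· == b)) := by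
    intro k
    induction k with
    | zero => rfl
    | succ k ih =>
      have : nrep (seqE f) (k + 1) = seqE f ++ nrep (seqE f) k := by
        simp [nrep, List.replicate_succ]
      rw [this, enc_append, ih, enc_seqE hf hb, List.replicate_succ, List.map_cons, blocks_cons]
      cases b <;> simp
  induction lam with
  | nil => rfl
  | cons a lam ih =>
    have h : starProd f (a :: lam) = seqO f ++ (nrep (seqE f) (a - 1) ++ starProd f lam) := by
      simp [starProd]
    rw [h, enc_append, enc_append, hE, ih, enc_seqO hf hb, enc_cons, star_cons, star_append]
    cases b <;> simp

end Word

/-- adjacency criterion, case `r = 0`: `α` is adjacent to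
`f ⋆ λ` in `L_n`, where `λ` is the least element of `L_d`, `d = n / m`. -/
theorem stmt_12 (n : ℕ) (hn : 3 ≤ n) (α : List ℕ) (hα : α ∈ Lset n)
    (hng : ¬ GreatestIn (Lset n) α)
    (i : ℕ) (hi : GoodEvenIndex α i) (himax : ∀ j, GoodEvenIndex α j → j ≤ i)
    (α' : List ℕ) (hop : ElemOpAt α i α') (hα' : α' ∈ Lset n)
    (f : List ℕ) (hf : f = wedge α α') (hflex : IsLexical f)
    (m d : ℕ) (hm : m = 1 + f.sum) (hmd : n = m * d)
    (lam : List ℕ) (hlam : LeastIn (Lset d) lam) :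
    AdjLtIn (Lset n) α (starProd f lam) := by
  obtain ⟨hαL, hαn⟩ := hα
  obtain ⟨⟨-, hαpos⟩, hαM⟩ := Word.isLexical_iff.1 hαL
  obtain ⟨u, a, α₁, α₂, rfl, rfl, h₁, -, hu, -⟩ := Word.flip_of_elemOpAt hαpos hi.1 hop
  rw [← hf] at hu
  have hfA := hflex.1
  have hpar : Word.par (u ++ [a]) = false := by rw [← h₁, Word.par_enc]; exact hi.1
  have hb : Word.par (Word.enc f ++ [!a]) = true := by rw [hu]; exact Word.par_flip hpar
  have henc : Word.enc (α₁ ++ α₂) = u ++ a :: Word.enc α₂ := by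
    rw [Word.enc_append, h₁]; simp
  rw [henc] at hαM
  obtain ⟨⟨hlamL, hlamd⟩, hlamin⟩ := hlam
  obtain ⟨hlamA, -⟩ := Word.isLexical_iff.1 hlamL
  obtain ⟨x, hx⟩ : ∃ x, Word.enc lam = true :: x := by
    rcases lam with _ | ⟨c, lam⟩
    · exact absurd rfl hlamA.1
    · exact ⟨_, Word.enc_cons c lam⟩
  have hlaml : (Word.enc lam).length + 1 = d := by rw [Word.length_enc hlamA.2, ← hlamd, add_comm]
  have hul : u.length + 1 = m := by rw [← hu, Word.length_enc hfA.2, hm, add_comm]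
  have hstar := Word.enc_starProd hfA hb lam
  have hpos : ∀ x ∈ starProd f lam, 0 < x := Word.pos_starProd hfA.2 lam
  rw [hu] at hstar hb
  refine ⟨(Word.lexLt_iff hαpos hpos).2 ?_, ?_⟩
  · rw [henc, hstar, hx, Word.star_cons]
    exact (Word.diff_lt (by cases a <;> simp)).2 (by cases a <;> exact hb)
  · rintro γ ⟨hγL, hγn⟩ ⟨h₂, h₃⟩
    obtain ⟨⟨-, hγpos⟩, hγM⟩ := Word.isLexical_iff.1 hγL
    have hγl : (Word.enc γ).length + 1 = n := by rw [Word.length_enc hγpos, ← hγn, add_comm]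
    rw [Word.lexLt_iff hαpos hγpos, henc] at h₂
    rw [Word.lexLt_iff hγpos hpos, hstar, hx] at h₃
    by_cases hne : Word.enc γ = u
    · have : m = m * d := by rw [← hmd, ← hγl, hne, hul]
      rw [hx, List.length_cons] at hlaml
      have h := Nat.eq_of_mul_eq_mul_left (by omega) ((mul_one m).trans this)
      omega
    rcases Word.wlt_tri hne with h | h
    · refine Word.false_of_between hαM hpar ?_ hγM ?_ h₂ h
      · intro g e w h4 h5 h6 h7 h8
        obtain ⟨β₁, β₂, h9, h10, h11⟩ := Word.goodEvenIndex_of_flip hαpos (henc.trans h4) h6 h7 h8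
        have h12 := himax _ h11
        obtain ⟨c, rfl⟩ := List.prefix_of_prefix_length_le ⟨_, h9.symm⟩ ⟨_, rfl⟩ h12
        rw [Word.enc_append, h10] at h₁
        have := congrArg List.length h₁
        simp at this
        omega
      · rw [← henc, Word.length_enc hγpos, Word.length_enc hαpos]; omega
    · obtain ⟨w, h4, h5, h6⟩ := Word.exists_eq_star_of_max hb hγM h h₃
      obtain ⟨β, hβ, hβw⟩ := Word.exists_enc (w := true :: w) (by simp)
      have hβA : IsAlphaSeq β := ⟨by rintro rfl; simp at hβw, hβ⟩
      rw [← hβw] at h4 h5 h6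
      rw [← hx, ← Word.lexLt_iff hβ hlamA.2] at h6
      refine Word.wlt_asymm ((Word.lexLt_iff hβ hlamA.2).1 h6)
        ((Word.lexLt_iff hlamA.2 hβ).1 (hlamin β ⟨Word.isLexical_iff.2 ⟨hβA, h5⟩, ?_⟩ ?_))
      · have h7 := Word.length_star (u := u) (b := !a) (w := Word.enc β)
        rw [← h4, hγl, hmd, hul, Word.length_enc hβ] at h7
        have := Nat.eq_of_mul_eq_mul_left (by omega) h7
        omega
      · rintro rfl
        exact Word.wlt_irrefl _ ((Word.lexLt_iff hβ hβ).1 h6)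
end
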